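/- Assume Hypotheses 1–3. For every x ∈ 𝕏 and y ∈ ℝ, lim_{n→∞} n^{3/2}·ℙ_x( τ_y = n ) = (2V(x,y)/(√(2π)σ³)) · ∫₀^{∞} 𝔼*_ν( V*(X*₁, z) ; S*₁ ≥ z ) dz. -/

import Mathlib

open Finset Filter Real Topology MeasureTheory

namespace CLLT

variable {X : Type*}

/-- Product of the transition weights along a path. -/
noncomputable def wt (P : X → X → ℝ) : X → List X → ℝ
  | _, [] => 1
  | x, y :: ys => P x y * wt P y ys

/-- Extension of a finite path `X₁, …, Xₙ` to a trajectory `ℕ → X` with `X₀ = x`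
(values beyond time `n` are irrelevant and set to `x`). -/
def pathExt (x : X) {n : ℕ} (path : Fin n → X) : ℕ → X := fun k =>
  if h : 1 ≤ k ∧ k ≤ n then path ⟨k - 1, by omega⟩ else x

/-- Expectation `𝔼_x (F (X₀, X₁, …))` of a functional of the first `n` steps of the
Markov chain with transition kernel `P` started at `X₀ = x`. -/
noncomputable def Ex [Fintype X] (P : X → X → ℝ) (x : X) (n : ℕ)
    (F : (ℕ → X) → ℝ) : ℝ :=
  ∑ path : Fin n → X, wt P x (List.ofFn path) * F (pathExt x path)

open Classical in
/-- Real-valued indicator of a proposition. -/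
noncomputable def ind (p : Prop) : ℝ := if p then 1 else 0

/-- Partial sum `S_k = f(X₁) + ⋯ + f(X_k)` along a trajectory. -/
noncomputable def Spath (f : X → ℝ) (ω : ℕ → X) (k : ℕ) : ℝ :=
  ∑ i ∈ Finset.Icc 1 k, f (ω i)

/-- The event `τ_y > n`, i.e. `y + S_k > 0` for all `k = 1, …, n`. -/
def survives (f : X → ℝ) (y : ℝ) (n : ℕ) (ω : ℕ → X) : Prop :=
  ∀ k ∈ Finset.Icc 1 n, 0 < y + Spath f ω k

/-- `n`-step transition kernel. -/
noncomputable def kpow [Fintype X] [DecidableEq X] (P : X → X → ℝ) : ℕ → X → X → ℝ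
  | 0 => fun x x' => if x = x' then 1 else 0
  | n + 1 => fun x x' => ∑ y, P x y * kpow P n y x'

/-- Transition operator acting on functions. -/
noncomputable def Pop [Fintype X] (P : X → X → ℝ) (g : X → ℝ) (x : X) : ℝ :=
  ∑ x', P x x' * g x'

/-- Asymptotic variance `σ² = ν(f²) + 2 ∑_{n ≥ 1} ν(f ⬝ Pⁿ f)`. -/
noncomputable def sigma2 [Fintype X] (P : X → X → ℝ) (ν f : X → ℝ) : ℝ :=
  (∑ x, f x ^ 2 * ν x) + 2 * ∑' n : ℕ, ∑ x, f x * ((Pop P)^[n + 1] f) x * ν x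

/-- Hypothesis 1 (primitivity). -/
def Primitive [Fintype X] [DecidableEq X] (P : X → X → ℝ) : Prop :=
  ∃ k₀ : ℕ, 1 ≤ k₀ ∧ ∀ x x', 0 < kpow P k₀ x x'

/-- Hypothesis 3 (non-lattice condition). -/
def NonLattice [Fintype X] (P : X → X → ℝ) (f : X → ℝ) : Prop :=
  ∀ θ a : ℝ, ∃ (n : ℕ) (g : Fin (n + 1) → X),
    (0 < ∏ i : Fin (n + 1), P (g i) (g (i + 1))) ∧
    ∀ m : ℤ, (∑ i, f (g i)) - (n + 1 : ℝ) * θ ≠ a * (m : ℝ)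

/-- `P` is a stochastic matrix and `ν` is a positive invariant probability for it. -/
structure IsStochastic [Fintype X] (P : X → X → ℝ) (ν : X → ℝ) : Prop where
  nonneg : ∀ x x', 0 ≤ P x x'
  rowSum : ∀ x, ∑ x', P x x' = 1
  nuPos : ∀ x, 0 < ν x
  nuSum : ∑ x, ν x = 1
  nuInv : ∀ x', ∑ x, ν x * P x x' = ν x'

/-- Dual kernel `P*(x, x') = ν(x') P(x', x) / ν(x)`. -/
noncomputable def dualK (P : X → X → ℝ) (ν : X → ℝ) (x x' : X) : ℝ :=
  ν x' * P x' x / ν x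

/-- Sup norm of a function on a finite set. -/
noncomputable def supN [Fintype X] [Nonempty X] (ψ : X → ℝ) : ℝ := ⨆ x, |ψ x|

/-- Rayleigh density `φ₊(t) = t e^{-t²/2} 𝟙_{t ≥ 0}`. -/
noncomputable def rayleigh (t : ℝ) : ℝ := if 0 ≤ t then t * Real.exp (-t ^ 2 / 2) else 0

/-- Centred normal density with standard deviation `s`. -/
noncomputable def gauss (s u : ℝ) : ℝ :=
  Real.exp (-u ^ 2 / (2 * s ^ 2)) / (s * Real.sqrt (2 * π))

/-- Perturbed transition operator `P_t`, as a complex matrix. -/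
noncomputable def Pmat [Fintype X] (P : X → X → ℝ) (f : X → ℝ) (t : ℝ) : Matrix X X ℂ :=
  Matrix.of fun x x' => (P x x' : ℂ) * Complex.exp (Complex.I * (t : ℂ) * (f x' : ℂ))

/-- A complex matrix viewed as a continuous linear operator on `X → ℂ`
(equipped with the sup norm). -/
noncomputable def toCLM [Fintype X] (M : Matrix X X ℂ) : (X → ℂ) →L[ℂ] (X → ℂ) :=
  LinearMap.toContinuousLinearMap M.mulVecLin

/-- Fourier transform `ĥ(t) = ∫ e^{-i t u} h(u) du`. -/
noncomputable def FT (h : ℝ → ℝ) (t : ℝ) : ℂ :=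
  ∫ u : ℝ, Complex.exp (-(Complex.I * (t : ℂ) * (u : ℂ))) * (h u : ℂ)

/-- Convolution `(g ∗ k)(u) = ∫ g(v) k(u - v) dv`. -/
noncomputable def convR (g k : ℝ → ℝ) (u : ℝ) : ℝ := ∫ v : ℝ, g v * k (u - v)

/-- Stone's kernel `κ`. -/
noncomputable def kapp (u : ℝ) : ℝ :=
  if u = 0 then 1 / (2 * π) else (Real.sin (u / 2) / (u / 2)) ^ 2 / (2 * π)

/-- Scaled kernel `κ_δ(u) = κ(u/δ)/δ`. -/
noncomputable def kappD (δ u : ℝ) : ℝ := kapp (u / δ) / δ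

/-- Upper regularisation `h̄_ε(u) = sup_{v ∈ [u-ε, u+ε]} h(v)`. -/
noncomputable def upReg (h : ℝ → ℝ) (ε u : ℝ) : ℝ := sSup (h '' Set.Icc (u - ε) (u + ε))

/-- Lower regularisation `ẖ_ε(u) = inf_{v ∈ [u-ε, u+ε]} h(v)`. -/
noncomputable def loReg (h : ℝ → ℝ) (ε u : ℝ) : ℝ := sInf (h '' Set.Icc (u - ε) (u + ε))

/-- The class `𝓗_ε`: non-negative, locally bounded, with `h`, `h̄_ε`, `ẖ_ε`
measurable and Lebesgue integrable. -/
def MemH (ε : ℝ) (h : ℝ → ℝ) : Prop :=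
  (∀ u, 0 ≤ h u) ∧ (∀ K : Set ℝ, IsCompact K → BddAbove (h '' K)) ∧
  Measurable h ∧ Measurable (upReg h ε) ∧ Measurable (loReg h ε) ∧
  Integrable h ∧ Integrable (upReg h ε) ∧ Integrable (loReg h ε)


set_option linter.unusedSectionVars false
/-! ### Part 1 -/


/-! ### S1: operators -/

/-- weighted one-step operator -/
noncomputable def opW [Fintype X] (P : X → X → ℝ) (f : X → ℝ) (w : ℝ → ℝ) :
    Module.End ℝ (X → ℝ → ℝ) where
  toFun h := fun x y => ∑ b, P x b * (w (y + f b) * h b (y + f b))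
  map_add' h h' := by
    funext x y
    simp [mul_add, Finset.sum_add_distrib]
  map_smul' c h := by
    funext x y
    simp only [Pi.smul_apply, smul_eq_mul, RingHom.id_apply, Finset.mul_sum]
    exact Finset.sum_congr rfl fun b _ => by ring

noncomputable def Uo [Fintype X] (P : X → X → ℝ) (f : X → ℝ) := opW P f (fun _ => 1)
noncomputable def Ko [Fintype X] (P : X → X → ℝ) (f : X → ℝ) := opW P f (fun y => ind (0 < y))
noncomputable def Lo [Fintype X] (P : X → X → ℝ) (f : X → ℝ) := opW P f (fun y => ind (y ≤ 0))

lemma ind_nonneg (p : Prop) : 0 ≤ ind p := by unfold ind; split_ifs <;> norm_num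
lemma ind_le_one (p : Prop) : ind p ≤ 1 := by unfold ind; split_ifs <;> norm_num
lemma ind_true {p : Prop} (h : p) : ind p = 1 := by simp [ind, h]
lemma ind_false {p : Prop} (h : ¬ p) : ind p = 0 := by simp [ind, h]
lemma ind_and (p q : Prop) : ind (p ∧ q) = ind p * ind q := by
  by_cases hp : p <;> by_cases hq : q <;> simp [ind, hp, hq]
lemma ind_mono {p q : Prop} (h : p → q) : ind p ≤ ind q := by
  by_cases hp : p
  · simp [ind, hp, h hp]
  · simpa [ind, hp] using ind_nonneg q
lemma ind_congr {p q : Prop} (h : p ↔ q) : ind p = ind q := by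
  rw [propext h]
lemma ind_pos_add (y : ℝ) : ind (0 < y) + ind (y ≤ 0) = 1 := by
  by_cases h : 0 < y
  · rw [ind_true h, ind_false (not_le.2 h)]; norm_num
  · rw [ind_false h, ind_true (not_lt.1 h)]; norm_num

section
variable [Fintype X] {P : X → X → ℝ} {ν f : X → ℝ}

lemma Uo_apply (h : X → ℝ → ℝ) (x : X) (y : ℝ) :
    Uo P f h x y = ∑ b, P x b * h b (y + f b) := by simp [Uo, opW]
lemma Ko_apply (h : X → ℝ → ℝ) (x : X) (y : ℝ) :
    Ko P f h x y = ∑ b, P x b * (ind (0 < y + f b) * h b (y + f b)) := rfl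
lemma Lo_apply (h : X → ℝ → ℝ) (x : X) (y : ℝ) :
    Lo P f h x y = ∑ b, P x b * (ind (y + f b ≤ 0) * h b (y + f b)) := rfl

lemma Ko_add_Lo : Ko P f + Lo P f = Uo P f := by
  ext h x y
  simp only [LinearMap.add_apply, Pi.add_apply]
  rw [Uo_apply, Ko_apply, Lo_apply, ← Finset.sum_add_distrib]
  refine Finset.sum_congr rfl fun b _ => ?_
  rw [← mul_add, ← add_mul, ind_pos_add, one_mul]

lemma opW_mono (hP : ∀ x x', 0 ≤ P x x') {w : ℝ → ℝ} (hw : ∀ y, 0 ≤ w y)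
    {h h' : X → ℝ → ℝ} (hh : ∀ x y, h x y ≤ h' x y) (x : X) (y : ℝ) :
    opW P f w h x y ≤ opW P f w h' x y := by
  refine Finset.sum_le_sum fun b _ => ?_
  exact mul_le_mul_of_nonneg_left (mul_le_mul_of_nonneg_left (hh _ _) (hw _)) (hP _ _)

/-- positive operator -/
def PosOp (A : Module.End ℝ (X → ℝ → ℝ)) : Prop :=
  ∀ h h' : X → ℝ → ℝ, (∀ x y, h x y ≤ h' x y) → ∀ x y, A h x y ≤ A h' x y

lemma PosOp.mul {A B : Module.End ℝ (X → ℝ → ℝ)} (hA : PosOp A) (hB : PosOp B) :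
    PosOp (A * B) := fun _ _ hh => hA _ _ (hB _ _ hh)

lemma PosOp.pow {A : Module.End ℝ (X → ℝ → ℝ)} (hA : PosOp A) (n : ℕ) : PosOp (A ^ n) := by
  induction n with
  | zero => intro h h' hh; simpa using hh
  | succ n ih => rw [pow_succ]; exact ih.mul hA

lemma PosOp.nonneg {A : Module.End ℝ (X → ℝ → ℝ)} (hA : PosOp A) {h : X → ℝ → ℝ}
    (hh : ∀ x y, 0 ≤ h x y) (x : X) (y : ℝ) : 0 ≤ A h x y := by
  have := hA 0 h hh x y
  simpa using this

lemma PosOp.le_const {A : Module.End ℝ (X → ℝ → ℝ)} (hA : PosOp A) {h : X → ℝ → ℝ} {B : ℝ}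
    (hh : ∀ x y, h x y ≤ B) (x : X) (y : ℝ) : A h x y ≤ B * A 1 x y := by
  have := hA h (B • 1) (by simpa using hh) x y
  simpa using this

lemma PosOp.abs_le_const {A : Module.End ℝ (X → ℝ → ℝ)} (hA : PosOp A) {h : X → ℝ → ℝ} {B : ℝ}
    (hh : ∀ x y, |h x y| ≤ B) (x : X) (y : ℝ) : |A h x y| ≤ B * A 1 x y := by
  rw [abs_le]
  constructor
  · have := hA.le_const (h := -h) (B := B) (fun x y => by
      have := (abs_le.1 (hh x y)).1
      simp; linarith) x y
    simp at this; linarith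
  · exact hA.le_const (fun x y => (abs_le.1 (hh x y)).2) x y

lemma posU (hS : IsStochastic P ν) : PosOp (Uo P f) :=
  fun _ _ hh => opW_mono hS.nonneg (fun _ => zero_le_one) hh
lemma posK (hS : IsStochastic P ν) : PosOp (Ko P f) :=
  fun _ _ hh => opW_mono hS.nonneg (fun _ => ind_nonneg _) hh
lemma posL (hS : IsStochastic P ν) : PosOp (Lo P f) :=
  fun _ _ hh => opW_mono hS.nonneg (fun _ => ind_nonneg _) hh

lemma Uo_one (hS : IsStochastic P ν) : Uo P f 1 = 1 := by
  funext x y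
  rw [Uo_apply]; simp [hS.rowSum]

lemma Uo_pow_one (hS : IsStochastic P ν) (n : ℕ) : (Uo P f ^ n) 1 = 1 := by
  induction n with
  | zero => simp
  | succ n ih => rw [pow_succ, Module.End.mul_apply, Uo_one hS, ih]

/-- survival probability -/
noncomputable def surv (P : X → X → ℝ) (f : X → ℝ) (n : ℕ) : X → ℝ → ℝ := (Ko P f ^ n) 1
/-- exit probability `P(τ = n+1)` -/
noncomputable def exi (P : X → X → ℝ) (f : X → ℝ) (n : ℕ) : X → ℝ → ℝ := (Ko P f ^ n) (Lo P f 1)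

lemma surv_zero : surv P f 0 = 1 := by simp [surv]
lemma surv_succ (n : ℕ) : surv P f (n + 1) = Ko P f (surv P f n) := by
  simp [surv, pow_succ']

lemma exi_eq (hS : IsStochastic P ν) (n : ℕ) (x : X) (y : ℝ) :
    exi P f n x y = surv P f n x y - surv P f (n + 1) x y := by
  have h1 : Lo P f 1 = 1 - Ko P f 1 := by
    have := congrArg (fun A => A 1) (Ko_add_Lo (P := P) (f := f))
    simp only [LinearMap.add_apply, Uo_one hS] at this
    exact eq_sub_of_add_eq' this
  simp [exi, surv, h1, pow_succ]

lemma surv_nonneg (hS : IsStochastic P ν) (n : ℕ) (x : X) (y : ℝ) : 0 ≤ surv P f n x y :=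
  ((posK hS).pow n).nonneg (fun _ _ => zero_le_one) x y
lemma exi_nonneg (hS : IsStochastic P ν) (n : ℕ) (x : X) (y : ℝ) : 0 ≤ exi P f n x y :=
  ((posK hS).pow n).nonneg ((posL hS).nonneg (fun _ _ => zero_le_one)) x y

lemma surv_le_one (hS : IsStochastic P ν) (n : ℕ) (x : X) (y : ℝ) : surv P f n x y ≤ 1 := by
  induction n with
  | zero => simp [surv_zero]
  | succ n ih => have := exi_eq (f := f) hS n x y; have := exi_nonneg (f := f) hS n x y; linarith

lemma surv_mono (hS : IsStochastic P ν) (n : ℕ) (x : X) : Monotone (surv P f n x) := by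
  induction n generalizing x with
  | zero => simp only [surv_zero]; exact fun _ _ _ => le_rfl
  | succ n ih =>
    intro y y' hy
    rw [surv_succ, Ko_apply, Ko_apply]
    refine Finset.sum_le_sum fun b _ => mul_le_mul_of_nonneg_left ?_ (hS.nonneg _ _)
    exact mul_le_mul (ind_mono (fun h => by linarith)) (ih b (by linarith))
      (surv_nonneg hS _ _ _) (ind_nonneg _)

lemma surv_sum_exi (hS : IsStochastic P ν) (a k : ℕ) (x : X) (y : ℝ) :
    ∑ j ∈ Finset.range k, exi P f (a + j) x y = surv P f a x y - surv P f (a + k) x y := by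
  induction k with
  | zero => simp
  | succ k ih => rw [Finset.sum_range_succ, ih, exi_eq hS]; simp [add_assoc]

/-- first-exit decomposition -/
lemma Ko_pow_decomp (a k : ℕ) :
    Ko P f ^ (a + k) = Ko P f ^ a * Uo P f ^ k -
      ∑ j ∈ Finset.range k, Ko P f ^ (a + j) * Lo P f * Uo P f ^ (k - 1 - j) := by
  induction k with
  | zero => simp
  | succ k ih =>
    have e : Ko P f = Uo P f - Lo P f := by rw [← Ko_add_Lo]; abel
    have h1 : Ko P f ^ (a + (k + 1)) = Ko P f ^ (a + k) * Uo P f - Ko P f ^ (a + k) * Lo P f := by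
      rw [← add_assoc, pow_succ, ← mul_sub, ← e]
    rw [h1, Finset.sum_range_succ]
    have h2 : Ko P f ^ (a + k) * Uo P f = Ko P f ^ a * Uo P f ^ (k+1) -
      ∑ j ∈ Finset.range k, Ko P f ^ (a + j) * Lo P f * Uo P f ^ (k + 1 - 1 - j) := by
      conv_lhs => rw [ih]
      rw [sub_mul, mul_assoc, ← pow_succ, Finset.sum_mul]
      congr 1
      refine Finset.sum_congr rfl fun j hj => ?_
      rw [mul_assoc, ← pow_succ]
      congr 2
      have := Finset.mem_range.1 hj
      omega
    rw [h2]
    simp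
    abel

end

/-! link with `Ex` -/
section
variable [Fintype X] {P : X → X → ℝ} {ν f : X → ℝ}

lemma Ex_succ (x : X) (n : ℕ) (F : (ℕ → X) → ℝ) :
    Ex P x (n + 1) F = ∑ b, P x b * ∑ p : Fin n → X, wt P b (List.ofFn p) *
      F (pathExt x (Fin.cons b p : Fin (n+1) → X)) := by
  unfold Ex
  rw [← (Fin.consEquiv (fun _ : Fin (n+1) => X)).sum_comp, Fintype.sum_prod_type]
  refine Finset.sum_congr rfl fun b _ => ?_
  rw [Finset.mul_sum]
  refine Finset.sum_congr rfl fun p _ => ?_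
  simp [Fin.consEquiv, List.ofFn_succ, wt, mul_assoc]

lemma Spath_cons (x b : X) {n : ℕ} (p : Fin n → X) (k : ℕ) (hk : k ≤ n) :
    Spath f (pathExt x (Fin.cons b p : Fin (n+1) → X)) (k + 1) =
      f b + Spath f (pathExt b p) k := by
  unfold Spath
  induction k with
  | zero => simp [pathExt]
  | succ k ih =>
    rw [Finset.sum_Icc_succ_top (by omega), ih (by omega), Finset.sum_Icc_succ_top (by omega),
      add_assoc]
    congr 2
    have h1 : 1 ≤ k + 1 + 1 ∧ k + 1 + 1 ≤ n + 1 := by omega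
    have h2 : 1 ≤ k + 1 ∧ k + 1 ≤ n := by omega
    simp only [pathExt, h1, h2, and_self, dif_pos]
    have : (⟨k + 1 + 1 - 1, by omega⟩ : Fin (n+1)) = Fin.succ ⟨k + 1 - 1, by omega⟩ := by
      ext; simp
    rw [this, Fin.cons_succ]

lemma survives_cons (x b : X) (y : ℝ) {n : ℕ} (p : Fin n → X) (k : ℕ) (hk : k ≤ n) :
    survives f y (k + 1) (pathExt x (Fin.cons b p : Fin (n+1) → X)) ↔
      0 < y + f b ∧ survives f (y + f b) k (pathExt b p) := by
  unfold survives
  constructor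
  · intro h
    refine ⟨?_, fun j hj => ?_⟩
    · have := h 1 (by simp)
      have h2 := Spath_cons (f := f) x b p 0 (by omega)
      simp only [zero_add] at h2
      rw [h2] at this
      simpa [Spath] using this
    · have hj' := Finset.mem_Icc.1 hj
      have := h (j+1) (by simp; omega)
      rw [Spath_cons x b p j (by omega)] at this
      linarith
  · rintro ⟨h0, h⟩ j hj
    have hj' := Finset.mem_Icc.1 hj
    obtain ⟨i, rfl⟩ : ∃ i, j = i + 1 := ⟨j - 1, by omega⟩
    rw [Spath_cons x b p i (by omega)]
    rcases Nat.eq_zero_or_pos i with rfl | hi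
    · simpa [Spath] using h0
    · have := h i (by simp; omega)
      linarith

lemma Ex_survives (x : X) (y : ℝ) (n : ℕ) :
    Ex P x n (fun ω => ind (survives f y n ω)) = surv P f n x y := by
  induction n generalizing x y with
  | zero => simp [Ex, surv_zero, wt, survives, ind]
  | succ n ih =>
    rw [Ex_succ, surv_succ, Ko_apply]
    refine Finset.sum_congr rfl fun b _ => ?_
    rw [← ih, Ex]
    simp only [Finset.mul_sum]
    refine Finset.sum_congr rfl fun p _ => ?_
    rw [ind_congr (survives_cons x b y p n le_rfl), ind_and]
    ring

lemma Ex_exit (x : X) (y : ℝ) (n : ℕ) :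
    Ex P x (n+1) (fun ω => ind (survives f y n ω ∧ y + Spath f ω (n+1) ≤ 0)) =
      exi P f n x y := by
  induction n generalizing x y with
  | zero =>
    rw [Ex_succ, exi, pow_zero, Module.End.one_apply, Lo_apply]
    refine Finset.sum_congr rfl fun b _ => ?_
    congr 1
    simp [wt, survives, Spath, pathExt]
  | succ n ih =>
    rw [Ex_succ, exi, pow_succ', Module.End.mul_apply, Ko_apply]
    refine Finset.sum_congr rfl fun b _ => ?_
    change _ = P x b * (ind (0 < y + f b) * exi P f n b (y + f b))
    rw [← ih, Ex]
    simp only [Finset.mul_sum]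
    refine Finset.sum_congr rfl fun p _ => ?_
    rw [Spath_cons x b p (n+1) le_rfl, ← add_assoc,
      ind_congr (and_congr_left' (survives_cons x b y p n (by omega))), and_assoc, ind_and]
    ring

lemma Ex_one_int (P' : X → X → ℝ) (W : X → ℝ → ℝ) (b : X) (z : ℝ) :
    Ex P' b 1 (fun ωs => W (ωs 1) z * ind (z ≤ Spath (fun u => -f u) ωs 1)) =
      ∑ c, P' b c * (W c z * ind (z ≤ - f c)) := by
  rw [Ex_succ]
  refine Finset.sum_congr rfl fun c _ => ?_
  simp [wt, Spath, pathExt]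
end

/-! ### Part 2 -/


/-! ### S2: mixing, Poisson equation, variance -/

lemma pow_div_le {q : ℝ} (hq0 : 0 < q) (hq1 : q < 1) {N : ℕ} (hN : 1 ≤ N) :
    ∃ C ρ : ℝ, 0 < C ∧ 0 < ρ ∧ ρ < 1 ∧ ∀ n : ℕ, q ^ (n / N) ≤ C * ρ ^ n := by
  have hN' : (0:ℝ) < N := by exact_mod_cast hN
  refine ⟨1 / q, q ^ (1 / (N:ℝ)), by positivity, by positivity,
    Real.rpow_lt_one hq0.le hq1 (by positivity), fun n => ?_⟩
  set ρ := q ^ (1 / (N:ℝ)) with hρ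
  have hρ0 : 0 < ρ := by positivity
  have hρ1 : ρ ≤ 1 := (Real.rpow_lt_one hq0.le hq1 (by positivity)).le
  have hqN : ρ ^ N = q := by
    rw [hρ, ← Real.rpow_natCast, ← Real.rpow_mul hq0.le]
    field_simp
    simp
  rw [← hqN, ← pow_mul, div_mul_eq_mul_div, one_mul, le_div_iff₀ (by positivity), ← pow_add]
  refine pow_le_pow_of_le_one hρ0.le hρ1 ?_
  have := Nat.div_add_mod n N
  have := Nat.mod_lt n hN
  omega

section
variable [Fintype X] {P : X → X → ℝ} {ν f : X → ℝ}

lemma Pop_sub (g h : X → ℝ) (x : X) : Pop P (fun x => g x - h x) x = Pop P g x - Pop P h x := by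
  simp [Pop, mul_sub, Finset.sum_sub_distrib]

lemma Pop_abs_le (hS : IsStochastic P ν) {g : X → ℝ} {B : ℝ} (hg : ∀ x, |g x| ≤ B) (x : X) :
    |Pop P g x| ≤ B := by
  calc |Pop P g x| ≤ ∑ b, P x b * B := by
        refine (Finset.abs_sum_le_sum_abs _ _).trans (Finset.sum_le_sum fun b _ => ?_)
        rw [abs_mul, abs_of_nonneg (hS.nonneg _ _)]
        exact mul_le_mul_of_nonneg_left (hg b) (hS.nonneg _ _)
    _ = B := by rw [← Finset.sum_mul, hS.rowSum, one_mul]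

lemma nu_Pop (hS : IsStochastic P ν) (g : X → ℝ) : ∑ x, Pop P g x * ν x = ∑ x, g x * ν x := by
  simp only [Pop, Finset.sum_mul]
  rw [Finset.sum_comm]
  refine Finset.sum_congr rfl fun b _ => ?_
  rw [← hS.nuInv b, Finset.mul_sum]
  exact Finset.sum_congr rfl fun x _ => by ring

lemma nu_Pop_iter (hS : IsStochastic P ν) (g : X → ℝ) (n : ℕ) :
    ∑ x, (Pop P)^[n] g x * ν x = ∑ x, g x * ν x := by
  induction n with
  | zero => simp
  | succ n ih => rw [Function.iterate_succ_apply', nu_Pop hS, ih]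

lemma Pop_iter_abs_le (hS : IsStochastic P ν) {g : X → ℝ} {B : ℝ} (hg : ∀ x, |g x| ≤ B)
    (n : ℕ) (x : X) : |(Pop P)^[n] g x| ≤ B := by
  induction n generalizing x with
  | zero => simpa using hg x
  | succ n ih => rw [Function.iterate_succ_apply']; exact Pop_abs_le hS ih x

variable [DecidableEq X]

lemma kpow_eq (n : ℕ) (x x' : X) : kpow P n x x' = ((Matrix.of P) ^ n) x x' := by
  induction n generalizing x with
  | zero => simp [kpow, Matrix.one_apply]
  | succ n ih => simp [kpow, pow_succ', Matrix.mul_apply, ih]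

lemma Pop_iter_eq (n : ℕ) (g : X → ℝ) (x : X) :
    (Pop P)^[n] g x = ∑ x', kpow P n x x' * g x' := by
  induction n generalizing x with
  | zero => simp [kpow]
  | succ n ih =>
    rw [Function.iterate_succ_apply']
    simp only [Pop, kpow, ih, Finset.sum_mul, Finset.mul_sum]
    rw [Finset.sum_comm]
    exact Finset.sum_congr rfl fun _ _ => Finset.sum_congr rfl fun _ _ => by ring

lemma kpow_rowSum (hS : IsStochastic P ν) (n : ℕ) (x : X) : ∑ x', kpow P n x x' = 1 := by
  have := Pop_iter_eq (P := P) n (fun _ => 1) x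
  simp only [mul_one] at this
  rw [← this]
  clear this
  induction n generalizing x with
  | zero => simp
  | succ n ih => rw [Function.iterate_succ_apply']; simp [Pop, ih, hS.rowSum]

lemma doeblin [Nonempty X] (hS : IsStochastic P ν) (h1 : Primitive P) :
    ∃ (k : ℕ) (q : ℝ), 1 ≤ k ∧ 0 < q ∧ q < 1 ∧ ∀ (g : X → ℝ) (B : ℝ), ∑ x, g x * ν x = 0 →
      (∀ x, |g x| ≤ B) → ∀ x, |(Pop P)^[k] g x| ≤ q * B := by
  obtain ⟨k, hk, hpos⟩ := h1
  obtain ⟨p, -, hp⟩ := Finset.exists_min_image (Finset.univ : Finset (X × X))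
    (fun p => kpow P k p.1 p.2) ⟨(Classical.arbitrary X, Classical.arbitrary X), by simp⟩
  set m := min (kpow P k p.1 p.2) (1/2) with hm
  have hm0 : 0 < m := lt_min (hpos _ _) (by norm_num)
  have hm1 : m ≤ 1/2 := min_le_right _ _
  have hmk : ∀ x x', m ≤ kpow P k x x' := fun x x' =>
    (min_le_left _ _).trans (hp (x, x') (by simp))
  have hν1 : ∀ x, ν x ≤ 1 := fun x => by
    rw [← hS.nuSum]
    exact Finset.single_le_sum (f := ν) (fun i _ => (hS.nuPos i).le) (Finset.mem_univ x)
  refine ⟨k, 1 - m, hk, by linarith, by linarith, fun g B hg hB x => ?_⟩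
  have e : (Pop P)^[k] g x = ∑ x', (kpow P k x x' - m * ν x') * g x' := by
    rw [Pop_iter_eq]
    have : ∑ x', m * ν x' * g x' = 0 := by
      have := congrArg (m * ·) hg
      simp only [Finset.mul_sum, mul_zero] at this
      rw [← this]; exact Finset.sum_congr rfl fun _ _ => by ring
    simp only [sub_mul, Finset.sum_sub_distrib, this, sub_zero]
  rw [e]
  calc |∑ x', (kpow P k x x' - m * ν x') * g x'|
      ≤ ∑ x', (kpow P k x x' - m * ν x') * B := by
        refine (Finset.abs_sum_le_sum_abs _ _).trans (Finset.sum_le_sum fun b _ => ?_)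
        have h0 : 0 ≤ kpow P k x b - m * ν b := by
          have := hmk x b
          have : m * ν b ≤ m * 1 := mul_le_mul_of_nonneg_left (hν1 b) hm0.le
          linarith
        rw [abs_mul, abs_of_nonneg h0]
        exact mul_le_mul_of_nonneg_left (hB b) h0
    _ = (1 - m) * B := by
        rw [← Finset.sum_mul, Finset.sum_sub_distrib, kpow_rowSum hS, ← Finset.mul_sum, hS.nuSum,
          mul_one]

lemma geom [Nonempty X] (hS : IsStochastic P ν) (h1 : Primitive P) :
    ∃ C ρ : ℝ, 0 < C ∧ 0 < ρ ∧ ρ < 1 ∧ ∀ (g : X → ℝ) (B : ℝ), ∑ x, g x * ν x = 0 →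
      (∀ x, |g x| ≤ B) → ∀ (n : ℕ) (x : X), |(Pop P)^[n] g x| ≤ C * ρ ^ n * B := by
  obtain ⟨k, q, hk, hq0, hq1, H⟩ := doeblin hS h1
  obtain ⟨C, ρ, hC, hρ0, hρ1, hle⟩ := pow_div_le hq0 hq1 hk
  refine ⟨C, ρ, hC, hρ0, hρ1, fun g B hg hB n x => ?_⟩
  have hB0 : 0 ≤ B := (abs_nonneg _).trans (hB x)
  have key : ∀ j (x : X), |(Pop P)^[k * j] g x| ≤ q ^ j * B := by
    intro j
    induction j with
    | zero => simpa using hB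
    | succ j ih =>
      intro x
      rw [mul_add, mul_one, add_comm, Function.iterate_add_apply, pow_succ']
      rw [mul_assoc]
      exact H _ _ (by rw [nu_Pop_iter hS, hg]) ih x
  have h2 : |(Pop P)^[n] g x| ≤ q ^ (n / k) * B := by
    conv_lhs => rw [← Nat.div_add_mod n k, add_comm, Function.iterate_add_apply]
    exact Pop_iter_abs_le hS (key _) _ _
  exact h2.trans (mul_le_mul_of_nonneg_right (hle n) hB0)

lemma exists_bound (g : X → ℝ) : ∃ B, 0 < B ∧ ∀ x, |g x| ≤ B := by
  refine ⟨∑ x, |g x| + 1, by positivity, fun x => ?_⟩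
  have := Finset.single_le_sum (f := fun x => |g x|) (fun i _ => abs_nonneg _) (Finset.mem_univ x)
  linarith

lemma poisson [Nonempty X] (hS : IsStochastic P ν) (h1 : Primitive P) (g : X → ℝ)
    (hg : ∑ x, g x * ν x = 0) : ∃ r : X → ℝ, ∀ x, r x - Pop P r x = g x := by
  obtain ⟨C, ρ, hC, hρ0, hρ1, H⟩ := geom hS h1
  obtain ⟨B, hB0, hB⟩ := exists_bound g
  have hs : ∀ x, Summable (fun n => (Pop P)^[n] g x) := fun x => by
    refine Summable.of_norm_bounded (g := fun n => C * ρ ^ n * B) ?_ (fun n => H g B hg hB n x)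
    exact ((summable_geometric_of_lt_one hρ0.le hρ1).mul_left C).mul_right B
  refine ⟨fun x => ∑' n, (Pop P)^[n] g x, fun x => ?_⟩
  have : Pop P (fun x => ∑' n, (Pop P)^[n] g x) x = ∑' n, (Pop P)^[n+1] g x := by
    simp only [Function.iterate_succ_apply']
    simp only [Pop, ← tsum_mul_left]
    rw [Summable.tsum_finsetSum]
    exact fun b _ => (hs b).mul_left _
  simp only [this]
  rw [(hs x).tsum_eq_zero_add]
  simp

lemma sigma2_eq [Nonempty X] (hS : IsStochastic P ν) (h1 : Primitive P)
    (h2 : ∑ x, f x * ν x = 0) (r : X → ℝ) (hr : ∀ x, r x - Pop P r x = Pop P f x) :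
    sigma2 P ν f = ∑ x, f x ^ 2 * ν x + 2 * ∑ x, f x * r x * ν x := by
  obtain ⟨C, ρ, hC, hρ0, hρ1, H⟩ := geom hS h1
  obtain ⟨B, hB0, hB⟩ := exists_bound f
  have hs : ∀ x, Summable (fun n => (Pop P)^[n+1] f x) := fun x => by
    refine (summable_nat_add_iff (f := fun n => (Pop P)^[n] f x) 1).2 ?_
    refine Summable.of_norm_bounded (g := fun n => C * ρ ^ n * B) ?_ (fun n => H f B h2 hB n x)
    exact ((summable_geometric_of_lt_one hρ0.le hρ1).mul_left C).mul_right B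
  set m := ∑ x, r x * ν x with hm
  set r0 : X → ℝ := fun x => r x - m with hr0
  have hr0ν : ∑ x, r0 x * ν x = 0 := by
    simp only [hr0, sub_mul, Finset.sum_sub_distrib, ← Finset.mul_sum, hS.nuSum]
    rw [hm]; ring
  obtain ⟨B', hB0', hB'⟩ := exists_bound r0
  have hPc : ∀ x, Pop P r0 x = Pop P r x - m := fun x => by
    rw [hr0, Pop_sub]; congr 1; simp [Pop, ← Finset.sum_mul, hS.rowSum]
  have tel : ∀ (n : ℕ) x, (Pop P)^[n+1] f x = (Pop P)^[n] r0 x - (Pop P)^[n+1] r0 x := by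
    intro n
    induction n with
    | zero =>
      intro x
      simp only [zero_add, Function.iterate_one, Function.iterate_zero, id, hPc, ← hr x]
      simp [hr0]
    | succ n ih =>
      intro x
      rw [Function.iterate_succ_apply' _ (n+1) f, Function.iterate_succ_apply' _ n r0,
        Function.iterate_succ_apply' _ (n+1) r0, ← Pop_sub]
      exact congrArg (fun g => Pop P g x) (funext ih)
  have hsum : ∀ x, HasSum (fun n => (Pop P)^[n+1] f x) (r0 x) := fun x => by
    rw [(hs x).hasSum_iff_tendsto_nat]
    have e : ∀ n, ∑ i ∈ Finset.range n, (Pop P)^[i+1] f x = r0 x - (Pop P)^[n] r0 x := by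
      intro n
      induction n with
      | zero => simp
      | succ n ih => rw [Finset.sum_range_succ, ih, tel]; ring
    simp only [e]
    have : Tendsto (fun n => (Pop P)^[n] r0 x) atTop (𝓝 0) := by
      refine squeeze_zero_norm (fun n => H r0 B' hr0ν hB' n x) ?_
      have := (tendsto_pow_atTop_nhds_zero_of_lt_one hρ0.le hρ1).const_mul C |>.mul_const B'
      simpa using this
    simpa using this.const_sub (r0 x)
  have : HasSum (fun n : ℕ => ∑ x, f x * ((Pop P)^[n + 1] f) x * ν x) (∑ x, f x * r0 x * ν x) :=
    hasSum_sum fun x _ => ((hsum x).mul_left (f x)).mul_right (ν x)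
  rw [sigma2, this.tsum_eq]
  congr 2
  simp only [hr0, mul_sub, sub_mul, Finset.sum_sub_distrib]
  have : ∑ x, f x * m * ν x = 0 := by
    have := congrArg (m * ·) h2
    simp only [Finset.mul_sum, mul_zero] at this
    rw [← this]; exact Finset.sum_congr rfl fun _ _ => by ring
  linarith

lemma sigma2_sq [Nonempty X] (hS : IsStochastic P ν) (h1 : Primitive P)
    (h2 : ∑ x, f x * ν x = 0) (r : X → ℝ) (hr : ∀ x, r x - Pop P r x = Pop P f x) :
    sigma2 P ν f = ∑ x, ν x * ∑ b, P x b * (f b + r b - r x) ^ 2 := by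
  rw [sigma2_eq hS h1 h2 r hr]
  have e : ∀ x, ∑ b, P x b * (f b + r b - r x) ^ 2 =
      Pop P (fun b => f b ^ 2 + 2 * (f b * r b) + r b ^ 2) x - r x ^ 2 := by
    intro x
    have h3 : Pop P (fun b => f b + r b) x = r x := by
      have : Pop P (fun b => f b + r b) x = Pop P f x + Pop P r x := by
        simp [Pop, mul_add, Finset.sum_add_distrib]
      rw [this, ← hr x]; ring
    have h4 : ∑ b, P x b * (f b + r b - r x) ^ 2 =
      Pop P (fun b => f b ^ 2 + 2 * (f b * r b) + r b ^ 2) x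
        - 2 * r x * Pop P (fun b => f b + r b) x + r x ^ 2 * ∑ b, P x b := by
      simp only [Pop, Finset.mul_sum]
      rw [← Finset.sum_sub_distrib, ← Finset.sum_add_distrib]
      exact Finset.sum_congr rfl fun _ _ => by ring
    rw [h4, h3, hS.rowSum]; ring
  have h5 : ∑ x, ν x * ∑ b, P x b * (f b + r b - r x) ^ 2 =
      ∑ x, Pop P (fun b => f b ^ 2 + 2 * (f b * r b) + r b ^ 2) x * ν x - ∑ x, r x ^ 2 * ν x := by
    rw [← Finset.sum_sub_distrib]
    exact Finset.sum_congr rfl fun x _ => by rw [e]; ring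
  rw [h5, nu_Pop hS, Finset.mul_sum, ← Finset.sum_add_distrib, ← Finset.sum_sub_distrib]
  exact Finset.sum_congr rfl fun x _ => by ring

lemma nu_Pf (hS : IsStochastic P ν) (h2 : ∑ x, f x * ν x = 0) : ∑ x, Pop P f x * ν x = 0 := by
  rw [nu_Pop hS, h2]

lemma cyc_pos (hP : ∀ x x', 0 ≤ P x x') {n : ℕ} {g : Fin (n+1) → X}
    (h : 0 < ∏ i : Fin (n + 1), P (g i) (g (i + 1))) (i : Fin (n+1)) : 0 < P (g i) (g (i+1)) := by
  refine lt_of_le_of_ne (hP _ _) (fun h0 => ?_)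
  rw [Finset.prod_eq_zero (Finset.mem_univ i) h0.symm] at h
  exact lt_irrefl _ h

lemma sigma2_pos [Nonempty X] (hS : IsStochastic P ν) (h1 : Primitive P)
    (h2 : ∑ x, f x * ν x = 0) (h3 : NonLattice P f) : 0 < sigma2 P ν f := by
  obtain ⟨r, hr⟩ := poisson hS h1 (Pop P f) (nu_Pf hS h2)
  rw [sigma2_sq hS h1 h2 r hr]
  have hnn : ∀ x, 0 ≤ ∑ b, P x b * (f b + r b - r x) ^ 2 := fun x =>
    Finset.sum_nonneg fun b _ => mul_nonneg (hS.nonneg _ _) (sq_nonneg _)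
  refine lt_of_le_of_ne (Finset.sum_nonneg fun x _ => mul_nonneg (hS.nuPos x).le (hnn x)) ?_
  intro h0
  have hx : ∀ x b, 0 < P x b → f b = r x - r b := by
    intro x b hxb
    have h4 := (Finset.sum_eq_zero_iff_of_nonneg
      (fun x _ => mul_nonneg (hS.nuPos x).le (hnn x))).1 h0.symm x (Finset.mem_univ x)
    have h5 : ∑ b, P x b * (f b + r b - r x) ^ 2 = 0 := by
      rcases mul_eq_zero.1 h4 with h | h
      · exact absurd h (hS.nuPos x).ne'
      · exact h
    have h6 := (Finset.sum_eq_zero_iff_of_nonneg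
      (fun b _ => mul_nonneg (hS.nonneg x b) (sq_nonneg _))).1 h5 b (Finset.mem_univ b)
    rcases mul_eq_zero.1 h6 with h | h
    · exact absurd h hxb.ne'
    · have := pow_eq_zero_iff (two_ne_zero) |>.1 h
      linarith
  obtain ⟨n, g, hg, hne⟩ := h3 0 0
  refine hne 0 ?_
  have hshift : ∀ (φ : X → ℝ), ∑ i, φ (g (i + 1)) = ∑ i, φ (g i) := fun φ =>
    Equiv.sum_comp (Equiv.addRight (1 : Fin (n+1))) (fun i => φ (g i))
  have : ∑ i, f (g i) = 0 := by
    rw [← hshift f]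
    calc ∑ i, f (g (i+1)) = ∑ i, (r (g i) - r (g (i+1))) :=
          Finset.sum_congr rfl fun i _ => hx _ _ (cyc_pos hS.nonneg hg i)
      _ = 0 := by rw [Finset.sum_sub_distrib, hshift r, sub_self]
  rw [this]; simp

/-! dual chain -/

lemma nu_mul_dual (hS : IsStochastic P ν) (x b : X) : ν x * dualK P ν x b = ν b * P b x := by
  unfold dualK
  have := (hS.nuPos x).ne'
  field_simp

lemma dual_stoch (hS : IsStochastic P ν) : IsStochastic (dualK P ν) ν where
  nonneg x x' := div_nonneg (mul_nonneg (hS.nuPos _).le (hS.nonneg _ _)) (hS.nuPos _).le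
  rowSum x := by
    have := (hS.nuPos x).ne'
    simp only [dualK]
    rw [← Finset.sum_div, hS.nuInv, div_self this]
  nuPos := hS.nuPos
  nuSum := hS.nuSum
  nuInv x' := by
    simp only [nu_mul_dual hS]
    rw [← Finset.mul_sum, hS.rowSum, mul_one]

lemma dual_kpow (hS : IsStochastic P ν) (n : ℕ) (x x' : X) :
    ν x * kpow (dualK P ν) n x x' = ν x' * kpow P n x' x := by
  induction n generalizing x with
  | zero =>
    by_cases h : x = x'
    · simp [kpow, h]
    · simp [kpow, h, Ne.symm h]
  | succ n ih =>
    rw [kpow_eq (P := P), pow_succ, Matrix.mul_apply]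
    simp only [kpow, ← kpow_eq, Finset.mul_sum]
    refine Finset.sum_congr rfl fun y _ => ?_
    rw [← mul_assoc, nu_mul_dual hS, ← mul_assoc, ← ih y, Matrix.of_apply]
    ring

lemma dual_prim (hS : IsStochastic P ν) (h1 : Primitive P) : Primitive (dualK P ν) := by
  obtain ⟨k, hk, H⟩ := h1
  refine ⟨k, hk, fun x x' => ?_⟩
  have := dual_kpow hS k x x'
  have h2 : 0 < ν x' * kpow P k x' x := mul_pos (hS.nuPos _) (H _ _)
  rw [← this] at h2
  exact pos_of_mul_pos_right h2 (hS.nuPos x).le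

lemma dual_pair (hS : IsStochastic P ν) (g h : X → ℝ) :
    ∑ x, Pop P g x * h x * ν x = ∑ x, g x * Pop (dualK P ν) h x * ν x := by
  simp only [Pop, Finset.sum_mul, Finset.mul_sum]
  rw [Finset.sum_comm]
  refine Finset.sum_congr rfl fun b _ => Finset.sum_congr rfl fun x _ => ?_
  have := nu_mul_dual hS b x
  linear_combination (-(g b * h x)) * this

lemma sigma2_dual [Nonempty X] (hS : IsStochastic P ν) (h1 : Primitive P)
    (h2 : ∑ x, f x * ν x = 0) : sigma2 (dualK P ν) ν (fun x => - f x) = sigma2 P ν f := by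
  have hS' := dual_stoch hS
  have h1' := dual_prim hS h1
  have h2' : ∑ x, (- f x) * ν x = 0 := by simp [h2]
  obtain ⟨r, hr⟩ := poisson hS h1 (Pop P f) (nu_Pf hS h2)
  obtain ⟨s, hs⟩ := poisson hS' h1' (Pop (dualK P ν) (fun x => - f x)) (nu_Pf hS' h2')
  rw [sigma2_eq hS h1 h2 r hr, sigma2_eq hS' h1' h2' s hs]
  simp only [even_two, Even.neg_pow, add_right_inj, mul_eq_mul_left_iff, OfNat.ofNat_ne_zero, or_false]
  -- `-ν(f s) = ν(f r)`, with `f = g - P g`, `g = f + r`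
  have e1 : ∀ x, f x = (f x + r x) - Pop P (fun x => f x + r x) x := fun x => by
    have : Pop P (fun b => f b + r b) x = Pop P f x + Pop P r x := by
      simp [Pop, mul_add, Finset.sum_add_distrib]
    rw [this, ← hr x]; ring
  have e2 : ∑ x, -f x * s x * ν x = - (∑ x, (f x + r x) * s x * ν x -
      ∑ x, Pop P (fun x => f x + r x) x * s x * ν x) := by
    rw [← Finset.sum_sub_distrib, ← Finset.sum_neg_distrib]
    refine Finset.sum_congr rfl fun x _ => ?_
    conv_lhs => rw [e1 x]
    ring
  rw [e2, dual_pair hS, ← Finset.sum_sub_distrib]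
  have e3 : ∑ x, ((f x + r x) * s x * ν x - (f x + r x) * Pop (dualK P ν) s x * ν x) =
      ∑ x, (f x + r x) * Pop (dualK P ν) (fun x => - f x) x * ν x :=
    Finset.sum_congr rfl fun x _ => by rw [← hs x]; ring
  rw [e3, ← dual_pair hS, ← Finset.sum_neg_distrib]
  refine Finset.sum_congr rfl fun x _ => ?_
  have := e1 x
  have h6 : Pop P (fun x => f x + r x) x = r x := by linarith
  rw [h6]; ring
end

/-! ### Part 3 -/


/-! ### S3: perturbed operators -/
section
variable [Fintype X] [DecidableEq X] [Nonempty X] {P : X → X → ℝ} {ν f : X → ℝ}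

/-- approximate eigenfunction -/
noncomputable def aeig (r b : X → ℝ) (l : ℂ) (x : X) : ℂ := 1 - l * r x + l ^ 2 * b x

lemma norm_sum_P_le (hS : IsStochastic P ν) {g : X → ℂ} {B : ℝ} (hg : ∀ x, ‖g x‖ ≤ B) (x : X) :
    ‖∑ c, (P x c : ℂ) * g c‖ ≤ B := by
  calc ‖∑ c, (P x c : ℂ) * g c‖ ≤ ∑ b, P x b * B := by
        refine (norm_sum_le _ _).trans (Finset.sum_le_sum fun b _ => ?_)
        rw [norm_mul, Complex.norm_real, Real.norm_of_nonneg (hS.nonneg _ _)]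
        exact mul_le_mul_of_nonneg_left (hg b) (hS.nonneg _ _)
    _ = B := by rw [← Finset.sum_mul, hS.rowSum, one_mul]

lemma aeig_bound (r b : X → ℝ) : ∃ C : ℝ, 0 < C ∧ ∀ l : ℂ, ‖l‖ ≤ 1 → ∀ x, ‖aeig r b l x - 1‖ ≤ C * ‖l‖ := by
  obtain ⟨R, hR0, hR⟩ := exists_bound r
  obtain ⟨B, hB0, hB⟩ := exists_bound b
  refine ⟨R + B, by positivity, fun l hl x => ?_⟩
  have e : aeig r b l x - 1 = l * (- r x + l * b x) := by unfold aeig; ring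
  rw [e, norm_mul, mul_comm]
  refine mul_le_mul_of_nonneg_right ?_ (norm_nonneg _)
  refine (norm_add_le _ _).trans (add_le_add ?_ ?_)
  · rw [norm_neg, Complex.norm_real]; exact hR x
  · rw [norm_mul, Complex.norm_real]
    calc ‖l‖ * ‖b x‖ ≤ 1 * B := mul_le_mul hl (hB x) (norm_nonneg _) zero_le_one
      _ = B := one_mul B

lemma exists_aeig (hS : IsStochastic P ν) (h1 : Primitive P) (h2 : ∑ x, f x * ν x = 0) :
    ∃ (r b : X → ℝ) (C : ℝ), 0 < C ∧ ∀ l : ℂ, ‖l‖ ≤ 1 → ∀ x,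
      ‖∑ c, (P x c : ℂ) * (aeig r b l c * Complex.exp (-l * f c)) -
        (1 + (sigma2 P ν f / 2 : ℝ) * l ^ 2) * aeig r b l x‖ ≤ C * ‖l‖ ^ 3 := by
  obtain ⟨r, hr⟩ := poisson hS h1 (Pop P f) (nu_Pf hS h2)
  set s : ℝ := sigma2 P ν f / 2 with hs
  have hs' := sigma2_eq hS h1 h2 r hr
  obtain ⟨b, hb⟩ := poisson hS h1 (fun x => Pop P (fun c => r c * f c + f c ^ 2 / 2) x - s) (by
    simp only [sub_mul, Finset.sum_sub_distrib]
    rw [nu_Pop hS, ← Finset.mul_sum, hS.nuSum, hs, hs', mul_one, add_div, mul_div_assoc]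
    rw [Finset.sum_div, Finset.sum_div, Finset.mul_sum, ← Finset.sum_add_distrib,
      ← Finset.sum_sub_distrib]
    exact Finset.sum_eq_zero fun x _ => by ring)
  obtain ⟨K, hK0, hK⟩ := exists_bound (fun x => - Pop P (fun c => b c * f c) x
    - Pop P (fun c => r c * f c ^ 2) x / 2 + s * r x)
  obtain ⟨K', hK0', hK'⟩ := exists_bound (fun x => Pop P (fun c => b c * f c ^ 2) x / 2 - s * b x)
  obtain ⟨M, hM0, hM⟩ := exists_bound f
  obtain ⟨A, hA0, hA⟩ := aeig_bound r b
  refine ⟨r, b, K + K' + (A + 1) * (M ^ 3 * Real.exp M), by positivity, fun l hl x => ?_⟩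
  set E : X → ℂ := fun c => Complex.exp (-l * f c) - (1 - l * f c + l ^ 2 * f c ^ 2 / 2) with hE
  have hEb : ∀ c, ‖E c‖ ≤ ‖l‖ ^ 3 * (M ^ 3 * Real.exp M) := by
    intro c
    have := Complex.norm_exp_sub_sum_le_norm_mul_exp (-l * f c) 3
    have e : ∑ m ∈ Finset.range 3, (-l * (f c : ℂ)) ^ m / (m.factorial : ℂ) =
      1 - l * f c + l ^ 2 * f c ^ 2 / 2 := by
      simp [Finset.sum_range_succ, Nat.factorial]; ring
    rw [e] at this
    refine this.trans ?_
    have h3 : ‖-l * (f c : ℂ)‖ ≤ ‖l‖ * M := by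
      rw [norm_mul, norm_neg, Complex.norm_real]
      exact mul_le_mul_of_nonneg_left (hM c) (norm_nonneg _)
    have h4 : ‖-l * (f c : ℂ)‖ ≤ M := h3.trans (by nlinarith)
    calc ‖-l * (f c : ℂ)‖ ^ 3 * Real.exp ‖-l * (f c : ℂ)‖
        ≤ (‖l‖ * M) ^ 3 * Real.exp M :=
          mul_le_mul (pow_le_pow_left₀ (norm_nonneg _) h3 3) (Real.exp_le_exp.2 h4)
            (Real.exp_pos _).le (by positivity)
      _ = _ := by ring
  have hAl : ∀ c, ‖aeig r b l c‖ ≤ A + 1 := by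
    intro c
    have h5 := hA l hl c
    have h6 : ‖aeig r b l c‖ ≤ ‖aeig r b l c - 1‖ + ‖(1:ℂ)‖ := by
      simpa using norm_add_le (aeig r b l c - 1) 1
    rw [norm_one] at h6
    nlinarith
  have hpc : ∀ g : X → ℝ, ((Pop P g x : ℝ) : ℂ) = ∑ c, (P x c : ℂ) * (g c : ℂ) := fun g => by
    simp [Pop]
  have e1 := congrArg (fun z : ℝ => (z : ℂ)) (hr x)
  have e2 := congrArg (fun z : ℝ => (z : ℂ)) (hb x)
  have e0 := congrArg (fun z : ℝ => (z : ℂ)) (hS.rowSum x)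
  simp only [Complex.ofReal_sub, hpc] at e1 e2
  push_cast at e0 e1 e2
  have e3 : ∑ c, (P x c : ℂ) * ((r c : ℂ) * f c + (f c : ℂ) ^ 2 / 2) =
      ∑ c, (P x c : ℂ) * ((r c : ℂ) * f c) + ∑ c, (P x c : ℂ) * ((f c : ℂ) ^ 2 / 2) := by
    rw [← Finset.sum_add_distrib]; exact Finset.sum_congr rfl fun c _ => by ring
  rw [e3] at e2
  have main : ∑ c, (P x c : ℂ) * (aeig r b l c * Complex.exp (-l * f c)) -
        (1 + (s : ℂ) * l ^ 2) * aeig r b l x =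
      l ^ 3 * ((- Pop P (fun c => b c * f c) x - Pop P (fun c => r c * f c ^ 2) x / 2 + s * r x : ℝ) : ℂ)
      + l ^ 4 * ((Pop P (fun c => b c * f c ^ 2) x / 2 - s * b x : ℝ) : ℂ)
      + ∑ c, (P x c : ℂ) * (aeig r b l c * E c) := by
    have h7 : ∀ c, (P x c : ℂ) * (aeig r b l c * Complex.exp (-l * f c)) =
        (P x c : ℂ) * (aeig r b l c * E c) + ((P x c : ℂ) - l * ((P x c : ℂ) * r c)
          - l * ((P x c : ℂ) * f c) + l ^ 2 * ((P x c : ℂ) * b c)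
          + l ^ 2 * ((P x c : ℂ) * ((r c : ℂ) * f c)) + l ^ 2 * ((P x c : ℂ) * ((f c : ℂ) ^ 2 / 2))
          - l ^ 3 * ((P x c : ℂ) * ((b c : ℂ) * f c))
          - l ^ 3 / 2 * ((P x c : ℂ) * ((r c : ℂ) * f c ^ 2))
          + l ^ 4 / 2 * ((P x c : ℂ) * ((b c : ℂ) * f c ^ 2))) := by
      intro c
      have : Complex.exp (-l * f c) = E c + (1 - l * f c + l ^ 2 * f c ^ 2 / 2) := by
        simp [hE]
      rw [this, aeig]; ring
    simp only [h7, Finset.sum_add_distrib, Finset.sum_sub_distrib, ← Finset.mul_sum]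
    simp only [Complex.ofReal_add, Complex.ofReal_sub, Complex.ofReal_neg, Complex.ofReal_mul,
      Complex.ofReal_div, hpc]
    push_cast
    rw [e0]
    unfold aeig
    linear_combination l * e1 - l ^ 2 * e2
  rw [main]
  have b1 : ‖l ^ 3 * ((- Pop P (fun c => b c * f c) x - Pop P (fun c => r c * f c ^ 2) x / 2 + s * r x : ℝ) : ℂ)‖
      ≤ ‖l‖ ^ 3 * K := by
    rw [norm_mul, norm_pow, Complex.norm_real]
    exact mul_le_mul_of_nonneg_left (hK x) (by positivity)
  have b2 : ‖l ^ 4 * ((Pop P (fun c => b c * f c ^ 2) x / 2 - s * b x : ℝ) : ℂ)‖ ≤ ‖l‖ ^ 3 * K' := by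
    rw [norm_mul, norm_pow, Complex.norm_real]
    exact mul_le_mul (pow_le_pow_of_le_one (norm_nonneg _) hl (by norm_num)) (hK' x)
      (norm_nonneg _) (by positivity)
  have b3 : ‖∑ c, (P x c : ℂ) * (aeig r b l c * E c)‖ ≤ (A + 1) * (‖l‖ ^ 3 * (M ^ 3 * Real.exp M)) := by
    refine norm_sum_P_le hS (fun c => ?_) x
    rw [norm_mul]
    exact mul_le_mul (hAl c) (hEb c) (norm_nonneg _) (by positivity)
  refine (norm_add_le _ _).trans ((add_le_add (norm_add_le _ _) le_rfl).trans ?_)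
  calc _ ≤ ‖l‖ ^ 3 * K + ‖l‖ ^ 3 * K' + (A + 1) * (‖l‖ ^ 3 * (M ^ 3 * Real.exp M)) :=
        add_le_add (add_le_add b1 b2) b3
    _ = _ := by ring
end

/-! ### Part 4 -/


/-! ### S4: Fourier matrices near zero -/
section
variable [Fintype X] [DecidableEq X] [Nonempty X] {P : X → X → ℝ} {ν f : X → ℝ}
attribute [local instance] Matrix.linftyOpNormedRing Matrix.linftyOpNormedAlgebra

lemma matnorm_le {A : Matrix X X ℂ} {B : ℝ} (hB : 0 ≤ B) (h : ∀ i, ∑ j, ‖A i j‖ ≤ B) : ‖A‖ ≤ B := by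
  rw [Matrix.linfty_opNorm_def]
  lift B to NNReal using hB
  rw [NNReal.coe_le_coe]
  refine Finset.sup_le fun i _ => ?_
  have := h i
  rw [← NNReal.coe_le_coe]
  push_cast
  exact this

lemma row_le_matnorm (A : Matrix X X ℂ) (i : X) : ∑ j, ‖A i j‖ ≤ ‖A‖ := by
  rw [Matrix.linfty_opNorm_def]
  have := Finset.le_sup (f := fun i => ∑ j, ‖A i j‖₊) (Finset.mem_univ i)
  rw [← NNReal.coe_le_coe] at this
  push_cast at this
  exact this

lemma entry_le_matnorm (A : Matrix X X ℂ) (i j : X) : ‖A i j‖ ≤ ‖A‖ :=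
  (Finset.single_le_sum (f := fun j => ‖A i j‖) (fun j _ => norm_nonneg _) (Finset.mem_univ j)).trans
    (row_le_matnorm A i)

lemma Pmat_apply (t : ℝ) (x x' : X) : Pmat P f t x x' =
    (P x x' : ℂ) * Complex.exp (Complex.I * (t : ℂ) * (f x' : ℂ)) := rfl

lemma norm_phase (t u : ℝ) : ‖Complex.exp (Complex.I * (t : ℂ) * (u : ℂ))‖ = 1 := by
  have : Complex.I * (t : ℂ) * (u : ℂ) = ((t * u : ℝ) : ℂ) * Complex.I := by push_cast; ring
  rw [this, Complex.norm_exp_ofReal_mul_I]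

lemma norm_phase_sub (t u : ℝ) : ‖Complex.exp (Complex.I * (t : ℂ) * (u : ℂ)) - 1‖ ≤ |t| * |u| := by
  have : Complex.I * (t : ℂ) * (u : ℂ) = Complex.I * ((t * u : ℝ) : ℂ) := by push_cast; ring
  rw [this, ← abs_mul]
  exact Real.norm_exp_I_mul_ofReal_sub_one_le

lemma Pmat_norm (hS : IsStochastic P ν) (t : ℝ) : ‖Pmat P f t‖ ≤ 1 := by
  refine matnorm_le zero_le_one fun i => ?_
  simp only [Pmat_apply, norm_mul, norm_phase, mul_one, Complex.norm_real,
    Real.norm_of_nonneg (hS.nonneg _ _), hS.rowSum, le_refl]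

lemma matnorm_one : ‖(1 : Matrix X X ℂ)‖ ≤ 1 := by
  refine matnorm_le zero_le_one fun i => ?_
  simp [Matrix.one_apply, apply_ite]

lemma matnorm_pow_le {A : Matrix X X ℂ} (hA : ‖A‖ ≤ 1) (n : ℕ) : ‖A ^ n‖ ≤ 1 := by
  induction n with
  | zero => simpa using matnorm_one
  | succ n ih =>
    rw [pow_succ]
    exact (norm_mul_le _ _).trans (mul_le_one₀ ih (norm_nonneg _) hA)

lemma matnorm_mul_le_right {A B : Matrix X X ℂ} (hA : ‖A‖ ≤ 1) : ‖A * B‖ ≤ ‖B‖ :=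
  (norm_mul_le _ _).trans (mul_le_of_le_one_left (norm_nonneg _) hA)
lemma matnorm_mul_le_left {A B : Matrix X X ℂ} (hB : ‖B‖ ≤ 1) : ‖A * B‖ ≤ ‖A‖ :=
  (norm_mul_le _ _).trans (mul_le_of_le_one_right (norm_nonneg _) hB)

lemma pow_sub_pow_norm {A B : Matrix X X ℂ} (hA : ‖A‖ ≤ 1) (hB : ‖B‖ ≤ 1) (n : ℕ) :
    ‖A ^ n - B ^ n‖ ≤ n * ‖A - B‖ := by
  induction n with
  | zero => simp
  | succ n ih =>
    have : A ^ (n + 1) - B ^ (n + 1) = A ^ n * (A - B) + (A ^ n - B ^ n) * B := by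
      rw [pow_succ, pow_succ]; noncomm_ring
    rw [this]
    refine (norm_add_le _ _).trans ?_
    have h1 := matnorm_mul_le_right (B := A - B) (matnorm_pow_le hA n)
    have h2 := matnorm_mul_le_left (A := A ^ n - B ^ n) hB
    push_cast
    linarith

/-- the rank one projection on constants -/
noncomputable def Pinf (ν : X → ℝ) : Matrix X X ℂ := Matrix.of fun _ x' => (ν x' : ℂ)

lemma rank_one_norm (hS : IsStochastic P ν) (a : X → ℂ) {B : ℝ} (hB : 0 ≤ B) (ha : ∀ x, ‖a x‖ ≤ B) :
    ‖(Matrix.of fun x x' => a x * (ν x' : ℂ) : Matrix X X ℂ)‖ ≤ B := by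
  refine matnorm_le hB fun i => ?_
  simp only [Matrix.of_apply, norm_mul, Complex.norm_real, Real.norm_of_nonneg (hS.nuPos _).le]
  rw [← Finset.mul_sum, hS.nuSum, mul_one]
  exact ha i

lemma Pinf_norm (hS : IsStochastic P ν) : ‖Pinf ν‖ ≤ 1 := by
  have := rank_one_norm hS (fun _ => 1) zero_le_one (by simp)
  simpa [Pinf] using this

lemma Pmat_zero : Pmat P f 0 = (Matrix.of P).map (fun z : ℝ => (z : ℂ)) := by
  ext x y; simp [Pmat_apply]

lemma Pmat_zero_pow (n : ℕ) (x x' : X) : (Pmat P f 0 ^ n) x x' = (kpow P n x x' : ℂ) := by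
  have h : Pmat P f 0 = Complex.ofRealHom.mapMatrix (Matrix.of P) := by
    rw [Pmat_zero]; rfl
  rw [h, ← map_pow, kpow_eq]; rfl

lemma Pmat_zero_lim (hS : IsStochastic P ν) (h1 : Primitive P) :
    ∃ C ρ : ℝ, 0 < C ∧ 0 < ρ ∧ ρ < 1 ∧ ∀ n, ‖Pmat P f 0 ^ n - Pinf ν‖ ≤ C * ρ ^ n := by
  obtain ⟨C, ρ, hC, h0, hρ, h⟩ := geom hS h1
  have hcard : (0:ℝ) < Fintype.card X := by exact_mod_cast Fintype.card_pos
  refine ⟨Fintype.card X * (C * 2), ρ, by positivity, h0, hρ, fun n => matnorm_le (by positivity) fun x => ?_⟩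
  have key : ∀ x', ‖(Pmat P f 0 ^ n - Pinf ν) x x'‖ ≤ C * ρ ^ n * 2 := by
    intro x'
    have hb := h (fun c => (if c = x' then 1 else 0) - ν x') 2 (by
      simp only [sub_mul, Finset.sum_sub_distrib, ← Finset.mul_sum, hS.nuSum]; simp) (by
      intro c
      have hν : ν x' ≤ 1 := by
        rw [← hS.nuSum]
        exact Finset.single_le_sum (f := ν) (fun j _ => (hS.nuPos j).le) (Finset.mem_univ x')
      have := hS.nuPos x'
      rw [abs_le]; split_ifs <;> constructor <;> linarith) n x
    rw [Pop_iter_eq] at hb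
    rw [Matrix.sub_apply, Pmat_zero_pow]
    simp only [Pinf, Matrix.of_apply]
    rw [← Complex.ofReal_sub, Complex.norm_real]
    convert hb using 2
    simp only [mul_sub, Finset.sum_sub_distrib, ← Finset.sum_mul, kpow_rowSum hS]
    simp
  calc _ ≤ ∑ x' : X, C * ρ ^ n * 2 := Finset.sum_le_sum fun x' _ => key x'
    _ = _ := by simp; ring

lemma Pmat_lip (hS : IsStochastic P ν) : ∃ M : ℝ, 0 < M ∧ ∀ t, ‖Pmat P f t - Pmat P f 0‖ ≤ M * |t| := by
  obtain ⟨M, hM0, hM⟩ := exists_bound f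
  refine ⟨M, hM0, fun t => matnorm_le (by positivity) fun x => ?_⟩
  calc _ ≤ ∑ b, P x b * (M * |t|) := by
        refine Finset.sum_le_sum fun b _ => ?_
        rw [Matrix.sub_apply, Pmat_apply, Pmat_apply]
        simp only [Complex.ofReal_zero, mul_zero, zero_mul, Complex.exp_zero]
        rw [← mul_sub, norm_mul, Complex.norm_real, Real.norm_of_nonneg (hS.nonneg _ _)]
        refine mul_le_mul_of_nonneg_left ((norm_phase_sub _ _).trans ?_) (hS.nonneg _ _)
        rw [mul_comm]
        exact mul_le_mul_of_nonneg_right (hM b) (abs_nonneg _)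
    _ = _ := by rw [← Finset.sum_mul, hS.rowSum, one_mul]

lemma clt_near (hS : IsStochastic P ν) (h1 : Primitive P) (h2 : ∑ x, f x * ν x = 0)
    (hσ : 0 < sigma2 P ν f) :
    ∃ t1 : ℝ, 0 < t1 ∧ sigma2 P ν f / 2 * t1 ^ 2 ≤ 1 ∧ ∀ ε : ℝ, 0 < ε → ∃ (m0 : ℕ) (K : ℝ), 0 < K ∧
      ∀ n ≥ m0, ∀ t : ℝ, |t| ≤ t1 →
      ‖Pmat P f t ^ n - (((1 - sigma2 P ν f / 2 * t ^ 2) ^ n : ℝ) : ℂ) • Pinf ν‖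
        ≤ ε + K * (|t| + n * |t| ^ 3) := by
  obtain ⟨r, b, C, hC, hae⟩ := exists_aeig hS h1 h2
  obtain ⟨A, hA0, hA⟩ := aeig_bound r b
  obtain ⟨C0, ρ, hC0, hρ0, hρ1, hlim⟩ := Pmat_zero_lim (f := f) hS h1
  obtain ⟨M, hM0, hM⟩ := Pmat_lip (f := f) hS
  set s := sigma2 P ν f / 2 with hs
  have hs0 : 0 < s := by positivity
  refine ⟨min 1 (1 / (s + 1)), by positivity, ?_, fun ε hε => ?_⟩
  · have h3 : min 1 (1 / (s + 1)) ≤ 1 / (s + 1) := min_le_right _ _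
    have h4 : min 1 (1 / (s + 1)) ≤ 1 := min_le_left _ _
    have h5 : (0:ℝ) ≤ min 1 (1 / (s + 1)) := by positivity
    have h6 : (s + 1) * (1 / (s + 1)) = 1 := by field_simp
    have h7 := mul_le_mul_of_nonneg_left h3 (by positivity : 0 ≤ s + 1)
    have h8 : (min 1 (1 / (s + 1))) ^ 2 ≤ min 1 (1 / (s + 1)) := by nlinarith
    have h9 := mul_le_mul_of_nonneg_left h8 hs0.le
    linarith
  obtain ⟨m, hm⟩ : ∃ m : ℕ, C0 * ρ ^ m ≤ ε := by
    have := (tendsto_pow_atTop_nhds_zero_of_lt_one hρ0.le hρ1).const_mul C0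
    rw [mul_zero] at this
    obtain ⟨m, hm⟩ := (this.eventually (gt_mem_nhds hε)).exists
    exact ⟨m, hm.le⟩
  refine ⟨m, m * M + C + 2 * A + m * s, by positivity, fun n hn t ht => ?_⟩
  have ht1 : |t| ≤ 1 := ht.trans (min_le_left _ _)
  have hst : s * t ^ 2 ≤ 1 := by
    have h3 : |t| ≤ 1 / (s + 1) := ht.trans (min_le_right _ _)
    have h5 := abs_nonneg t
    have h6 : (s + 1) * (1 / (s + 1)) = 1 := by field_simp
    rw [← sq_abs]
    have h7 := mul_le_mul_of_nonneg_left h3 (by positivity : 0 ≤ s + 1)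
    have h8 : |t| ^ 2 ≤ |t| := by nlinarith
    have h9 := mul_le_mul_of_nonneg_left h8 hs0.le
    linarith
  set μ : ℝ := 1 - s * t ^ 2 with hμ
  have hμ0 : 0 ≤ μ := by linarith
  have hμ1 : μ ≤ 1 := by have : 0 ≤ s * t ^ 2 := by positivity
                         linarith
  set Q := Pmat P f t with hQ
  have hQ1 : ‖Q‖ ≤ 1 := Pmat_norm hS t
  have hQ0 : ‖Pmat P f 0‖ ≤ 1 := Pmat_norm hS 0
  set l : ℂ := -(Complex.I * t) with hl
  have hln : ‖l‖ = |t| := by rw [hl, norm_neg, norm_mul, Complex.norm_I, Complex.norm_real, one_mul, Real.norm_eq_abs]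
  set AA : Matrix X X ℂ := Matrix.of fun x x' => aeig r b l x * (ν x' : ℂ) with hAA
  have hd : ‖AA - Pinf ν‖ ≤ A * |t| := by
    have : AA - Pinf ν = Matrix.of fun x x' => (aeig r b l x - 1) * (ν x' : ℂ) := by
      ext x x'; simp [hAA, Pinf, sub_mul]
    rw [this]
    refine rank_one_norm hS _ (by positivity) fun x => ?_
    have := hA l (by rw [hln]; exact ht1) x
    rwa [hln] at this
  have hq : ‖Q * AA - (μ : ℂ) • AA‖ ≤ C * |t| ^ 3 := by
    have : Q * AA - (μ : ℂ) • AA = Matrix.of fun x x' =>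
      (∑ c, (P x c : ℂ) * (aeig r b l c * Complex.exp (-l * f c)) - (1 + (s : ℝ) * l ^ 2) * aeig r b l x) * (ν x' : ℂ) := by
      ext x x'
      simp only [Matrix.sub_apply, Matrix.mul_apply, Matrix.smul_apply, hAA, Matrix.of_apply, smul_eq_mul, hQ, Pmat_apply]
      have e1 : (μ : ℂ) = 1 + (s : ℂ) * l ^ 2 := by
        rw [hμ, hl]; push_cast
        rw [neg_sq, mul_pow, Complex.I_sq]; ring
      rw [e1, sub_mul, Finset.sum_mul]
      congr 1
      · refine Finset.sum_congr rfl fun c _ => ?_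
        have : -l * (f c : ℂ) = Complex.I * t * f c := by rw [hl]; ring
        rw [this]; ring
      · ring
    rw [this]
    refine rank_one_norm hS _ (by positivity) fun x => ?_
    have := hae l (by rw [hln]; exact ht1) x
    rwa [hln] at this
  have hμn : ∀ k : ℕ, ‖((μ ^ k : ℝ) : ℂ)‖ ≤ 1 := fun k => by
    rw [Complex.norm_real, Real.norm_of_nonneg (by positivity)]
    exact pow_le_one₀ hμ0 hμ1
  have hj : ∀ j : ℕ, ‖Q ^ j * AA - ((μ ^ j : ℝ) : ℂ) • AA‖ ≤ j * (C * |t| ^ 3) := by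
    intro j
    induction j with
    | zero => simp
    | succ j ih =>
      have e : Q ^ (j + 1) * AA - ((μ ^ (j + 1) : ℝ) : ℂ) • AA =
        Q * (Q ^ j * AA - ((μ ^ j : ℝ) : ℂ) • AA) + ((μ ^ j : ℝ) : ℂ) • (Q * AA - (μ : ℂ) • AA) := by
        rw [pow_succ', mul_sub, smul_sub, smul_smul, mul_smul_comm, ← mul_assoc]
        push_cast
        rw [pow_succ]; abel
      rw [e]
      refine (norm_add_le _ _).trans ?_
      have a1 := matnorm_mul_le_right (B := Q ^ j * AA - ((μ ^ j : ℝ) : ℂ) • AA) hQ1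
      have a2 : ‖((μ ^ j : ℝ) : ℂ) • (Q * AA - (μ : ℂ) • AA)‖ ≤ C * |t| ^ 3 := by
        rw [norm_smul]
        exact (mul_le_of_le_one_left (norm_nonneg _) (hμn j)).trans hq
      rw [Nat.cast_succ]; linarith
  have hjP : ∀ j : ℕ, ‖Q ^ j * Pinf ν - ((μ ^ j : ℝ) : ℂ) • Pinf ν‖ ≤ j * (C * |t| ^ 3) + 2 * (A * |t|) := by
    intro j
    have e : Q ^ j * Pinf ν - ((μ ^ j : ℝ) : ℂ) • Pinf ν = (Q ^ j * AA - ((μ ^ j : ℝ) : ℂ) • AA)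
      - Q ^ j * (AA - Pinf ν) + ((μ ^ j : ℝ) : ℂ) • (AA - Pinf ν) := by
      rw [mul_sub, smul_sub]; abel
    rw [e]
    refine (norm_add_le _ _).trans ((add_le_add (norm_sub_le _ _) le_rfl).trans ?_)
    have a1 := matnorm_mul_le_right (B := AA - Pinf ν) (matnorm_pow_le hQ1 j)
    have a2 : ‖((μ ^ j : ℝ) : ℂ) • (AA - Pinf ν)‖ ≤ ‖AA - Pinf ν‖ := by
      rw [norm_smul]
      exact mul_le_of_le_one_left (norm_nonneg _) (hμn j)
    have := hj j
    linarith
  obtain ⟨j, rfl⟩ := Nat.exists_eq_add_of_le' hn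
  have e : Q ^ (j + m) - ((μ ^ (j + m) : ℝ) : ℂ) • Pinf ν =
      Q ^ j * (Q ^ m - Pmat P f 0 ^ m) + Q ^ j * (Pmat P f 0 ^ m - Pinf ν)
      + (Q ^ j * Pinf ν - ((μ ^ j : ℝ) : ℂ) • Pinf ν) + ((μ ^ j * (1 - μ ^ m) : ℝ) : ℂ) • Pinf ν := by
    rw [pow_add, pow_add, mul_sub, mul_sub]
    push_cast
    rw [mul_sub, sub_smul]; simp only [mul_one]; abel
  rw [e]
  refine (norm_add_le _ _).trans ((add_le_add (norm_add₃_le) le_rfl).trans ?_)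
  have a1 := (matnorm_mul_le_right (B := Q ^ m - Pmat P f 0 ^ m) (matnorm_pow_le hQ1 j)).trans
    ((pow_sub_pow_norm hQ1 hQ0 m).trans (mul_le_mul_of_nonneg_left (hM t) (by positivity)))
  have a2 := (matnorm_mul_le_right (B := Pmat P f 0 ^ m - Pinf ν) (matnorm_pow_le hQ1 j)).trans ((hlim m).trans hm)
  have a3 := hjP j
  have a4 : ‖((μ ^ j * (1 - μ ^ m) : ℝ) : ℂ) • Pinf ν‖ ≤ m * s * |t| := by
    rw [norm_smul, Complex.norm_real]
    refine (mul_le_of_le_one_right (norm_nonneg _) (Pinf_norm hS)).trans ?_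
    have b1 : μ ^ m ≤ 1 := pow_le_one₀ hμ0 hμ1
    have b2 : μ ^ j ≤ 1 := pow_le_one₀ hμ0 hμ1
    have b0 : 0 ≤ μ ^ j := by positivity
    have b3 := one_add_mul_le_pow (a := -(s * t ^ 2)) (by linarith) m
    have b4 : 1 + -(s * t ^ 2) = μ := by rw [hμ]; ring
    rw [b4] at b3
    rw [Real.norm_of_nonneg (mul_nonneg b0 (by linarith))]
    have b5 : t ^ 2 ≤ |t| := by rw [← sq_abs]; nlinarith [abs_nonneg t]
    calc μ ^ j * (1 - μ ^ m) ≤ 1 * (1 - μ ^ m) := mul_le_mul_of_nonneg_right b2 (by linarith)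
      _ ≤ m * (s * t ^ 2) := by linarith
      _ ≤ m * (s * |t|) := by gcongr
      _ = _ := by ring
  rw [Nat.cast_add]
  have c1 : (0:ℝ) ≤ |t| := abs_nonneg t
  have c2 : (0:ℝ) ≤ |t| ^ 3 := by positivity
  have c3 : (0:ℝ) ≤ j := by positivity
  have c4 : (0:ℝ) ≤ m := by positivity
  have d1 : (0:ℝ) ≤ m * |t| ^ 3 := by positivity
  have d2 : (0:ℝ) ≤ (m * M + 2 * A + m * s) * ((j + m) * |t| ^ 3) := by positivity
  have d3 : (0:ℝ) ≤ C * |t| := by positivity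
  have d4 : (0:ℝ) ≤ C * (m * |t| ^ 3) := by positivity
  nlinarith
end

/-! ### Part 5 -/


/-! ### S5: decay of the Fourier matrices -/
section
variable [Fintype X] [DecidableEq X] [Nonempty X] {P : X → X → ℝ} {ν f : X → ℝ}
attribute [local instance] Matrix.linftyOpNormedRing Matrix.linftyOpNormedAlgebra

lemma no_eig (hS : IsStochastic P ν) (h1 : Primitive P) (h3 : NonLattice P f) {t : ℝ} (ht : t ≠ 0)
    {k : ℂ} (hk : 1 ≤ ‖k‖) {v : X → ℂ} (hv : v ≠ 0)
    (he : ∀ x, ∑ b, Pmat P f t x b * v b = k * v x) : False := by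
  set z : X → ℂ := fun b => Complex.exp (Complex.I * (t : ℂ) * (f b : ℂ)) * v b with hz
  have hzn : ∀ b, ‖z b‖ = ‖v b‖ := fun b => by simp only [hz]; rw [norm_mul, norm_phase, one_mul]
  have he' : ∀ x, ∑ b, (P x b : ℂ) * z b = k * v x := fun x => by
    rw [← he x]
    exact Finset.sum_congr rfl fun b _ => by rw [Pmat_apply]; ring
  set u : X → ℝ := fun x => ‖v x‖ with hu
  have hsub : ∀ x, ‖k‖ * u x ≤ Pop P u x := by
    intro x
    have := norm_sum_le Finset.univ (fun b => (P x b : ℂ) * z b)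
    rw [he' x, norm_mul] at this
    refine this.trans (le_of_eq ?_)
    unfold Pop
    exact Finset.sum_congr rfl fun b _ => by
      rw [norm_mul, hzn, Complex.norm_real, Real.norm_of_nonneg (hS.nonneg _ _)]
  have hu0 : ∀ x, 0 ≤ u x := fun x => norm_nonneg _
  have hsub' : ∀ x, u x ≤ Pop P u x := fun x => (le_mul_of_one_le_left (hu0 x) hk).trans (hsub x)
  have hharm : ∀ x, Pop P u x = u x := by
    have h0 : ∑ x, (Pop P u x - u x) * ν x = 0 := by
      simp only [sub_mul, Finset.sum_sub_distrib, nu_Pop hS, sub_self]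
    intro x
    have := (Finset.sum_eq_zero_iff_of_nonneg
      (fun x _ => mul_nonneg (sub_nonneg.2 (hsub' x)) (hS.nuPos x).le)).1 h0 x (Finset.mem_univ x)
    rcases mul_eq_zero.1 this with h | h
    · linarith
    · exact absurd h (hS.nuPos x).ne'
  set B : ℝ := ∑ x, u x * ν x with hB
  have hconst : ∀ x, u x = B := by
    obtain ⟨C, ρ, hC, hρ0, hρ1, hg⟩ := geom hS h1
    obtain ⟨D, hD0, hD⟩ := exists_bound (fun x => u x - B)
    have hfix : Pop P (fun x => u x - B) = (fun x => u x - B) := by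
      funext x
      rw [Pop_sub (P := P) u (fun _ => B) x, hharm]
      simp [Pop, ← Finset.sum_mul, hS.rowSum]
    intro x
    have hle : ∀ n : ℕ, |u x - B| ≤ C * ρ ^ n * D := by
      intro n
      have := hg (fun x => u x - B) D (by
        simp only [sub_mul, Finset.sum_sub_distrib, ← Finset.mul_sum, hS.nuSum]; simp [hB]) hD n x
      rwa [Function.iterate_fixed hfix] at this
    have hl : Tendsto (fun n : ℕ => C * ρ ^ n * D) atTop (𝓝 (C * 0 * D)) :=
      ((tendsto_pow_atTop_nhds_zero_of_lt_one hρ0.le hρ1).const_mul C).mul_const D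
    have := ge_of_tendsto' hl hle
    simp only [mul_zero, zero_mul] at this
    have h4 := abs_nonpos_iff.1 this
    linarith
  have hBpos : 0 < B := by
    obtain ⟨x, hx⟩ := Function.ne_iff.1 hv
    rw [← hconst x]
    exact norm_pos_iff.2 hx
  have hk1 : ‖k‖ = 1 := by
    obtain ⟨x⟩ := ‹Nonempty X›
    have := hsub x
    rw [hharm, hconst] at this
    refine le_antisymm ?_ hk
    by_contra hc
    push Not at hc
    nlinarith
  have hedge : ∀ x b, 0 < P x b → z b = k * v x := by
    intro x b hxb
    set w := k * v x with hw
    have hwn : ‖w‖ = B := by rw [hw, norm_mul, hk1, one_mul]; exact hconst x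
    have hsq : ∑ b, P x b * ‖z b - w‖ ^ 2 = 0 := by
      have e1 : ∀ b, P x b * ‖z b - w‖ ^ 2 = 2 * B ^ 2 * P x b - 2 * ((starRingEnd ℂ) w * ((P x b : ℂ) * z b)).re := by
        intro b
        have hzb : ‖z b‖ = B := (hzn b).trans (hconst b)
        have a1 : ‖z b‖ ^ 2 = (z b).re ^ 2 + (z b).im ^ 2 := by
          rw [← Complex.normSq_eq_norm_sq, Complex.normSq_apply]; ring
        have a2 : ‖w‖ ^ 2 = w.re ^ 2 + w.im ^ 2 := by
          rw [← Complex.normSq_eq_norm_sq, Complex.normSq_apply]; ring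
        have a3 : ‖z b - w‖ ^ 2 = ((z b).re - w.re) ^ 2 + ((z b).im - w.im) ^ 2 := by
          rw [← Complex.normSq_eq_norm_sq, Complex.normSq_apply]; simp; ring
        rw [hzb] at a1
        rw [hwn] at a2
        rw [a3]
        simp only [Complex.mul_re, Complex.conj_re, Complex.conj_im, Complex.ofReal_re, Complex.ofReal_im, Complex.mul_im]
        linear_combination (-(P x b)) * a1 - (P x b) * a2
      simp only [e1, Finset.sum_sub_distrib, ← Finset.mul_sum, hS.rowSum]
      rw [← Complex.re_sum, ← Finset.mul_sum, he' x, ← hw]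
      have : ((starRingEnd ℂ) w * w).re = B ^ 2 := by
        rw [← hwn, ← Complex.normSq_eq_conj_mul_self, Complex.normSq_eq_norm_sq]
        exact Complex.ofReal_re _
      rw [this]; ring
    have h6 := (Finset.sum_eq_zero_iff_of_nonneg
      (fun b _ => mul_nonneg (hS.nonneg x b) (sq_nonneg _))).1 hsq b (Finset.mem_univ b)
    rcases mul_eq_zero.1 h6 with h | h
    · exact absurd h hxb.ne'
    · have := pow_eq_zero_iff (two_ne_zero) |>.1 h
      exact sub_eq_zero.1 (norm_eq_zero.1 this)
  obtain ⟨n, g, hg, hne⟩ := h3 (k.arg / t) (2 * π / t)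
  have hprod : ∏ i, z (g (i + 1)) = ∏ i, (k * v (g i)) :=
    Finset.prod_congr rfl fun i _ => hedge _ _ (cyc_pos hS.nonneg hg i)
  have hshift : ∏ i, z (g (i + 1)) = ∏ i, z (g i) :=
    Equiv.prod_comp (Equiv.addRight (1 : Fin (n+1))) (fun i => z (g i))
  rw [hshift] at hprod
  simp only [hz, Finset.prod_mul_distrib] at hprod
  have hvne : ∏ i, v (g i) ≠ 0 := Finset.prod_ne_zero_iff.2 fun i _ => by
    rw [← norm_ne_zero_iff]
    have := hconst (g i)
    simp only [hu] at this
    rw [this]; exact hBpos.ne'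
  have hpow := mul_right_cancel₀ hvne hprod
  rw [← Complex.exp_sum, Finset.prod_const, Finset.card_univ, Fintype.card_fin] at hpow
  have hkexp : k = Complex.exp (k.arg * Complex.I) := by
    have := Complex.norm_mul_exp_arg_mul_I k
    rw [hk1, Complex.ofReal_one, one_mul] at this
    exact this.symm
  rw [hkexp, ← Complex.exp_nat_mul, ← sub_eq_zero] at hpow
  have h7 : Complex.exp (∑ i, Complex.I * (t:ℂ) * (f (g i) : ℂ) - ((n + 1 : ℕ) : ℂ) * (k.arg * Complex.I)) = 1 := by
    rw [Complex.exp_sub, sub_eq_zero.1 hpow, div_self (Complex.exp_ne_zero _)]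
  obtain ⟨m, hm⟩ := Complex.exp_eq_one_iff.1 h7
  refine hne m ?_
  have h8 : (t : ℂ) * (∑ i, (f (g i) : ℂ)) - ((n : ℂ) + 1) * k.arg = m * (2 * π) := by
    apply mul_left_cancel₀ Complex.I_ne_zero
    rw [← Finset.mul_sum] at hm
    push_cast at hm
    linear_combination hm
  have h9 : t * (∑ i, f (g i)) - ((n : ℝ) + 1) * k.arg = m * (2 * π) := by
    exact_mod_cast h8
  field_simp
  linarith

lemma exists_pow_lt (hS : IsStochastic P ν) (h1 : Primitive P) (h3 : NonLattice P f) {t : ℝ} (ht : t ≠ 0) :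
    ∃ N : ℕ, ‖Pmat P f t ^ N‖ < 1 / 2 := by
  set Q := Pmat P f t
  have hsp : spectralRadius ℂ Q < ((1 : NNReal) : ENNReal) := by
    refine spectrum.spectralRadius_lt_of_forall_lt Q fun z hz => ?_
    by_contra hc
    push Not at hc
    rw [← Matrix.spectrum_toLin', ← Module.End.hasEigenvalue_iff_mem_spectrum] at hz
    obtain ⟨v, hv⟩ := hz.exists_hasEigenvector
    refine no_eig hS h1 h3 ht (k := z) (v := v) (by exact_mod_cast hc) hv.2 fun x => ?_
    have := congrFun hv.apply_eq_smul x
    rw [Matrix.toLin'_apply] at this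
    simpa [Matrix.mulVec, dotProduct] using this
  obtain ⟨r, hr1, hr2⟩ := ENNReal.lt_iff_exists_nnreal_btwn.1 hsp
  have hr2' : r < 1 := by exact_mod_cast hr2
  have hG := spectrum.pow_nnnorm_pow_one_div_tendsto_nhds_spectralRadius Q
  have ev1 := hG.eventually (gt_mem_nhds hr1)
  have hp := tendsto_pow_atTop_nhds_zero_of_lt_one (r := (r : ℝ)) r.2 (by exact_mod_cast hr2')
  have ev2 := hp.eventually (gt_mem_nhds (by norm_num : (0:ℝ) < 1 / 2))
  obtain ⟨N, hN1, hN2, hN3⟩ := (ev1.and (ev2.and (eventually_gt_atTop 0))).exists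
  refine ⟨N, lt_of_le_of_lt ?_ hN2⟩
  have hN0 : (0:ℝ) < N := by exact_mod_cast hN3
  have := ENNReal.rpow_le_rpow hN1.le hN0.le
  rw [← ENNReal.rpow_mul, one_div_mul_cancel hN0.ne', ENNReal.rpow_one, ENNReal.rpow_natCast] at this
  have h4 : ‖Q ^ N‖₊ ≤ r ^ N := by exact_mod_cast this
  exact_mod_cast h4

lemma Pmat_cont : Continuous (fun t : ℝ => Pmat P f t) := by
  refine continuous_matrix fun x b => ?_
  simp only [Pmat_apply]
  fun_prop

lemma Pmat_pow_cont (n : ℕ) : Continuous (fun t : ℝ => Pmat P f t ^ n) := Pmat_cont.pow n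

lemma unif_far (hS : IsStochastic P ν) (h1 : Primitive P) (h3 : NonLattice P f) {η : ℝ} (hη : 0 < η) (T : ℝ) :
    ∃ N : ℕ, 1 ≤ N ∧ ∀ t, η ≤ |t| → |t| ≤ T → ‖Pmat P f t ^ N‖ ≤ 1 / 2 := by
  have hK : IsCompact {t : ℝ | η ≤ |t| ∧ |t| ≤ T} := by
    refine (isCompact_Icc (a := -T) (b := T)).of_isClosed_subset ?_ fun t ht => abs_le.1 ht.2
    exact (isClosed_le continuous_const continuous_abs).inter (isClosed_le continuous_abs continuous_const)
  have hdec : ∀ t, ∀ N M : ℕ, N ≤ M → ‖Pmat P f t ^ M‖ ≤ ‖Pmat P f t ^ N‖ := by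
    intro t N M h
    obtain ⟨j, rfl⟩ := Nat.exists_eq_add_of_le' h
    rw [pow_add]
    exact matnorm_mul_le_right (matnorm_pow_le (Pmat_norm hS t) j)
  obtain ⟨N, hN⟩ := hK.elim_directed_cover (fun N : ℕ => {t : ℝ | ‖Pmat P f t ^ N‖ < 1 / 2})
    (fun N => isOpen_lt (Pmat_pow_cont N).norm continuous_const)
    (fun t ht => by
      obtain ⟨N, hN⟩ := exists_pow_lt hS h1 h3 (t := t) (by
        intro h0; rw [h0] at ht; have := ht.1; simp at this; linarith)
      exact Set.mem_iUnion.2 ⟨N, hN⟩)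
    (directed_of_isDirected_le fun N M h t ht => lt_of_le_of_lt (hdec t N M h) ht)
  refine ⟨N + 1, by omega, fun t h4 h5 => (hdec t N (N + 1) (by omega)).trans ?_⟩
  exact (hN ⟨h4, h5⟩ : ‖Pmat P f t ^ N‖ < 1 / 2).le

lemma half_decay {A : Matrix X X ℂ} (hA : ‖A‖ ≤ 1) {N : ℕ} (hN : 1 ≤ N) (h : ‖A ^ N‖ ≤ 1 / 2)
    {c : ℝ} (hc : c * N ≤ Real.log 2) (hc0 : 0 ≤ c) (n : ℕ) : ‖A ^ n‖ ≤ 2 * Real.exp (-(c * n)) := by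
  have h1 : ∀ q : ℕ, ‖A ^ (N * q)‖ ≤ (1 / 2) ^ q := by
    intro q
    induction q with
    | zero => simp
    | succ q ih =>
      rw [mul_add, pow_add, mul_one, pow_succ]
      exact (norm_mul_le _ _).trans (mul_le_mul ih h (norm_nonneg _) (by positivity))
  have h2 : ‖A ^ n‖ ≤ (1 / 2) ^ (n / N) := by
    conv_lhs => rw [← Nat.div_add_mod n N, pow_add]
    exact (matnorm_mul_le_left (matnorm_pow_le hA _)).trans (h1 _)
  refine h2.trans ?_
  have e2 : (2:ℝ) = Real.exp (Real.log 2) := (Real.exp_log (by norm_num)).symm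
  have e3 : (1 / 2 : ℝ) ^ (n / N) = Real.exp (-(Real.log 2 * (n / N : ℕ))) := by
    rw [one_div, inv_pow, Real.exp_neg, mul_comm, Real.exp_nat_mul, ← e2]
  rw [e3]
  conv_rhs => rw [e2]
  rw [← Real.exp_add, Real.exp_le_exp]
  have hdm : (n : ℝ) ≤ N * (n / N : ℕ) + N := by
    have := Nat.div_add_mod n N
    have h5 := Nat.mod_lt n (by omega : 0 < N)
    have : n ≤ N * (n / N) + N := by omega
    exact_mod_cast this
  have hq : (0:ℝ) ≤ ((n / N : ℕ) : ℝ) := by positivity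
  have h6 := mul_le_mul_of_nonneg_left hdm hc0
  have h7 := mul_le_mul_of_nonneg_right hc hq
  nlinarith

lemma decay (hS : IsStochastic P ν) (h1 : Primitive P) (h2 : ∑ x, f x * ν x = 0) (h3 : NonLattice P f)
    (T : ℝ) : ∃ c : ℝ, 0 < c ∧ ∀ t, |t| ≤ T → ∀ n : ℕ, ‖Pmat P f t ^ n‖ ≤ 2 * Real.exp (-(c * t ^ 2 * n)) := by
  have hσ := sigma2_pos hS h1 h2 h3
  obtain ⟨t1, ht1, hst, hcl⟩ := clt_near hS h1 h2 hσ
  obtain ⟨m0, K, hK, hcl⟩ := hcl (1/8) (by norm_num)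
  set s := sigma2 P ν f / 2 with hs
  have hs0 : 0 < s := by positivity
  set A := 2 / s with hA
  have hA0 : 0 < A := by positivity
  set t2 := min (min t1 1) (min (1 / (8 * K * (A + 2))) (A / (m0 + 1 + A))) with ht2
  have ht20 : 0 < t2 := by positivity
  have l2 : (0:ℝ) < Real.log 2 := Real.log_pos (by norm_num)
  have near : ∀ t, t ≠ 0 → |t| ≤ t2 → ∀ n : ℕ, ‖Pmat P f t ^ n‖ ≤ 2 * Real.exp (-((Real.log 2 / (A + 1)) * t ^ 2 * n)) := by
    intro t ht0 ht n
    have b1 : |t| ≤ t1 := ht.trans ((min_le_left _ _).trans (min_le_left _ _))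
    have b2 : |t| ≤ 1 := ht.trans ((min_le_left _ _).trans (min_le_right _ _))
    have b3 : |t| ≤ 1 / (8 * K * (A + 2)) := ht.trans ((min_le_right _ _).trans (min_le_left _ _))
    have b4 : |t| ≤ A / (m0 + 1 + A) := ht.trans ((min_le_right _ _).trans (min_le_right _ _))
    have hta : 0 < |t| := abs_pos.2 ht0
    have ht2p : 0 < t ^ 2 := by positivity
    have htsq : t ^ 2 ≤ |t| := by rw [← sq_abs]; nlinarith
    set N := ⌈A / t ^ 2⌉₊ with hN
    have hN1 : A / t ^ 2 ≤ N := Nat.le_ceil _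
    have hN2 : (N : ℝ) < A / t ^ 2 + 1 := Nat.ceil_lt_add_one (by positivity)
    have hN3 : A ≤ N * t ^ 2 := by rwa [div_le_iff₀ ht2p] at hN1
    have hN4 : N * t ^ 2 ≤ A + t ^ 2 := by
      have := mul_le_mul_of_nonneg_right hN2.le ht2p.le
      rwa [add_mul, one_mul, div_mul_cancel₀ _ ht2p.ne'] at this
    have hNm : (m0 : ℝ) < N := by
      rw [le_div_iff₀ (by positivity)] at b4
      have : (m0 : ℝ) * t ^ 2 < N * t ^ 2 := by
        have hm : (0:ℝ) ≤ m0 := by positivity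
        nlinarith
      exact lt_of_mul_lt_mul_right this ht2p.le
    have hNm' : m0 < N := by exact_mod_cast hNm
    have hc := hcl N hNm'.le t b1
    have hμ0 : 0 ≤ 1 - s * t ^ 2 := by
      have : t ^ 2 ≤ t1 ^ 2 := by rw [← sq_abs]; gcongr
      nlinarith
    have hμ : (1 - s * t ^ 2) ^ N ≤ 1 / 4 := by
      have a1 : 1 - s * t ^ 2 ≤ Real.exp (-(s * t ^ 2)) := by
        have := Real.add_one_le_exp (-(s * t ^ 2)); linarith
      calc (1 - s * t ^ 2) ^ N ≤ Real.exp (-(s * t ^ 2)) ^ N := pow_le_pow_left₀ hμ0 a1 N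
        _ = Real.exp (-(s * (N * t ^ 2))) := by rw [← Real.exp_nat_mul]; ring_nf
        _ ≤ Real.exp (-2) := by
          rw [Real.exp_le_exp]
          have : s * A = 2 := by rw [hA]; field_simp
          nlinarith
        _ ≤ 1 / 4 := by
          rw [Real.exp_neg, ← one_div]
          apply one_div_le_one_div_of_le (by norm_num)
          have := Real.quadratic_le_exp_of_nonneg (x := 2) (by norm_num)
          linarith
    have hP2 : ‖Pmat P f t ^ N‖ ≤ 1 / 2 := by
      have a1 : ‖(((1 - s * t ^ 2) ^ N : ℝ) : ℂ) • Pinf ν‖ ≤ 1 / 4 := by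
        rw [norm_smul, Complex.norm_real, Real.norm_of_nonneg (by positivity)]
        exact (mul_le_of_le_one_right (by positivity) (Pinf_norm hS)).trans hμ
      have a2 : K * (|t| + N * |t| ^ 3) ≤ 1 / 8 := by
        rw [le_div_iff₀ (by positivity)] at b3
        have a3 : (N : ℝ) * |t| ^ 3 = (N * t ^ 2) * |t| := by rw [← sq_abs]; ring
        rw [a3]
        have a4 : (N * t ^ 2) * |t| ≤ (A + 1) * |t| := by
          refine mul_le_mul_of_nonneg_right ?_ hta.le; linarith
        have := mul_le_mul_of_nonneg_left a4 hK.le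
        nlinarith
      have a5 := norm_sub_norm_le (Pmat P f t ^ N) ((((1 - s * t ^ 2) ^ N : ℝ) : ℂ) • Pinf ν)
      linarith
    refine half_decay (Pmat_norm hS t) (by omega) hP2 ?_ (by positivity) n
    calc Real.log 2 / (A + 1) * t ^ 2 * N = Real.log 2 * ((N * t ^ 2) / (A + 1)) := by ring
      _ ≤ Real.log 2 * 1 := by
        refine mul_le_mul_of_nonneg_left ?_ l2.le
        rw [div_le_one (by positivity)]; linarith
      _ = _ := mul_one _
  obtain ⟨N, hN1, hN⟩ := unif_far hS h1 h3 ht20 (T := T)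
  refine ⟨min (Real.log 2 / (A + 1)) (Real.log 2 / (N * (T ^ 2 + 1))), ?_, fun t htT n => ?_⟩
  · have : (0:ℝ) < N := by exact_mod_cast hN1
    positivity
  have hN0 : (0:ℝ) < N := by exact_mod_cast hN1
  have mono : ∀ c c' : ℝ, c' ≤ c → 2 * Real.exp (-(c * t ^ 2 * n)) ≤ 2 * Real.exp (-(c' * t ^ 2 * n)) := by
    intro c c' h
    gcongr
  by_cases ht0 : t = 0
  · subst ht0
    simp only [ne_eq, OfNat.ofNat_ne_zero, not_false_eq_true, zero_pow, mul_zero, zero_mul, neg_zero, Real.exp_zero]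
    linarith [matnorm_pow_le (Pmat_norm (f := f) hS 0) n]
  by_cases ht : |t| ≤ t2
  · exact (near t ht0 ht n).trans (mono _ _ (min_le_left _ _))
  · push Not at ht
    refine le_trans ?_ (mono _ _ (min_le_right _ _))
    refine half_decay (Pmat_norm hS t) hN1 (hN t ht.le htT) ?_ (by positivity) n
    have : t ^ 2 ≤ T ^ 2 := by rw [← sq_abs]; gcongr
    calc Real.log 2 / (N * (T ^ 2 + 1)) * t ^ 2 * N = Real.log 2 * (t ^ 2 / (T ^ 2 + 1)) := by
          field_simp
      _ ≤ Real.log 2 * 1 := by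
        refine mul_le_mul_of_nonneg_left ?_ l2.le
        rw [div_le_one (by positivity)]; linarith
      _ = _ := mul_one _
end

/-! ### Part 6 -/


/-! ### S6: integrated Fourier bounds -/
section
variable [Fintype X] [DecidableEq X] [Nonempty X] {P : X → X → ℝ} {ν f : X → ℝ}
attribute [local instance] Matrix.linftyOpNormedRing Matrix.linftyOpNormedAlgebra

/-- difference between the Fourier matrix and its Gaussian limit -/
noncomputable def gdiff (P : X → X → ℝ) (ν f : X → ℝ) (n : ℕ) (t : ℝ) : ℝ :=
  ‖Pmat P f t ^ n - ((Real.exp (-(sigma2 P ν f / 2 * t ^ 2 * n)) : ℝ) : ℂ) • Pinf ν‖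

lemma gdiff_cont (n : ℕ) : Continuous (gdiff P ν f n) := by
  unfold gdiff
  have h1 : Continuous (fun t : ℝ => ((Real.exp (-(sigma2 P ν f / 2 * t ^ 2 * n)) : ℝ) : ℂ)) := by fun_prop
  have h2 : Continuous (fun t : ℝ => Pmat P f t ^ n - ((Real.exp (-(sigma2 P ν f / 2 * t ^ 2 * n)) : ℝ) : ℂ) • Pinf ν) :=
    (Pmat_pow_cont n).sub (h1.smul continuous_const)
  exact h2.norm

lemma gdiff_nonneg (n : ℕ) (t : ℝ) : 0 ≤ gdiff P ν f n t := norm_nonneg _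

lemma Pdiff_cont (n m : ℕ) : Continuous (fun t : ℝ => ‖Pmat P f t ^ n - Pmat P f t ^ m‖) := by
  have h2 : Continuous (fun t : ℝ => Pmat P f t ^ n - Pmat P f t ^ m) :=
    (Pmat_pow_cont n).sub (Pmat_pow_cont m)
  exact h2.norm

lemma gdiff_ptwise (hS : IsStochastic P ν) (h1 : Primitive P) (h2 : ∑ x, f x * ν x = 0)
    (h3 : NonLattice P f) (u : ℝ) :
    Tendsto (fun n : ℕ => gdiff P ν f n (u / Real.sqrt n)) atTop (𝓝 0) := by
  have hσ := sigma2_pos hS h1 h2 h3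
  obtain ⟨t1, ht1, hst, hcl⟩ := clt_near hS h1 h2 hσ
  set s := sigma2 P ν f / 2 with hs
  have hsq : Tendsto (fun n : ℕ => Real.sqrt n) atTop atTop :=
    Real.tendsto_sqrt_atTop.comp tendsto_natCast_atTop_atTop
  have hu0 : Tendsto (fun n : ℕ => |u| / Real.sqrt n) atTop (𝓝 0) := hsq.const_div_atTop _
  have hu3 : Tendsto (fun n : ℕ => |u| ^ 3 / Real.sqrt n) atTop (𝓝 0) := hsq.const_div_atTop _
  have hexp := Real.tendsto_one_add_div_pow_exp (-(s * u ^ 2))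
  rw [Metric.tendsto_atTop] at hexp
  rw [Metric.tendsto_atTop]
  intro ε hε
  obtain ⟨m0, K, hK, hcl⟩ := hcl (ε / 4) (by positivity)
  obtain ⟨N1, hN1⟩ := hexp (ε / 4) (by positivity)
  have hKe : Tendsto (fun n : ℕ => K * (|u| / Real.sqrt n + |u| ^ 3 / Real.sqrt n)) atTop (𝓝 0) := by
    simpa using (hu0.add hu3).const_mul K
  obtain ⟨N2, hN2⟩ := eventually_atTop.1 ((hKe.eventually (gt_mem_nhds (by positivity : (0:ℝ) < ε / 4))).and
    (hu0.eventually (gt_mem_nhds ht1)))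
  refine ⟨max (max N1 N2) (max m0 1), fun n hn => ?_⟩
  simp only [ge_iff_le, max_le_iff] at hn
  obtain ⟨⟨a1, a2⟩, a3, a4⟩ := hn
  have hn0 : (0:ℝ) < n := by exact_mod_cast a4
  have hsn : 0 < Real.sqrt n := Real.sqrt_pos.2 hn0
  have hsn2 : Real.sqrt n ^ 2 = n := Real.sq_sqrt hn0.le
  have habs : |u / Real.sqrt n| = |u| / Real.sqrt n := by rw [abs_div, abs_of_pos hsn]
  have b1 := hcl n a3 (u / Real.sqrt n) (by rw [habs]; exact (hN2 n a2).2.le)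
  have b2 := hN1 n a1
  have b3 := (hN2 n a2).1
  have e2 : (u / Real.sqrt n) ^ 2 = u ^ 2 / n := by rw [div_pow, hsn2]
  have e3 : |u / Real.sqrt n| + n * |u / Real.sqrt n| ^ 3 = |u| / Real.sqrt n + |u| ^ 3 / Real.sqrt n := by
    rw [habs]; congr 1
    rw [div_pow]
    nth_rewrite 1 [← hsn2]
    field_simp
  rw [e3] at b1
  rw [Real.dist_eq, sub_zero, abs_of_nonneg (gdiff_nonneg _ _)]
  unfold gdiff
  rw [e2] at b1 ⊢
  have e4 : 1 - s * (u ^ 2 / n) = 1 + -(s * u ^ 2) / n := by ring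
  have e5 : -(s * (u ^ 2 / n) * n) = -(s * u ^ 2) := by field_simp
  rw [e4] at b1
  rw [e5]
  set Q := Pmat P f (u / Real.sqrt n) ^ n
  set α := (1 + -(s * u ^ 2) / n) ^ n
  set β := Real.exp (-(s * u ^ 2))
  have e6 : Q - (β : ℂ) • Pinf ν = (Q - (α : ℂ) • Pinf ν) + ((α - β : ℝ) : ℂ) • Pinf ν := by
    push_cast; rw [sub_smul]; abel
  rw [e6]
  refine lt_of_le_of_lt (norm_add_le _ _) ?_
  have b4 : ‖((α - β : ℝ) : ℂ) • Pinf ν‖ ≤ ε / 4 := by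
    rw [norm_smul, Complex.norm_real]
    exact (mul_le_of_le_one_right (norm_nonneg _) (Pinf_norm hS)).trans b2.le
  linarith

lemma gdiff_int (hS : IsStochastic P ν) (h1 : Primitive P) (h2 : ∑ x, f x * ν x = 0)
    (h3 : NonLattice P f) {T : ℝ} (hT : 0 < T) :
    Tendsto (fun n : ℕ => Real.sqrt n * ∫ t in (-T)..T, gdiff P ν f n t) atTop (𝓝 0) := by
  have hσ := sigma2_pos hS h1 h2 h3
  obtain ⟨c, hc, hdec⟩ := decay hS h1 h2 h3 T
  have key : ∀ n : ℕ, 1 ≤ n → Real.sqrt n * ∫ t in (-T)..T, gdiff P ν f n t =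
      ∫ u, (Set.Ioc (-T * Real.sqrt n) (T * Real.sqrt n)).indicator (fun u => gdiff P ν f n (u / Real.sqrt n)) u := by
    intro n hn
    have hsn : 0 < Real.sqrt n := Real.sqrt_pos.2 (by exact_mod_cast hn)
    rw [integral_indicator measurableSet_Ioc, ← intervalIntegral.integral_of_le (by nlinarith),
      intervalIntegral.integral_comp_div _ hsn.ne', mul_div_cancel_right₀ _ hsn.ne',
      mul_div_cancel_right₀ _ hsn.ne', smul_eq_mul]
  refine Tendsto.congr' (f₁ := fun n : ℕ => ∫ u, (Set.Ioc (-T * Real.sqrt n) (T * Real.sqrt n)).indicator (fun u => gdiff P ν f n (u / Real.sqrt n)) u) ?_ ?_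
  · filter_upwards [eventually_ge_atTop 1] with n hn using (key n hn).symm
  have h0 : (0:ℝ) = ∫ _ : ℝ, (0:ℝ) := by simp
  rw [h0]
  refine tendsto_integral_filter_of_dominated_convergence
    (fun u => 2 * Real.exp (-c * u ^ 2) + Real.exp (-(sigma2 P ν f / 2) * u ^ 2)) ?_ ?_ ?_ ?_
  · refine Eventually.of_forall fun n => ?_
    refine AEStronglyMeasurable.indicator ?_ measurableSet_Ioc
    exact ((gdiff_cont n).comp (continuous_id.div_const _)).aestronglyMeasurable
  · filter_upwards [eventually_ge_atTop 1] with n hn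
    refine Eventually.of_forall fun u => ?_
    have hn0 : (0:ℝ) < n := by exact_mod_cast hn
    have hsn : 0 < Real.sqrt n := Real.sqrt_pos.2 hn0
    by_cases hu : u ∈ Set.Ioc (-T * Real.sqrt n) (T * Real.sqrt n)
    · rw [Set.indicator_of_mem hu]
      rw [Real.norm_of_nonneg (gdiff_nonneg _ _)]
      unfold gdiff
      have e2 : (u / Real.sqrt n) ^ 2 * n = u ^ 2 := by
        rw [div_pow, Real.sq_sqrt hn0.le, div_mul_cancel₀ _ hn0.ne']
      refine (norm_sub_le _ _).trans (add_le_add ?_ ?_)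
      · have := hdec (u / Real.sqrt n) (by
          rw [abs_div, abs_of_pos hsn, div_le_iff₀ hsn, abs_le]
          exact ⟨by linarith [hu.1], hu.2⟩) n
        rw [mul_assoc, e2] at this
        rwa [neg_mul]
      · rw [norm_smul, Complex.norm_real, Real.norm_of_nonneg (Real.exp_pos _).le, mul_assoc, e2, ← neg_mul]
        exact mul_le_of_le_one_right (Real.exp_pos _).le (Pinf_norm hS)
    · rw [Set.indicator_of_notMem hu, norm_zero]
      positivity
  · exact ((integrable_exp_neg_mul_sq hc).const_mul 2).add (integrable_exp_neg_mul_sq (by positivity))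
  · refine Eventually.of_forall fun u => ?_
    refine squeeze_zero (fun n => ?_) (fun n => ?_) (gdiff_ptwise hS h1 h2 h3 u)
    · exact Set.indicator_nonneg (fun _ _ => norm_nonneg _) _
    · exact Set.indicator_le_self' (fun _ _ => norm_nonneg _) _

/-- integrated norm -/
noncomputable def IT (P : X → X → ℝ) (f : X → ℝ) (T : ℝ) (l : ℕ) : ℝ := ∫ t in (-T)..T, ‖Pmat P f t ^ l‖
/-- integrated difference -/
noncomputable def DT (P : X → X → ℝ) (f : X → ℝ) (T : ℝ) (l l' : ℕ) : ℝ :=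
  ∫ t in (-T)..T, ‖Pmat P f t ^ l' - Pmat P f t ^ l‖

lemma gauss_le {a : ℝ} (ha : 0 < a) {T : ℝ} (hT : 0 < T) :
    ∫ t in (-T)..T, Real.exp (-a * t ^ 2) ≤ Real.sqrt (π / a) := by
  rw [← integral_gaussian, intervalIntegral.integral_of_le (by linarith)]
  exact setIntegral_le_integral (integrable_exp_neg_mul_sq ha) (Eventually.of_forall fun _ => (Real.exp_pos _).le)

lemma gauss_sub_le {a b : ℝ} (ha : 0 < a) (hab : a ≤ b) {T : ℝ} (hT : 0 < T) :
    ∫ t in (-T)..T, (Real.exp (-a * t ^ 2) - Real.exp (-b * t ^ 2)) ≤ Real.sqrt (π / a) - Real.sqrt (π / b) := by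
  rw [← integral_gaussian, ← integral_gaussian, intervalIntegral.integral_of_le (by linarith),
    ← integral_sub (integrable_exp_neg_mul_sq ha) (integrable_exp_neg_mul_sq (by linarith))]
  refine setIntegral_le_integral ((integrable_exp_neg_mul_sq ha).sub (integrable_exp_neg_mul_sq (by linarith)))
    (Eventually.of_forall fun t => ?_)
  simp only [Pi.zero_apply, sub_nonneg, Real.exp_le_exp]
  nlinarith [sq_nonneg t]

lemma IT_bound (hS : IsStochastic P ν) (h1 : Primitive P) (h2 : ∑ x, f x * ν x = 0)
    (h3 : NonLattice P f) : ∃ C1 : ℝ, 0 < C1 ∧ ∀ T : ℝ, 0 < T → ∃ l0 : ℕ, 1 ≤ l0 ∧ ∀ l ≥ l0,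
      IT P f T l ≤ C1 / Real.sqrt l := by
  have hσ := sigma2_pos hS h1 h2 h3
  set s := sigma2 P ν f / 2 with hs
  have hs0 : 0 < s := by positivity
  refine ⟨Real.sqrt (π / s) + 1, by positivity, fun T hT => ?_⟩
  obtain ⟨N, hN⟩ := eventually_atTop.1 ((gdiff_int hS h1 h2 h3 hT).eventually (gt_mem_nhds (zero_lt_one)))
  refine ⟨max N 1, le_max_right _ _, fun l hl => ?_⟩
  have hl1 : N ≤ l := (le_max_left _ _).trans hl
  have hl2 : 1 ≤ l := (le_max_right _ _).trans hl
  have hl0 : (0:ℝ) < l := by exact_mod_cast hl2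
  have hsl : 0 < Real.sqrt l := Real.sqrt_pos.2 hl0
  have b1 := hN l hl1
  have b2 : IT P f T l ≤ (∫ t in (-T)..T, gdiff P ν f l t) + ∫ t in (-T)..T, Real.exp (-(s * l) * t ^ 2) := by
    unfold IT
    rw [← intervalIntegral.integral_add ((gdiff_cont l).intervalIntegrable _ _)
      (Continuous.intervalIntegrable (by fun_prop) _ _)]
    refine intervalIntegral.integral_mono_on (by linarith) ((Pmat_pow_cont l).norm.intervalIntegrable _ _)
      (((gdiff_cont l).add (by fun_prop)).intervalIntegrable _ _) fun t _ => ?_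
    unfold gdiff
    have e : -(s * l) * t ^ 2 = -(s * t ^ 2 * l) := by ring
    rw [e]
    have a1 : ‖((Real.exp (-(s * t ^ 2 * l)) : ℝ) : ℂ) • Pinf ν‖ ≤ Real.exp (-(s * t ^ 2 * l)) := by
      rw [norm_smul, Complex.norm_real, Real.norm_of_nonneg (Real.exp_pos _).le]
      exact mul_le_of_le_one_right (Real.exp_pos _).le (Pinf_norm hS)
    have a5 := norm_sub_norm_le (Pmat P f t ^ l) (((Real.exp (-(s * t ^ 2 * l)) : ℝ) : ℂ) • Pinf ν)
    linarith
  have b3 := gauss_le (a := s * l) (by positivity) hT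
  rw [← div_div, Real.sqrt_div' _ hl0.le] at b3
  have b4 : ∫ t in (-T)..T, gdiff P ν f l t ≤ 1 / Real.sqrt l := by
    rw [le_div_iff₀ hsl, mul_comm]; exact b1.le
  rw [add_div]; linarith

lemma DT_bound (hS : IsStochastic P ν) (h1 : Primitive P) (h2 : ∑ x, f x * ν x = 0)
    (h3 : NonLattice P f) {T : ℝ} (hT : 0 < T) {η : ℝ} (hη : 0 < η) :
    ∃ (ε : ℝ) (l0 : ℕ), 0 < ε ∧ 1 ≤ l0 ∧ ∀ l ≥ l0, ∀ k : ℕ, (k : ℝ) ≤ ε * l →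
      DT P f T l (l + k) ≤ η / Real.sqrt l := by
  have hσ := sigma2_pos hS h1 h2 h3
  set s := sigma2 P ν f / 2 with hs
  have hs0 : 0 < s := by positivity
  obtain ⟨N, hN⟩ := eventually_atTop.1 ((gdiff_int hS h1 h2 h3 hT).eventually (gt_mem_nhds (by positivity : (0:ℝ) < η / 3)))
  refine ⟨η / (3 * Real.sqrt (π / s)), max N 1, by positivity, le_max_right _ _, fun l hl k hk => ?_⟩
  have hl1 : N ≤ l := (le_max_left _ _).trans hl
  have hl2 : 1 ≤ l := (le_max_right _ _).trans hl
  have hl0 : (0:ℝ) < l := by exact_mod_cast hl2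
  have hlk0 : (0:ℝ) < ((l + k : ℕ) : ℝ) := by exact_mod_cast (by omega : 0 < l + k)
  have hsl : 0 < Real.sqrt l := Real.sqrt_pos.2 hl0
  have hslk : 0 < Real.sqrt ((l + k : ℕ) : ℝ) := Real.sqrt_pos.2 hlk0
  have hle : Real.sqrt l ≤ Real.sqrt ((l + k : ℕ) : ℝ) := Real.sqrt_le_sqrt (by push_cast; linarith [(Nat.cast_nonneg k : (0:ℝ) ≤ k)])
  have b1 := hN l hl1
  have b1' := hN (l + k) (by omega)
  have b2 : DT P f T l (l + k) ≤ (∫ t in (-T)..T, gdiff P ν f l t) + (∫ t in (-T)..T, gdiff P ν f (l + k) t)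
      + ∫ t in (-T)..T, (Real.exp (-(s * l) * t ^ 2) - Real.exp (-(s * (l + k : ℕ)) * t ^ 2)) := by
    unfold DT
    have hc1 : Continuous (fun t => gdiff P ν f l t + gdiff P ν f (l + k) t) := (gdiff_cont l).add (gdiff_cont _)
    have hc2 : Continuous (fun t : ℝ => Real.exp (-(s * l) * t ^ 2) - Real.exp (-(s * (l + k : ℕ)) * t ^ 2)) := by fun_prop
    rw [← intervalIntegral.integral_add ((gdiff_cont l).intervalIntegrable _ _)
      ((gdiff_cont _).intervalIntegrable _ _), ← intervalIntegral.integral_add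
      (hc1.intervalIntegrable _ _) (hc2.intervalIntegrable _ _)]
    refine intervalIntegral.integral_mono_on (by linarith) ((Pdiff_cont _ _).intervalIntegrable _ _)
      ((hc1.add hc2).intervalIntegrable _ _) fun t _ => ?_
    unfold gdiff
    have e : -(s * l) * t ^ 2 = -(s * t ^ 2 * l) := by ring
    have e' : -(s * (l + k : ℕ)) * t ^ 2 = -(s * t ^ 2 * (l + k : ℕ)) := by ring
    rw [e, e']
    set α := Real.exp (-(s * t ^ 2 * l)) with hα
    set β := Real.exp (-(s * t ^ 2 * (l + k : ℕ))) with hβ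
    have hαβ : β ≤ α := by
      rw [hα, hβ, Real.exp_le_exp, neg_le_neg_iff]
      gcongr; omega
    have a1 : ‖((α - β : ℝ) : ℂ) • Pinf ν‖ ≤ α - β := by
      rw [norm_smul, Complex.norm_real, Real.norm_of_nonneg (by linarith)]
      exact mul_le_of_le_one_right (by linarith) (Pinf_norm hS)
    have e6 : Pmat P f t ^ (l + k) - Pmat P f t ^ l = (Pmat P f t ^ (l + k) - (β : ℂ) • Pinf ν)
      - (Pmat P f t ^ l - (α : ℂ) • Pinf ν) - ((α - β : ℝ) : ℂ) • Pinf ν := by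
      push_cast; rw [sub_smul]; abel
    rw [e6]
    have := norm_sub_le ((Pmat P f t ^ (l + k) - (β : ℂ) • Pinf ν)
      - (Pmat P f t ^ l - (α : ℂ) • Pinf ν)) (((α - β : ℝ) : ℂ) • Pinf ν)
    have h' := norm_sub_le (Pmat P f t ^ (l + k) - (β : ℂ) • Pinf ν) (Pmat P f t ^ l - (α : ℂ) • Pinf ν)
    linarith
  have b3 := gauss_sub_le (a := s * l) (b := s * (l + k : ℕ)) (by positivity) (by gcongr; omega) hT
  rw [← div_div, Real.sqrt_div' _ hl0.le, ← div_div, Real.sqrt_div' _ hlk0.le] at b3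
  have b4 : ∫ t in (-T)..T, gdiff P ν f l t ≤ (η / 3) / Real.sqrt l := by
    rw [le_div_iff₀ hsl, mul_comm]; exact b1.le
  have b5 : ∫ t in (-T)..T, gdiff P ν f (l + k) t ≤ (η / 3) / Real.sqrt l := by
    refine le_trans ?_ (div_le_div_of_nonneg_left (by positivity) hsl hle)
    rw [le_div_iff₀ hslk, mul_comm]; exact b1'.le
  have b6 : Real.sqrt (π / s) / Real.sqrt l - Real.sqrt (π / s) / Real.sqrt ((l + k : ℕ) : ℝ) ≤ (η / 3) / Real.sqrt l := by
    have hps : 0 < Real.sqrt (π / s) := by positivity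
    have hk' : (k : ℝ) / l ≤ η / (3 * Real.sqrt (π / s)) := by rwa [div_le_iff₀ hl0]
    have c1 : 1 - Real.sqrt l / Real.sqrt ((l + k : ℕ) : ℝ) ≤ k / l := by
      have d1 : (l : ℝ) / ((l + k : ℕ) : ℝ) ≤ Real.sqrt l / Real.sqrt ((l + k : ℕ) : ℝ) := by
        rw [div_le_div_iff₀ hlk0 hslk]
        have e1 := Real.mul_self_sqrt hl0.le
        have e2 := Real.mul_self_sqrt hlk0.le
        calc (l : ℝ) * Real.sqrt ((l + k : ℕ) : ℝ) = Real.sqrt l * (Real.sqrt l * Real.sqrt ((l + k : ℕ) : ℝ)) := by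
              rw [← mul_assoc, e1]
          _ ≤ Real.sqrt l * (Real.sqrt ((l + k : ℕ) : ℝ) * Real.sqrt ((l + k : ℕ) : ℝ)) := by gcongr
          _ = _ := by rw [e2]
      have d2 : 1 - (l : ℝ) / ((l + k : ℕ) : ℝ) ≤ k / l := by
        rw [sub_le_iff_le_add, ← sub_le_iff_le_add', le_div_iff₀ hlk0]
        push_cast
        have : (1 - (k:ℝ) / l) * (l + k) = l - k ^ 2 / l := by field_simp; ring
        rw [this]
        have : (0:ℝ) ≤ (k:ℝ) ^ 2 / l := by positivity
        linarith
      linarith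
    calc _ = Real.sqrt (π / s) / Real.sqrt l * (1 - Real.sqrt l / Real.sqrt ((l + k : ℕ) : ℝ)) := by
          field_simp
      _ ≤ Real.sqrt (π / s) / Real.sqrt l * (η / (3 * Real.sqrt (π / s))) := by gcongr; linarith
      _ = _ := by field_simp
  have e7 : η / Real.sqrt l = (η / 3) / Real.sqrt l + (η / 3) / Real.sqrt l + (η / 3) / Real.sqrt l := by ring
  rw [e7]; linarith
end

/-! ### Part 7 -/


/-! ### S7: the Fejer kernel -/
section

/-- Fejer kernel with spectrum in `[-T, T]` -/
noncomputable def kap (T u : ℝ) : ℝ := ∫ t in (-T)..T, (1 - |t| / T) * Real.cos (t * u)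

lemma kap_cont (T : ℝ) : Continuous (kap T) := by
  unfold kap
  refine intervalIntegral.continuous_parametric_intervalIntegral_of_continuous' ?_ _ _
  simp only [Function.uncurry_def]
  fun_prop

lemma kap_scale {T : ℝ} (hT : 0 < T) (u : ℝ) : kap T u = T * kap 1 (T * u) := by
  have h := intervalIntegral.integral_comp_div (a := -T) (b := T) (c := T)
    (fun s => (1 - |s| / 1) * Real.cos (s * (T * u))) hT.ne'
  rw [neg_div, div_self hT.ne', smul_eq_mul] at h
  unfold kap
  rw [← h]
  refine intervalIntegral.integral_congr fun t _ => ?_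
  rw [abs_div, abs_of_pos hT, div_one]
  congr 2
  field_simp

lemma kap_one {u : ℝ} (hu : u ≠ 0) : kap 1 u = 2 * (1 - Real.cos u) / u ^ 2 := by
  have hc : Continuous (fun t : ℝ => (1 - |t| / 1) * Real.cos (t * u)) := by fun_prop
  have h1 : ∫ t in (0:ℝ)..1, (1 - |t| / 1) * Real.cos (t * u) = (1 - Real.cos u) / u ^ 2 := by
    have : ∫ t in (0:ℝ)..1, (1 - |t| / 1) * Real.cos (t * u) = ∫ t in (0:ℝ)..1, (1 - t) * Real.cos (t * u) := by
      refine intervalIntegral.integral_congr fun t ht => ?_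
      rw [Set.uIcc_of_le zero_le_one] at ht
      simp only [abs_of_nonneg ht.1, div_one]
    rw [this, intervalIntegral.integral_eq_sub_of_hasDerivAt
      (f := fun t => (1 - t) * Real.sin (t * u) / u - Real.cos (t * u) / u ^ 2)]
    · simp; field_simp; ring
    · intro t _
      have h1 : HasDerivAt (fun t : ℝ => t * u) u t := by simpa using (hasDerivAt_id t).mul_const u
      have h2 : HasDerivAt (fun t : ℝ => 1 - t) (-1) t := by simpa using (hasDerivAt_id t).const_sub 1
      have h3 : HasDerivAt (fun t : ℝ => (1 - t) * Real.sin (t * u) / u - Real.cos (t * u) / u ^ 2)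
        (((-1) * Real.sin (t * u) + (1 - t) * (Real.cos (t * u) * u)) / u - (-Real.sin (t * u) * u) / u ^ 2) t :=
        ((h2.mul h1.sin).div_const u).sub (h1.cos.div_const (u ^ 2))
      refine h3.congr_deriv ?_
      field_simp; ring
    · exact (Continuous.intervalIntegrable (by fun_prop) _ _)
  have h2 : ∫ t in (-1:ℝ)..0, (1 - |t| / 1) * Real.cos (t * u) = (1 - Real.cos u) / u ^ 2 := by
    rw [← h1]
    have := intervalIntegral.integral_comp_neg (a := 0) (b := 1) (fun t : ℝ => (1 - |t| / 1) * Real.cos (t * u))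
    rw [neg_zero] at this
    rw [← this]
    refine intervalIntegral.integral_congr fun t _ => ?_
    simp
  unfold kap
  rw [← intervalIntegral.integral_add_adjacent_intervals (b := 0) (hc.intervalIntegrable _ _) (hc.intervalIntegrable _ _), h1, h2]
  ring

lemma kap_one_zero : kap 1 0 = 1 := by
  have hlim : Tendsto (kap 1) (𝓝[≠] 0) (𝓝 (kap 1 0)) := (kap_cont 1).continuousAt.tendsto.mono_left nhdsWithin_le_nhds
  unfold kap
  simp only [mul_zero, Real.cos_zero, mul_one, div_one]
  have hc : Continuous (fun t : ℝ => (1 - |t|)) := by fun_prop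
  rw [← intervalIntegral.integral_add_adjacent_intervals (b := 0) (hc.intervalIntegrable _ _) (hc.intervalIntegrable _ _)]
  have h1 : ∫ t in (0:ℝ)..1, (1 - |t|) = ∫ t in (0:ℝ)..1, (1 - t) := by
    refine intervalIntegral.integral_congr fun t ht => ?_
    rw [Set.uIcc_of_le zero_le_one] at ht
    simp only [abs_of_nonneg ht.1]
  have h2 : ∫ t in (-1:ℝ)..0, (1 - |t|) = ∫ t in (-1:ℝ)..0, (1 + t) := by
    refine intervalIntegral.integral_congr fun t ht => ?_
    rw [Set.uIcc_of_le (by norm_num)] at ht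
    simp only [abs_of_nonpos ht.2]; ring
  rw [h1, h2, intervalIntegral.integral_sub (by simp) (by simp), intervalIntegral.integral_add (by simp) (by simp)]
  simp; norm_num

lemma kap_one_nonneg (u : ℝ) : 0 ≤ kap 1 u := by
  by_cases hu : u = 0
  · rw [hu, kap_one_zero]; norm_num
  · rw [kap_one hu]
    have := Real.cos_le_one u
    have : 0 ≤ 1 - Real.cos u := by linarith
    positivity

lemma kap_one_le (u : ℝ) : kap 1 u ≤ 6 * (1 + u ^ 2)⁻¹ := by
  rw [← div_eq_mul_inv, le_div_iff₀ (by positivity)]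
  have h1 : kap 1 u ≤ 2 := by
    have := intervalIntegral.norm_integral_le_of_norm_le_const (a := -1) (b := 1) (C := 1)
      (f := fun t : ℝ => (1 - |t| / 1) * Real.cos (t * u)) (fun t ht => by
        rw [Set.uIoc_of_le (by norm_num)] at ht
        rw [norm_mul]
        refine mul_le_one₀ ?_ (norm_nonneg _) (Real.abs_cos_le_one _)
        have : |t| ≤ 1 := abs_le.2 ⟨ht.1.le, ht.2⟩
        rw [div_one, Real.norm_eq_abs, abs_le]
        constructor <;> linarith [abs_nonneg t])
    have h := le_of_abs_le this
    unfold kap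
    refine h.trans ?_
    norm_num
  have h2 : kap 1 u * u ^ 2 ≤ 4 := by
    by_cases hu : u = 0
    · rw [hu]; norm_num
    · rw [kap_one hu, div_mul_cancel₀ _ (by positivity)]
      linarith [Real.neg_one_le_cos u]
  linarith

lemma kap_one_int : Integrable (kap 1) := by
  refine (integrable_inv_one_add_sq.const_mul 6).mono' (kap_cont 1).aestronglyMeasurable (Eventually.of_forall fun u => ?_)
  rw [Real.norm_of_nonneg (kap_one_nonneg u)]
  exact kap_one_le u

/-- total mass of the Fejer kernel -/
noncomputable def ck : ℝ := ∫ u, kap 1 u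

lemma ck_pos : 0 < ck := by
  unfold ck
  rw [integral_pos_iff_support_of_nonneg kap_one_nonneg kap_one_int]
  refine IsOpen.measure_pos volume ((kap_cont 1).isOpen_support) ⟨0, ?_⟩
  rw [Function.mem_support, kap_one_zero]; norm_num

/-- normalised Fejer kernel -/
noncomputable def KT (T u : ℝ) : ℝ := kap T u / ck

lemma KT_cont (T : ℝ) : Continuous (KT T) := (kap_cont T).div_const _

lemma KT_nonneg {T : ℝ} (hT : 0 < T) (u : ℝ) : 0 ≤ KT T u := by
  unfold KT
  rw [kap_scale hT]
  have := kap_one_nonneg (T * u)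
  have := ck_pos
  positivity

lemma KT_int {T : ℝ} (hT : 0 < T) : Integrable (KT T) := by
  have h : KT T = fun u => T * kap 1 (T * u) / ck := by funext u; unfold KT; rw [kap_scale hT]
  rw [h]
  exact ((kap_one_int.comp_mul_left' hT.ne').const_mul T).div_const _

lemma KT_mass {T : ℝ} (hT : 0 < T) : ∫ u, KT T u = 1 := by
  have h : KT T = fun u => T * kap 1 (T * u) / ck := by funext u; unfold KT; rw [kap_scale hT]
  rw [h, integral_div, integral_const_mul, Measure.integral_comp_mul_left (kap 1) T, smul_eq_mul,
    abs_of_pos (by positivity), ← mul_assoc, mul_inv_cancel₀ hT.ne', one_mul]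
  exact div_self ck_pos.ne'

lemma KT_conc {δ : ℝ} (hδ : 0 < δ) : ∃ T : ℝ, 0 < T ∧ 1 - δ ≤ ∫ u in (-δ)..δ, KT T u := by
  have h1 : Tendsto (fun T : ℝ => ∫ u in (-(T * δ))..(T * δ), kap 1 u) atTop (𝓝 ck) := by
    refine intervalIntegral_tendsto_integral kap_one_int ?_ ?_
    · exact tendsto_neg_atTop_atBot.comp (tendsto_id.atTop_mul_const hδ)
    · exact tendsto_id.atTop_mul_const hδ
  have hlt : (1 - δ) * ck < ck := by nlinarith [ck_pos]
  obtain ⟨T, hT1, hT2⟩ := ((h1.eventually (lt_mem_nhds hlt)).and (eventually_gt_atTop 0)).exists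
  refine ⟨T, hT2, ?_⟩
  have h : ∀ u, KT T u = T * kap 1 (T * u) / ck := fun u => by unfold KT; rw [kap_scale hT2]
  simp only [h]
  rw [intervalIntegral.integral_div, intervalIntegral.integral_const_mul,
    intervalIntegral.integral_comp_mul_left (kap 1) hT2.ne', smul_eq_mul, ← mul_assoc, mul_inv_cancel₀ hT2.ne', one_mul,
    le_div_iff₀ ck_pos, mul_neg]
  exact hT1.le
end

/-! ### Part 8 -/


/-! ### S8: smoothing -/
section
variable [Fintype X] [DecidableEq X] [Nonempty X] {P : X → X → ℝ} {ν f : X → ℝ}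
attribute [local instance] Matrix.linftyOpNormedRing Matrix.linftyOpNormedAlgebra

/-- convolution in the real variable -/
noncomputable def Cv (k : ℝ → ℝ) (h : X → ℝ → ℝ) : X → ℝ → ℝ := fun x y => ∫ v, h x v * k (y - v)

lemma Uo_int {h : X → ℝ → ℝ} (hh : ∀ x, Integrable (h x)) (x : X) : Integrable (Uo P f h x) := by
  have : Uo P f h x = fun y => ∑ b, P x b * h b (y + f b) := by funext y; rw [Uo_apply]
  rw [this]
  exact integrable_finsetSum _ fun b _ => ((hh b).comp_add_right (f b)).const_mul _

lemma Cv_integrable {k : ℝ → ℝ} {B : ℝ} (hk : Measurable k) (hkB : ∀ u, |k u| ≤ B) {g : ℝ → ℝ}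
    (hg : Integrable g) (y : ℝ) : Integrable (fun v => g v * k (y - v)) := by
  refine hg.mul_bdd (c := B) (hk.comp (measurable_const.sub measurable_id)).aestronglyMeasurable
    (Eventually.of_forall fun v => hkB _)

lemma Cv_Uo {k : ℝ → ℝ} {B : ℝ} (hk : Measurable k) (hkB : ∀ u, |k u| ≤ B) {h : X → ℝ → ℝ}
    (hh : ∀ x, Integrable (h x)) : Cv k (Uo P f h) = Uo P f (Cv k h) := by
  funext x y
  rw [Uo_apply]
  unfold Cv
  simp only [Uo_apply, Finset.sum_mul]
  rw [integral_finsetSum]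
  · refine Finset.sum_congr rfl fun b _ => ?_
    rw [← integral_const_mul, ← integral_add_right_eq_self (fun v => P x b * (h b v * k (y + f b - v))) (f b)]
    refine integral_congr_ae (Eventually.of_forall fun v => ?_)
    simp only
    rw [show y + f b - (v + f b) = y - v by ring]; ring
  · intro b _
    have := (Cv_integrable hk hkB ((hh b).comp_add_right (f b)) y).const_mul (P x b)
    refine this.congr (Eventually.of_forall fun v => ?_)
    simp only; ring

lemma Uo_pow_int {h : X → ℝ → ℝ} (hh : ∀ x, Integrable (h x)) (l : ℕ) : ∀ x, Integrable ((Uo P f ^ l) h x) := by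
  induction l with
  | zero => simpa using hh
  | succ l ih => rw [pow_succ']; exact Uo_int ih

lemma Cv_Uo_pow {k : ℝ → ℝ} {B : ℝ} (hk : Measurable k) (hkB : ∀ u, |k u| ≤ B) {h : X → ℝ → ℝ}
    (hh : ∀ x, Integrable (h x)) (l : ℕ) : Cv k ((Uo P f ^ l) h) = (Uo P f ^ l) (Cv k h) := by
  induction l with
  | zero => simp
  | succ l ih =>
    rw [pow_succ', Module.End.mul_apply, Module.End.mul_apply, Cv_Uo hk hkB (Uo_pow_int hh l), ih]

lemma Cv_le {k : ℝ → ℝ} {B : ℝ} (hk : Measurable k) (hk0 : ∀ u, 0 ≤ k u) (hkB : ∀ u, |k u| ≤ B)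
    (hki : Integrable k) {h : X → ℝ → ℝ} (hh : ∀ x, Integrable (h x)) {A : ℝ} (hA : ∀ x y, h x y ≤ A)
    (x : X) (y : ℝ) : Cv k h x y ≤ A * ∫ u, k u := by
  unfold Cv
  rw [← integral_sub_left_eq_self k volume y, ← integral_const_mul]
  refine integral_mono (Cv_integrable hk hkB (hh x) y) ((hki.comp_sub_left y).const_mul A) fun v => ?_
  exact mul_le_mul_of_nonneg_right (hA _ _) (hk0 _)

/-- Fourier-smoothed transition function -/
noncomputable def pM (T : ℝ) (M : ℝ → Matrix X X ℂ) (x x' : X) (u : ℝ) : ℝ :=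
  (∫ t in (-T)..T, (1 - |t| / T) * (Complex.exp (Complex.I * (t : ℂ) * (u : ℂ)) * M t x x').re) / ck

lemma pM_integrand_cont (T : ℝ) {M : ℝ → Matrix X X ℂ} (hM : Continuous M) (x x' : X) :
    Continuous (Function.uncurry fun (u t : ℝ) =>
      (1 - |t| / T) * (Complex.exp (Complex.I * (t : ℂ) * (u : ℂ)) * M t x x').re) := by
  have h1 : Continuous (fun t => M t x x') := (continuous_apply x').comp ((continuous_apply x).comp hM)
  have h2 : Continuous (fun q : ℝ × ℝ => M q.2 x x') := h1.comp continuous_snd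
  have h3 : Continuous (fun q : ℝ × ℝ => Complex.exp (Complex.I * (q.2 : ℂ) * (q.1 : ℂ))) := by fun_prop
  have h4 : Continuous (fun q : ℝ × ℝ => (1 - |q.2| / T)) := by fun_prop
  exact h4.mul (Complex.continuous_re.comp (h3.mul h2))

lemma pM_cont (T : ℝ) {M : ℝ → Matrix X X ℂ} (hM : Continuous M) (x x' : X) :
    Continuous (pM T M x x') := by
  refine Continuous.div_const ?_ _
  exact intervalIntegral.continuous_parametric_intervalIntegral_of_continuous' (pM_integrand_cont T hM x x') _ _

lemma pM_int1 (T : ℝ) {M : ℝ → Matrix X X ℂ} (hM : Continuous M) (x x' : X) (u a b : ℝ) :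
    IntervalIntegrable (fun t => (1 - |t| / T) * (Complex.exp (Complex.I * (t : ℂ) * (u : ℂ)) * M t x x').re) volume a b := by
  have h := (pM_integrand_cont T hM x x').comp (Continuous.prodMk_right u)
  exact h.intervalIntegrable _ _

lemma pM_bound {T : ℝ} (hT : 0 < T) {M : ℝ → Matrix X X ℂ} (hM : Continuous M) (x x' : X) (u : ℝ) :
    |pM T M x x' u| ≤ (∫ t in (-T)..T, ‖M t‖) / ck := by
  unfold pM
  rw [abs_div, abs_of_pos ck_pos]
  refine div_le_div_of_nonneg_right ?_ ck_pos.le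
  have hM' : Continuous (fun t => ‖M t‖) := hM.norm
  have hMi : IntervalIntegrable (fun t => ‖M t‖) volume (-T) T := hM'.intervalIntegrable _ _
  rw [← Real.norm_eq_abs]
  refine intervalIntegral.norm_integral_le_of_norm_le (by linarith) ?_ hMi
  refine Eventually.of_forall fun t ht => ?_
  rw [Real.norm_eq_abs, abs_mul]
  have h0 : |t| ≤ T := abs_le.2 ⟨ht.1.le, ht.2⟩
  have h1 : |1 - |t| / T| ≤ 1 := by
    have : |t| / T ≤ 1 := (div_le_one hT).2 h0
    have h2 : 0 ≤ |t| / T := by positivity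
    rw [abs_le]; constructor <;> linarith
  have h2 : |(Complex.exp (Complex.I * (t : ℂ) * (u : ℂ)) * M t x x').re| ≤ ‖M t‖ := by
    refine (Complex.abs_re_le_norm _).trans ?_
    rw [norm_mul, norm_phase, one_mul]
    exact entry_le_matnorm _ _ _
  calc _ ≤ 1 * ‖M t‖ := mul_le_mul h1 h2 (abs_nonneg _) zero_le_one
    _ = _ := one_mul _

lemma pM_zero (T : ℝ) (x x' : X) (u : ℝ) :
    pM T (fun t => Pmat P f t ^ 0) x x' u = if x = x' then KT T u else 0 := by
  unfold pM KT kap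
  by_cases h : x = x'
  · rw [if_pos h]
    congr 1
    refine intervalIntegral.integral_congr fun t _ => ?_
    have : Complex.I * (t : ℂ) * (u : ℂ) = ((t * u : ℝ) : ℂ) * Complex.I := by push_cast; ring
    simp only [pow_zero, h, Matrix.one_apply_eq, mul_one]
    rw [this, Complex.exp_ofReal_mul_I_re]
  · rw [if_neg h]
    simp [Matrix.one_apply_ne h]

lemma pM_succ (T : ℝ) (l : ℕ) (x x' : X) (u : ℝ) :
    pM T (fun t => Pmat P f t ^ (l + 1)) x x' u =
      ∑ b, P x b * pM T (fun t => Pmat P f t ^ l) b x' (u + f b) := by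
  unfold pM
  simp only [← mul_div_assoc]
  rw [← Finset.sum_div]
  congr 1
  simp only [← intervalIntegral.integral_const_mul]
  rw [← intervalIntegral.integral_finsetSum fun b _ =>
    (pM_int1 T (Pmat_pow_cont (P := P) (f := f) l) b x' (u + f b) _ _).const_mul _]
  refine intervalIntegral.integral_congr fun t _ => ?_
  rw [pow_succ', Matrix.mul_apply, Finset.mul_sum, Complex.re_sum, Finset.mul_sum]
  refine Finset.sum_congr rfl fun b _ => ?_
  rw [Pmat_apply]
  have : Complex.exp (Complex.I * (t : ℂ) * (u : ℂ)) * ((P x b : ℂ) * Complex.exp (Complex.I * (t : ℂ) * (f b : ℂ)) *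
      (Pmat P f t ^ l) b x') = (P x b : ℂ) * (Complex.exp (Complex.I * (t : ℂ) * ((u + f b : ℝ) : ℂ)) * (Pmat P f t ^ l) b x') := by
    push_cast
    rw [mul_add, Complex.exp_add]; ring
  rw [this, Complex.re_ofReal_mul]
  ring

lemma smooth_rep {T : ℝ} (hT : 0 < T) {g : X → ℝ → ℝ} (hg : ∀ x, Integrable (g x)) (l : ℕ) (x : X) (y : ℝ) :
    (Uo P f ^ l) (Cv (KT T) g) x y =
      ∑ x', ∫ v, g x' v * pM T (fun t => Pmat P f t ^ l) x x' (y - v) := by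
  induction l generalizing x y with
  | zero =>
    simp only [pM_zero]
    rw [Finset.sum_eq_single x]
    · simp [Cv]
    · intro b _ hb
      simp [Ne.symm hb]
    · simp
  | succ l ih =>
    rw [pow_succ', Module.End.mul_apply, Uo_apply]
    simp only [ih, pM_succ]
    simp only [Finset.mul_sum]
    rw [Finset.sum_comm]
    refine Finset.sum_congr rfl fun x' _ => ?_
    rw [integral_finsetSum]
    · refine Finset.sum_congr rfl fun b _ => ?_
      rw [← integral_const_mul]
      refine integral_congr_ae (Eventually.of_forall fun v => ?_)
      simp only
      rw [show y + f b - v = y - v + f b by ring]; ring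
    · intro b _
      have hc := pM_cont T (Pmat_pow_cont (P := P) (f := f) l) b x'
      have := (Cv_integrable (k := fun w => pM T (fun t => Pmat P f t ^ l) b x' (w + f b))
        (hc.comp (continuous_add_const _)).measurable
        (fun w => pM_bound hT (Pmat_pow_cont (P := P) (f := f) l) b x' (w + f b)) (hg x') y).const_mul (P x b)
      refine this.congr (Eventually.of_forall fun v => ?_)
      simp only; ring

/-- total L1 norm -/
noncomputable def L1 (g : X → ℝ → ℝ) : ℝ := ∑ x, ∫ v, |g x v|

lemma abs_int_mul_le {g k : ℝ → ℝ} {B : ℝ} (hg : Integrable g) (hk : ∀ v, |k v| ≤ B) :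
    |∫ v, g v * k v| ≤ (∫ v, |g v|) * B := by
  rw [← integral_mul_const, ← Real.norm_eq_abs]
  refine norm_integral_le_of_norm_le (hg.abs.mul_const B) (Eventually.of_forall fun v => ?_)
  rw [Real.norm_eq_abs, abs_mul]
  exact mul_le_mul_of_nonneg_left (hk v) (abs_nonneg _)

lemma smooth_bound {T : ℝ} (hT : 0 < T) {g : X → ℝ → ℝ} (hg : ∀ x, Integrable (g x)) (l : ℕ) (x : X) (y : ℝ) :
    |(Uo P f ^ l) (Cv (KT T) g) x y| ≤ IT P f T l / ck * L1 g := by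
  rw [smooth_rep hT hg, mul_comm]
  unfold L1
  rw [Finset.sum_mul]
  refine (Finset.abs_sum_le_sum_abs _ _).trans (Finset.sum_le_sum fun x' _ => ?_)
  exact abs_int_mul_le (hg x') fun v => pM_bound hT (Pmat_pow_cont (P := P) (f := f) l) x x' _

lemma pM_sub (T : ℝ) (l l' : ℕ) (x x' : X) (u : ℝ) :
    pM T (fun t => Pmat P f t ^ l' - Pmat P f t ^ l) x x' u =
    pM T (fun t => Pmat P f t ^ l') x x' u - pM T (fun t => Pmat P f t ^ l) x x' u := by
  unfold pM
  rw [← sub_div, ← intervalIntegral.integral_sub (pM_int1 T (Pmat_pow_cont (P := P) (f := f) l') x x' u _ _)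
    (pM_int1 T (Pmat_pow_cont (P := P) (f := f) l) x x' u _ _)]
  congr 1
  refine intervalIntegral.integral_congr fun t _ => ?_
  simp only [Matrix.sub_apply, mul_sub, Complex.sub_re]

lemma smooth_diff {T : ℝ} (hT : 0 < T) {g : X → ℝ → ℝ} (hg : ∀ x, Integrable (g x)) (l l' : ℕ) (x : X) (y : ℝ) :
    |(Uo P f ^ l') (Cv (KT T) g) x y - (Uo P f ^ l) (Cv (KT T) g) x y| ≤ DT P f T l l' / ck * L1 g := by
  rw [smooth_rep hT hg, smooth_rep hT hg, mul_comm, ← Finset.sum_sub_distrib]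
  unfold L1
  rw [Finset.sum_mul]
  refine (Finset.abs_sum_le_sum_abs _ _).trans (Finset.sum_le_sum fun x' _ => ?_)
  have hi : ∀ n : ℕ, Integrable (fun v => g x' v * pM T (fun t => Pmat P f t ^ n) x x' (y - v)) := fun n =>
    Cv_integrable (pM_cont T (Pmat_pow_cont (P := P) (f := f) n) x x').measurable
      (pM_bound hT (Pmat_pow_cont (P := P) (f := f) n) x x') (hg x') y
  rw [← integral_sub (hi l') (hi l)]
  have : ∀ v, g x' v * pM T (fun t => Pmat P f t ^ l') x x' (y - v) - g x' v * pM T (fun t => Pmat P f t ^ l) x x' (y - v)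
    = g x' v * pM T (fun t => Pmat P f t ^ l' - Pmat P f t ^ l) x x' (y - v) := fun v => by rw [pM_sub]; ring
  simp only [this]
  have hc : Continuous (fun t : ℝ => Pmat P f t ^ l' - Pmat P f t ^ l) := (Pmat_pow_cont l').sub (Pmat_pow_cont l)
  exact abs_int_mul_le (hg x') fun v => pM_bound hT hc x x' _

end

/-! ### Part 9 -/


/-! ### S9: duality and L1 norms -/
section
variable [Fintype X] [DecidableEq X] [Nonempty X] {P : X → X → ℝ} {ν f : X → ℝ}

/-- adjoint of `Uo` -/
noncomputable def Ua (P : X → X → ℝ) (ν f : X → ℝ) (g : X → ℝ → ℝ) : X → ℝ → ℝ :=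
  fun b w => ∑ x, dualK P ν b x * g x (w - f b)

/-- final-step functions -/
noncomputable def Fd (P : X → X → ℝ) (f : X → ℝ) (d : ℝ) (n : ℕ) : X → ℝ → ℝ :=
  (Ko P f ^ n) (Uo P f (fun _ z => ind (z ≤ d)))

lemma Fd_succ (d : ℝ) (n : ℕ) : Fd P f d (n + 1) = Ko P f (Fd P f d n) := by
  simp [Fd, pow_succ']

lemma exi_eq_Fd (n : ℕ) : exi P f n = Fd P f 0 n := by
  unfold exi Fd
  congr 1
  funext x y
  rw [Lo_apply, Uo_apply]
  simp

lemma ind_meas_le (d : ℝ) : Measurable (fun z : ℝ => ind (z ≤ d)) := by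
  unfold ind
  exact Measurable.ite measurableSet_Iic measurable_const measurable_const

lemma ind_meas_pos : Measurable (fun z : ℝ => ind (0 < z)) := by
  unfold ind
  exact Measurable.ite measurableSet_Ioi measurable_const measurable_const

lemma Uo_meas {h : X → ℝ → ℝ} (hh : ∀ x, Measurable (h x)) (x : X) : Measurable (Uo P f h x) := by
  have : Uo P f h x = fun y => ∑ b, P x b * h b (y + f b) := by funext y; rw [Uo_apply]
  rw [this]
  exact Finset.measurable_sum _ fun b _ => ((hh b).comp (measurable_id.add_const (f b))).const_mul _

lemma Ko_eq_Uo (h : X → ℝ → ℝ) : Ko P f h = Uo P f (fun b w => ind (0 < w) * h b w) := by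
  funext x y
  rw [Ko_apply, Uo_apply]

lemma Ko_meas {h : X → ℝ → ℝ} (hh : ∀ x, Measurable (h x)) (x : X) : Measurable (Ko P f h x) := by
  rw [Ko_eq_Uo]
  exact Uo_meas (fun b => ind_meas_pos.mul (hh b)) x

lemma Fd_meas (d : ℝ) (n : ℕ) : ∀ x, Measurable (Fd P f d n x) := by
  induction n with
  | zero => intro x; exact Uo_meas (fun _ => ind_meas_le d) x
  | succ n ih => intro x; rw [Fd_succ]; exact Ko_meas ih x

lemma Fd_mono (hS : IsStochastic P ν) {d d' : ℝ} (hd : d ≤ d') (n : ℕ) (x : X) (y : ℝ) :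
    Fd P f d n x y ≤ Fd P f d' n x y :=
  ((posK hS).pow n) _ _ (fun x y => posU hS _ _ (fun _ z => ind_mono fun h => h.trans hd) x y) x y

lemma Fd_nonneg (hS : IsStochastic P ν) (d : ℝ) (n : ℕ) (x : X) (y : ℝ) : 0 ≤ Fd P f d n x y :=
  ((posK hS).pow n).nonneg (fun x y => (posU hS).nonneg (fun _ _ => ind_nonneg _) x y) x y

lemma Fd_le_one (hS : IsStochastic P ν) (d : ℝ) (n : ℕ) (x : X) (y : ℝ) : Fd P f d n x y ≤ 1 := by
  have h := ((posK (f := f) hS).pow n) (Uo P f (fun _ z => ind (z ≤ d))) 1 (fun x y => by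
    have := posU (f := f) hS (fun _ z => ind (z ≤ d)) 1 (fun _ z => ind_le_one _) x y
    rwa [Uo_one hS] at this) x y
  exact h.trans (surv_le_one hS n x y)

lemma bdd_supp_int {g : ℝ → ℝ} {a b : ℝ} (hg : Measurable g) (h0 : ∀ w, |g w| ≤ ind (a < w ∧ w ≤ b)) : Integrable g := by
  have hi : Integrable (fun w : ℝ => ind (a < w ∧ w ≤ b)) := by
    have : (fun w : ℝ => ind (a < w ∧ w ≤ b)) = Set.indicator (Set.Ioc a b) (fun _ => (1:ℝ)) := by
      funext w
      by_cases hw : a < w ∧ w ≤ b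
      · rw [ind_true hw, Set.indicator_of_mem (by exact hw)]
      · rw [ind_false hw, Set.indicator_of_notMem (by exact hw)]
    rw [this]
    exact (integrable_indicator_iff measurableSet_Ioc).2 (integrableOn_const (by simp))
  exact hi.mono' hg.aestronglyMeasurable (Eventually.of_forall h0)

lemma int_ind_Ioc {a b : ℝ} (hab : a ≤ b) : ∫ w : ℝ, ind (a < w ∧ w ≤ b) = b - a := by
  have : (fun w : ℝ => ind (a < w ∧ w ≤ b)) = Set.indicator (Set.Ioc a b) (fun _ => (1:ℝ)) := by
    funext w
    by_cases hw : a < w ∧ w ≤ b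
    · rw [ind_true hw, Set.indicator_of_mem (by exact hw)]
    · rw [ind_false hw, Set.indicator_of_notMem (by exact hw)]
  rw [this, integral_indicator measurableSet_Ioc]
  simp [hab]

lemma ind_Ioc_int (a b : ℝ) : Integrable (fun w : ℝ => ind (a < w ∧ w ≤ b)) := by
  refine bdd_supp_int (a := a) (b := b) ?_ fun w => le_of_eq (abs_of_nonneg (ind_nonneg _))
  have : (fun w : ℝ => ind (a < w ∧ w ≤ b)) = fun w => ind (0 < w - a) * ind (w ≤ b) := by
    funext w; rw [← ind_and]; congr 1; rw [sub_pos]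
  rw [this]
  exact (ind_meas_pos.comp (measurable_id.sub_const a)).mul (ind_meas_le b)

lemma phiU_int (hS : IsStochastic P ν) (d : ℝ) (x : X) :
    Integrable (fun w => ind (0 < w) * Uo P f (fun _ z => ind (z ≤ d)) x w) := by
  obtain ⟨M, hM, hfM⟩ := exists_bound f
  refine bdd_supp_int (a := 0) (b := d + M) (ind_meas_pos.mul (Uo_meas (fun _ => ind_meas_le d) x)) fun w => ?_
  have hU0 : 0 ≤ Uo P f (fun _ z => ind (z ≤ d)) x w := (posU hS).nonneg (fun _ _ => ind_nonneg _) x w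
  rw [abs_of_nonneg (mul_nonneg (ind_nonneg _) hU0)]
  by_cases hw : 0 < w ∧ w ≤ d + M
  · rw [ind_true hw]
    exact mul_le_one₀ (ind_le_one _) hU0 (Fd_le_one (n := 0) hS d x w)
  · rw [ind_false hw]
    by_cases hw0 : 0 < w
    · have h2 : d + M < w := by by_contra h; exact hw ⟨hw0, not_lt.1 h⟩
      rw [Uo_apply]
      refine le_of_eq ?_
      rw [Finset.sum_eq_zero, mul_zero]
      intro b _
      rw [ind_false, mul_zero]
      have := (abs_le.1 (hfM b)).1
      intro h; linarith
    · rw [ind_false hw0, zero_mul]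

lemma phi_int {g : ℝ → ℝ} (hg : Integrable g) : Integrable (fun w => ind (0 < w) * g w) :=
  hg.bdd_mul (c := 1) ind_meas_pos.aestronglyMeasurable (Eventually.of_forall fun w => by
    rw [Real.norm_of_nonneg (ind_nonneg _)]; exact ind_le_one _)

lemma Fd_int (hS : IsStochastic P ν) (d : ℝ) (n : ℕ) : ∀ x, Integrable (Fd P f d (n + 1) x) := by
  induction n with
  | zero => intro x; rw [Fd_succ, Ko_eq_Uo]; exact Uo_int (fun b => phiU_int hS d b) x
  | succ n ih => intro x; rw [Fd_succ, Ko_eq_Uo]; exact Uo_int (fun b => phi_int (ih b)) x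

lemma phiFd_int (hS : IsStochastic P ν) (d : ℝ) (n : ℕ) (x : X) :
    Integrable (fun w => ind (0 < w) * Fd P f d n x w) := by
  cases n with
  | zero => exact phiU_int hS d x
  | succ n => exact phi_int (Fd_int hS d n x)

lemma adj (hS : IsStochastic P ν) {g h : X → ℝ → ℝ} (H : ∀ x b, Integrable (fun w => g x (w - f b) * h b w)) :
    ∑ x, ν x * ∫ z, g x z * Uo P f h x z = ∑ b, ν b * ∫ w, Ua P ν f g b w * h b w := by
  have H' : ∀ x b, Integrable (fun z => g x z * h b (z + f b)) := fun x b => by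
    have := (H x b).comp_add_right (f b)
    refine this.congr (Eventually.of_forall fun z => ?_)
    simp only [add_sub_cancel_right]
  have e1 : ∀ x, ν x * ∫ z, g x z * Uo P f h x z = ∑ b, ν x * P x b * ∫ w, g x (w - f b) * h b w := by
    intro x
    simp only [Uo_apply, Finset.mul_sum]
    rw [integral_finsetSum, Finset.mul_sum]
    · refine Finset.sum_congr rfl fun b _ => ?_
      rw [mul_assoc]
      congr 1
      rw [← integral_add_right_eq_self (fun w => g x (w - f b) * h b w) (f b), ← integral_const_mul]
      refine integral_congr_ae (Eventually.of_forall fun z => ?_)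
      simp only [add_sub_cancel_right]; ring
    · intro b _
      refine ((H' x b).const_mul (P x b)).congr (Eventually.of_forall fun z => ?_)
      simp only; ring
  have e2 : ∀ b, ν b * ∫ w, Ua P ν f g b w * h b w = ∑ x, ν x * P x b * ∫ w, g x (w - f b) * h b w := by
    intro b
    simp only [Ua, Finset.sum_mul]
    rw [integral_finsetSum, Finset.mul_sum]
    · refine Finset.sum_congr rfl fun x _ => ?_
      rw [← nu_mul_dual hS b x, mul_assoc]
      congr 1
      rw [← integral_const_mul]
      refine integral_congr_ae (Eventually.of_forall fun z => ?_)
      simp only; ring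
    · intro x _
      refine ((H x b).const_mul (dualK P ν b x)).congr (Eventually.of_forall fun z => ?_)
      simp only; ring
  simp only [e1, e2]
  exact Finset.sum_comm

/-- dual weights -/
noncomputable def Gd (P : X → X → ℝ) (ν f : X → ℝ) : ℕ → X → ℝ → ℝ
  | 0 => fun _ _ => 1
  | n + 1 => fun b w => ind (0 < w) * Ua P ν f (Gd P ν f n) b w

lemma Ua_Gd (hS : IsStochastic P ν) (j : ℕ) (b : X) (w : ℝ) :
    Ua P ν f (Gd P ν f (j + 1)) b w =
      ind (0 < w - f b) * surv (dualK P ν) (fun b => -f b) j b (w - f b) := by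
  induction j generalizing b w with
  | zero =>
    simp only [Ua, Gd, surv_zero, mul_one, (dual_stoch hS).rowSum, Pi.one_apply]
    rw [← Finset.sum_mul, (dual_stoch hS).rowSum, one_mul]
  | succ j ih =>
    rw [Ua]
    simp only [Gd] at ih ⊢
    simp only [ih]
    rw [surv_succ, Ko_apply, Finset.mul_sum]
    refine Finset.sum_congr rfl fun x _ => ?_
    simp only [← sub_eq_add_neg]
    ring

lemma Gd_meas_bdd (hS : IsStochastic P ν) (n : ℕ) : ∀ x, Measurable (Gd P ν f n x) ∧ ∀ w, |Gd P ν f n x w| ≤ 1 := by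
  induction n with
  | zero => intro x; exact ⟨measurable_const, fun w => by simp [Gd]⟩
  | succ n ih =>
    intro x
    refine ⟨?_, fun w => ?_⟩
    · refine ind_meas_pos.mul ?_
      exact Finset.measurable_sum _ fun b _ => ((ih b).1.comp (measurable_id.sub_const _)).const_mul _
    · simp only [Gd, abs_mul]
      refine mul_le_one₀ (by rw [abs_of_nonneg (ind_nonneg _)]; exact ind_le_one _) (abs_nonneg _) ?_
      unfold Ua
      refine (Finset.abs_sum_le_sum_abs _ _).trans ?_
      rw [← (dual_stoch hS).rowSum x]
      refine Finset.sum_le_sum fun b _ => ?_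
      rw [abs_mul, abs_of_nonneg ((dual_stoch hS).nonneg x b)]
      exact mul_le_of_le_one_right ((dual_stoch hS).nonneg x b) ((ih b).2 _)

lemma pair_Ko (hS : IsStochastic P ν) (i : ℕ) {h : X → ℝ → ℝ} (hh : ∀ b, Integrable (fun w => ind (0 < w) * h b w)) :
    ∑ x, ν x * ∫ z, Gd P ν f i x z * Ko P f h x z = ∑ x, ν x * ∫ z, Gd P ν f (i + 1) x z * h x z := by
  rw [Ko_eq_Uo, adj hS]
  · refine Finset.sum_congr rfl fun b _ => ?_
    congr 1
    refine integral_congr_ae (Eventually.of_forall fun z => ?_)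
    simp only [Gd]; ring
  · intro x b
    refine (hh b).bdd_mul (c := 1) (((Gd_meas_bdd hS i x).1.comp (measurable_id.sub_const (f b))).aestronglyMeasurable)
      (Eventually.of_forall fun w => (Gd_meas_bdd hS i x).2 _)

lemma pair_Fd (hS : IsStochastic P ν) (d : ℝ) (n : ℕ) (i : ℕ) :
    ∑ x, ν x * ∫ z, Gd P ν f i x z * Fd P f d n x z = ∑ x, ν x * ∫ z, Gd P ν f (i + n) x z * Fd P f d 0 x z := by
  induction n generalizing i with
  | zero => rfl
  | succ n ih =>
    rw [Fd_succ, pair_Ko hS i (phiFd_int hS d n), ih (i + 1)]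
    simp only [add_assoc, add_comm 1 n]

lemma Fd_dual (hS : IsStochastic P ν) (d : ℝ) (j : ℕ) :
    ∑ x, ν x * ∫ z, Fd P f d (j + 1) x z = ∑ b, ν b * ∫ w, ind (0 < w - f b) *
      surv (dualK P ν) (fun b => -f b) j b (w - f b) * ind (w ≤ d) := by
  have h := pair_Fd (f := f) hS d (j + 1) 0
  rw [zero_add] at h
  have e2 : ∀ x z, Gd P ν f 0 x z = 1 := fun _ _ => rfl
  simp only [e2, one_mul] at h
  rw [h]
  have e0 : Fd P f d 0 = Uo P f (fun _ z => ind (z ≤ d)) := by simp [Fd]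
  rw [e0]
  rw [adj hS]
  · simp only [Ua_Gd hS]
  · intro x b
    refine bdd_supp_int (a := f b) (b := d)
      (((Gd_meas_bdd hS (j + 1) x).1.comp (measurable_id.sub_const (f b))).mul (ind_meas_le d)) fun w => ?_
    have h2 : |Gd P ν f (j + 1) x (w - f b)| ≤ ind (0 < w - f b) := by
      simp only [Gd]
      by_cases hw : 0 < w - f b
      · have h5 := (Gd_meas_bdd (f := f) hS (j + 1) x).2 (w - f b)
        simp only [Gd] at h5
        rwa [ind_true hw] at h5 ⊢
      · rw [ind_false hw]; simp
    rw [abs_mul, ind_and, abs_of_nonneg (ind_nonneg (w ≤ d))]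
    refine mul_le_mul_of_nonneg_right (h2.trans (ind_mono fun h => by linarith)) (ind_nonneg _)

lemma surv_meas (n : ℕ) : ∀ x, Measurable (surv P f n x) := by
  induction n with
  | zero => intro x; rw [surv_zero]; exact measurable_const
  | succ n ih => intro x; rw [surv_succ]; exact Ko_meas ih x

lemma Wd_int (hS : IsStochastic P ν) (d : ℝ) (j : ℕ) (b : X) : Integrable (fun w => ind (0 < w - f b) *
      surv (dualK P ν) (fun b => -f b) j b (w - f b) * ind (w ≤ d)) := by
  refine bdd_supp_int (a := f b) (b := d) ?_ fun w => ?_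
  · exact ((ind_meas_pos.comp (measurable_id.sub_const (f b))).mul
      ((surv_meas j b).comp (measurable_id.sub_const (f b)))).mul (ind_meas_le d)
  · have h0 := surv_nonneg (f := fun b => -f b) (dual_stoch hS) j b (w - f b)
    have h1 := surv_le_one (f := fun b => -f b) (dual_stoch hS) j b (w - f b)
    rw [abs_of_nonneg (mul_nonneg (mul_nonneg (ind_nonneg _) h0) (ind_nonneg _)), ind_and]
    refine mul_le_mul_of_nonneg_right ?_ (ind_nonneg _)
    refine (mul_le_of_le_one_right (ind_nonneg _) h1).trans (ind_mono fun h => by linarith)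

lemma nu_min (hS : IsStochastic P ν) : ∃ c : ℝ, 0 < c ∧ ∀ x, c ≤ ν x := by
  obtain ⟨x0, hx0⟩ := Finite.exists_min ν
  exact ⟨ν x0, hS.nuPos x0, hx0⟩

lemma L1_eq {g : X → ℝ → ℝ} (hg : ∀ x y, 0 ≤ g x y) : L1 g = ∑ x, ∫ v, g x v := by
  unfold L1
  refine Finset.sum_congr rfl fun x _ => ?_
  simp only [abs_of_nonneg (hg x _)]

/-- decay of the dual survival probabilities -/
def DecD (P : X → X → ℝ) (f : X → ℝ) : Prop :=
  ∀ z, ∃ C : ℝ, 0 < C ∧ ∀ (n : ℕ) (b : X), surv P f n b z ≤ C / Real.sqrt (n + 1)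

lemma Fd_L1_diff (hS : IsStochastic P ν) (hD : DecD (dualK P ν) (fun b => -f b)) :
    ∃ C : ℝ, 0 < C ∧ ∀ (d d' : ℝ) (n : ℕ), d ≤ d' → d' ≤ 1 →
      L1 (Fd P f d' (n + 1)) - L1 (Fd P f d (n + 1)) ≤ C * (d' - d) / Real.sqrt (n + 1) := by
  obtain ⟨M, hM, hfM⟩ := exists_bound f
  obtain ⟨C, hC, hCv⟩ := hD (1 + M)
  obtain ⟨c, hc, hcν⟩ := nu_min hS
  refine ⟨C / c, by positivity, fun d d' n hd hd' => ?_⟩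
  have hA : 0 ≤ C / Real.sqrt (n + 1) := by positivity
  rw [L1_eq (Fd_nonneg hS d' (n + 1)), L1_eq (Fd_nonneg hS d (n + 1)), ← Finset.sum_sub_distrib]
  have h1 : c * ∑ x, ((∫ v, Fd P f d' (n + 1) x v) - ∫ v, Fd P f d (n + 1) x v) ≤
      ∑ x, ν x * ((∫ v, Fd P f d' (n + 1) x v) - ∫ v, Fd P f d (n + 1) x v) := by
    rw [Finset.mul_sum]
    refine Finset.sum_le_sum fun x _ => mul_le_mul_of_nonneg_right (hcν x) ?_
    rw [sub_nonneg]
    exact integral_mono (Fd_int hS d n x) (Fd_int hS d' n x) fun v => Fd_mono hS hd _ _ _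
  have h2 : ∑ x, ν x * ((∫ v, Fd P f d' (n + 1) x v) - ∫ v, Fd P f d (n + 1) x v) ≤
      C / Real.sqrt (n + 1) * (d' - d) := by
    simp only [mul_sub]
    rw [Finset.sum_sub_distrib, Fd_dual hS, Fd_dual hS, ← Finset.sum_sub_distrib]
    have h3 : ∀ b, ν b * (∫ w, ind (0 < w - f b) * surv (dualK P ν) (fun b => -f b) n b (w - f b) * ind (w ≤ d')) -
        ν b * (∫ w, ind (0 < w - f b) * surv (dualK P ν) (fun b => -f b) n b (w - f b) * ind (w ≤ d)) ≤
        ν b * (C / Real.sqrt (n + 1) * (d' - d)) := by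
      intro b
      rw [← mul_sub, ← integral_sub (Wd_int hS d' n b) (Wd_int hS d n b), ← int_ind_Ioc hd]
      refine mul_le_mul_of_nonneg_left ?_ (hS.nuPos b).le
      rw [← integral_const_mul]
      refine integral_mono ((Wd_int hS d' n b).sub (Wd_int hS d n b)) ((ind_Ioc_int d d').const_mul _) fun w => ?_
      have h0 := surv_nonneg (f := fun b => -f b) (dual_stoch hS) n b (w - f b)
      simp only
      by_cases hw : w ≤ d
      · rw [ind_true hw, ind_true (hw.trans hd), sub_self]
        exact mul_nonneg hA (ind_nonneg _)
      · by_cases hw' : w ≤ d'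
        · rw [ind_false hw, ind_true hw', ind_true (p := d < w ∧ w ≤ d') ⟨not_le.1 hw, hw'⟩, mul_one, mul_zero, sub_zero, mul_one]
          refine (mul_le_of_le_one_left h0 (ind_le_one _)).trans ?_
          refine (surv_mono (dual_stoch hS) n b ?_).trans (hCv n b)
          have := (abs_le.1 (hfM b)).1
          linarith
        · rw [ind_false hw, ind_false hw', sub_self]
          exact mul_nonneg hA (ind_nonneg _)
    refine (Finset.sum_le_sum fun b _ => h3 b).trans ?_
    rw [← Finset.sum_mul, hS.nuSum, one_mul, mul_sub]
  have h4 := h1.trans h2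
  rw [mul_comm c, ← le_div_iff₀ hc] at h4
  refine h4.trans (le_of_eq ?_)
  field_simp

lemma Fd_L1 (hS : IsStochastic P ν) (hD : DecD (dualK P ν) (fun b => -f b)) :
    ∃ C : ℝ, 0 < C ∧ ∀ (d : ℝ) (n : ℕ), d ≤ 1 → L1 (Fd P f d (n + 1)) ≤ C / Real.sqrt (n + 1) := by
  obtain ⟨M, hM, hfM⟩ := exists_bound f
  obtain ⟨C, hC, hCd⟩ := Fd_L1_diff hS hD
  refine ⟨C * (1 + M), by positivity, fun d n hd => ?_⟩
  have h1 := hCd (-M) 1 n (by linarith) le_rfl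
  have h2 : L1 (Fd P f (-M) (n + 1)) ≤ 0 := by
    rw [L1_eq (Fd_nonneg hS _ (n + 1))]
    obtain ⟨c, hc, hcν⟩ := nu_min hS
    have h3 := Fd_dual (f := f) hS (-M) n
    have h4 : ∑ b, ν b * ∫ w, ind (0 < w - f b) *
      surv (dualK P ν) (fun b => -f b) n b (w - f b) * ind (w ≤ -M) = 0 := by
      refine Finset.sum_eq_zero fun b _ => ?_
      have : ∀ w, ind (0 < w - f b) * surv (dualK P ν) (fun b => -f b) n b (w - f b) * ind (w ≤ -M) = 0 := by
        intro w
        by_cases hw : w ≤ -M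
        · rw [ind_false (p := 0 < w - f b), zero_mul, zero_mul]
          have := (abs_le.1 (hfM b)).1
          intro h; linarith
        · rw [ind_false hw, mul_zero]
      simp only [this, integral_zero, mul_zero]
    rw [h4] at h3
    have h5 : c * ∑ x, (∫ v, Fd P f (-M) (n + 1) x v) ≤ ∑ x, ν x * ∫ v, Fd P f (-M) (n + 1) x v := by
      rw [Finset.mul_sum]
      refine Finset.sum_le_sum fun x _ => mul_le_mul_of_nonneg_right (hcν x) ?_
      exact integral_nonneg fun v => Fd_nonneg hS _ _ _ _
    rw [h3] at h5
    exact nonpos_of_mul_nonpos_right h5 hc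
  have h6 : L1 (Fd P f d (n + 1)) ≤ L1 (Fd P f 1 (n + 1)) := by
    rw [L1_eq (Fd_nonneg hS _ (n + 1)), L1_eq (Fd_nonneg hS _ (n + 1))]
    exact Finset.sum_le_sum fun x _ => integral_mono (Fd_int hS _ n x) (Fd_int hS _ n x) fun v => Fd_mono hS hd _ _ _
  rw [sub_neg_eq_add] at h1
  linarith

end

/-! ### Part 10 -/


/-! ### S10: sandwich and regularity in time -/
section
variable [Fintype X] [DecidableEq X] [Nonempty X] {P : X → X → ℝ} {ν f : X → ℝ}

lemma Fd_shift (hS : IsStochastic P ν) {d d' : ℝ} (n : ℕ) (x : X) {y z : ℝ} (h1 : z ≤ y) (h2 : y - z + d ≤ d') :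
    Fd P f d n x z ≤ Fd P f d' n x y := by
  induction n generalizing x y z with
  | zero =>
    simp only [Fd, pow_zero, Module.End.one_apply, Uo_apply]
    refine Finset.sum_le_sum fun b _ => mul_le_mul_of_nonneg_left (ind_mono fun h => ?_) (hS.nonneg _ _)
    linarith
  | succ n ih =>
    rw [Fd_succ, Fd_succ, Ko_apply, Ko_apply]
    refine Finset.sum_le_sum fun b _ => mul_le_mul_of_nonneg_left ?_ (hS.nonneg _ _)
    refine mul_le_mul (ind_mono fun h => by linarith) (ih b (by linarith) (by linarith)) (Fd_nonneg hS _ _ _ _) (ind_nonneg _)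

/-- inner part of the kernel -/
noncomputable def kin (δ T u : ℝ) : ℝ := Set.indicator (Set.Ioc (-δ) δ) (KT T) u
/-- outer part of the kernel -/
noncomputable def kout (δ T u : ℝ) : ℝ := Set.indicator (Set.Ioc (-δ) δ)ᶜ (KT T) u

lemma kin_add_kout (δ T u : ℝ) : kin δ T u + kout δ T u = KT T u := by
  unfold kin kout
  exact congrFun (Set.indicator_self_add_compl (Set.Ioc (-δ) δ) (KT T)) u

lemma KT_bdd {T : ℝ} (hT : 0 < T) : ∃ B : ℝ, ∀ u, |KT T u| ≤ B := by
  refine ⟨T * 6 / ck, fun u => ?_⟩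
  rw [abs_of_nonneg (KT_nonneg hT u)]
  unfold KT
  refine div_le_div_of_nonneg_right ?_ ck_pos.le
  rw [kap_scale hT]
  refine mul_le_mul_of_nonneg_left ((kap_one_le _).trans ?_) hT.le
  have : (1 + (T * u) ^ 2)⁻¹ ≤ 1 := inv_le_one_of_one_le₀ (by nlinarith [sq_nonneg (T * u)])
  linarith

lemma kin_nonneg {δ T : ℝ} (hT : 0 < T) (u : ℝ) : 0 ≤ kin δ T u := Set.indicator_nonneg (fun v _ => KT_nonneg hT v) u
lemma kout_nonneg {δ T : ℝ} (hT : 0 < T) (u : ℝ) : 0 ≤ kout δ T u := Set.indicator_nonneg (fun v _ => KT_nonneg hT v) u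
lemma kin_le {δ T : ℝ} (hT : 0 < T) (u : ℝ) : kin δ T u ≤ KT T u := by
  linarith [kin_add_kout δ T u, kout_nonneg (δ := δ) hT u]
lemma kout_le {δ T : ℝ} (hT : 0 < T) (u : ℝ) : kout δ T u ≤ KT T u := by
  linarith [kin_add_kout δ T u, kin_nonneg (δ := δ) hT u]
lemma kin_meas (δ T : ℝ) : Measurable (kin δ T) := (KT_cont T).measurable.indicator measurableSet_Ioc
lemma kout_meas (δ T : ℝ) : Measurable (kout δ T) := (KT_cont T).measurable.indicator measurableSet_Ioc.compl
lemma kin_int {δ T : ℝ} (hT : 0 < T) : Integrable (kin δ T) := (KT_int hT).indicator measurableSet_Ioc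
lemma kout_int {δ T : ℝ} (hT : 0 < T) : Integrable (kout δ T) := (KT_int hT).indicator measurableSet_Ioc.compl

lemma kin_mass {δ T : ℝ} (hδ : 0 < δ) (h : 1 - δ ≤ ∫ u in (-δ)..δ, KT T u) : 1 - δ ≤ ∫ u, kin δ T u := by
  unfold kin
  rwa [integral_indicator measurableSet_Ioc, ← intervalIntegral.integral_of_le (by linarith)]

lemma kin_mass_le {δ T : ℝ} (hT : 0 < T) : ∫ u, kin δ T u ≤ 1 := by
  rw [← KT_mass hT]
  exact integral_mono (kin_int hT) (KT_int hT) fun u => kin_le hT u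

lemma kout_mass {δ T : ℝ} (hT : 0 < T) (hδ : 0 < δ) (h : 1 - δ ≤ ∫ u in (-δ)..δ, KT T u) : ∫ u, kout δ T u ≤ δ := by
  have h1 := kin_mass hδ h
  have h2 : (∫ u, kin δ T u) + ∫ u, kout δ T u = 1 := by
    rw [← integral_add (kin_int hT) (kout_int hT), ← KT_mass hT]
    simp only [kin_add_kout]
  linarith

/-- upper envelope -/
noncomputable def Gp (P : X → X → ℝ) (f : X → ℝ) (δ : ℝ) (n : ℕ) : X → ℝ → ℝ := fun x v => Fd P f (2 * δ) n x (v + δ)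
/-- lower envelope -/
noncomputable def Gm (P : X → X → ℝ) (f : X → ℝ) (δ : ℝ) (n : ℕ) : X → ℝ → ℝ := fun x v => Fd P f (-(2 * δ)) n x (v - δ)

lemma Gp_int (hS : IsStochastic P ν) (δ : ℝ) (n : ℕ) (x : X) : Integrable (Gp P f δ (n + 1) x) :=
  (Fd_int hS (2 * δ) n x).comp_add_right δ
lemma Gm_int (hS : IsStochastic P ν) (δ : ℝ) (n : ℕ) (x : X) : Integrable (Gm P f δ (n + 1) x) :=
  (Fd_int hS (-(2 * δ)) n x).comp_sub_right δ

lemma L1_Gp (δ : ℝ) (n : ℕ) : L1 (Gp P f δ n) = L1 (Fd P f (2 * δ) n) := by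
  unfold L1 Gp
  refine Finset.sum_congr rfl fun x _ => ?_
  exact integral_add_right_eq_self (fun v => |Fd P f (2 * δ) n x v|) δ
lemma L1_Gm (δ : ℝ) (n : ℕ) : L1 (Gm P f δ n) = L1 (Fd P f (-(2 * δ)) n) := by
  unfold L1 Gm
  refine Finset.sum_congr rfl fun x _ => ?_
  exact integral_sub_right_eq_self (fun v => |Fd P f (-(2 * δ)) n x v|) δ

lemma Gm_le_Gp (hS : IsStochastic P ν) {δ : ℝ} (hδ : 0 < δ) (n : ℕ) (x : X) (v : ℝ) : Gm P f δ n x v ≤ Gp P f δ n x v :=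
  Fd_shift hS n x (by linarith) (by linarith)

lemma L1_sub (hS : IsStochastic P ν) {δ : ℝ} (hδ : 0 < δ) (n : ℕ) :
    L1 (Gp P f δ (n + 1) - Gm P f δ (n + 1)) = L1 (Fd P f (2 * δ) (n + 1)) - L1 (Fd P f (-(2 * δ)) (n + 1)) := by
  rw [← L1_Gp, ← L1_Gm, L1_eq (g := Gp P f δ (n + 1)) (fun x y => Fd_nonneg hS _ _ _ _),
    L1_eq (g := Gm P f δ (n + 1)) (fun x y => Fd_nonneg hS _ _ _ _), L1_eq (g := Gp P f δ (n + 1) - Gm P f δ (n + 1)) (fun x y => sub_nonneg.2 (Gm_le_Gp hS hδ _ _ _)),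
    ← Finset.sum_sub_distrib]
  refine Finset.sum_congr rfl fun x _ => ?_
  exact integral_sub (Gp_int hS δ n x) (Gm_int hS δ n x)

lemma Cv_up (hS : IsStochastic P ν) {δ T : ℝ} (hT : 0 < T) (hδ : 0 < δ) (h : 1 - δ ≤ ∫ u in (-δ)..δ, KT T u)
    (n : ℕ) (x : X) (y : ℝ) : (1 - δ) * Fd P f 0 (n + 1) x y ≤ Cv (KT T) (Gp P f δ (n + 1)) x y := by
  obtain ⟨B, hB⟩ := KT_bdd hT
  have hF := Fd_nonneg (f := f) hS 0 (n + 1) x y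
  calc (1 - δ) * Fd P f 0 (n + 1) x y ≤ Fd P f 0 (n + 1) x y * ∫ u, kin δ T u := by
        rw [mul_comm]; exact mul_le_mul_of_nonneg_left (kin_mass hδ h) hF
    _ = ∫ v, Fd P f 0 (n + 1) x y * kin δ T (y - v) := by
        rw [integral_const_mul, integral_sub_left_eq_self (kin δ T) volume y]
    _ ≤ Cv (KT T) (Gp P f δ (n + 1)) x y := by
        unfold Cv
        refine integral_mono (((kin_int hT).comp_sub_left y).const_mul _)
          (Cv_integrable (KT_cont T).measurable hB (Gp_int hS δ n x) y) fun v => ?_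
        simp only
        by_cases hv : y - v ∈ Set.Ioc (-δ) δ
        · have : kin δ T (y - v) = KT T (y - v) := Set.indicator_of_mem hv _
          rw [this]
          refine mul_le_mul_of_nonneg_right ?_ (KT_nonneg hT _)
          exact Fd_shift hS _ x (by linarith [hv.2]) (by linarith [hv.1])
        · have : kin δ T (y - v) = 0 := Set.indicator_of_notMem hv _
          rw [this, mul_zero]
          exact mul_nonneg (Fd_nonneg hS _ _ _ _) (KT_nonneg hT _)

lemma Cv_down (hS : IsStochastic P ν) {δ T : ℝ} (hT : 0 < T) (hδ : 0 < δ)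
    (n : ℕ) (x : X) (y : ℝ) : Cv (KT T) (Gm P f δ (n + 1)) x y ≤
      (Fd P f 0 (n + 1) + Cv (kout δ T) (Gm P f δ (n + 1))) x y := by
  obtain ⟨B, hB⟩ := KT_bdd hT
  have hkoB : ∀ u, |kout δ T u| ≤ B := fun u => by
    rw [abs_of_nonneg (kout_nonneg hT u)]; exact (kout_le hT u).trans (le_of_abs_le (hB u))
  have hF := Fd_nonneg (f := f) hS 0 (n + 1) x y
  have i1 := Cv_integrable (KT_cont T).measurable hB (Gm_int (f := f) hS δ n x) y
  have i2 := Cv_integrable (kout_meas δ T) hkoB (Gm_int (f := f) hS δ n x) y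
  have h1 : Cv (KT T) (Gm P f δ (n + 1)) x y - Cv (kout δ T) (Gm P f δ (n + 1)) x y ≤ Fd P f 0 (n + 1) x y := by
    calc _ = ∫ v, (Gm P f δ (n + 1) x v * KT T (y - v) - Gm P f δ (n + 1) x v * kout δ T (y - v)) := by
          unfold Cv; rw [integral_sub i1 i2]
      _ ≤ ∫ v, Fd P f 0 (n + 1) x y * kin δ T (y - v) := by
          refine integral_mono (i1.sub i2) (((kin_int hT).comp_sub_left y).const_mul _) fun v => ?_
          simp only
          rw [← mul_sub, ← kin_add_kout δ T (y - v), add_sub_cancel_right]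
          by_cases hv : y - v ∈ Set.Ioc (-δ) δ
          · refine mul_le_mul_of_nonneg_right ?_ (kin_nonneg hT _)
            exact Fd_shift hS _ x (by linarith [hv.1]) (by linarith [hv.2])
          · have : kin δ T (y - v) = 0 := Set.indicator_of_notMem hv _
            rw [this, mul_zero, mul_zero]
      _ = Fd P f 0 (n + 1) x y * ∫ u, kin δ T u := by
          rw [integral_const_mul, integral_sub_left_eq_self (kin δ T) volume y]
      _ ≤ Fd P f 0 (n + 1) x y := mul_le_of_le_one_right hF (kin_mass_le hT)
  simp only [Pi.add_apply]
  linarith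

lemma U_up (hS : IsStochastic P ν) {δ T : ℝ} (hT : 0 < T) (hδ : 0 < δ) (h : 1 - δ ≤ ∫ u in (-δ)..δ, KT T u)
    (l n : ℕ) (x : X) (y : ℝ) : (1 - δ) * (Uo P f ^ l) (Fd P f 0 (n + 1)) x y ≤ (Uo P f ^ l) (Cv (KT T) (Gp P f δ (n + 1))) x y := by
  have := ((posU (f := f) hS).pow l) ((1 - δ) • Fd P f 0 (n + 1)) _ (fun x y => Cv_up hS hT hδ h n x y) x y
  simpa using this

lemma U_le (hS : IsStochastic P ν) {δ T : ℝ} (hT : 0 < T) (hδ : 0 < δ) (hδ2 : δ ≤ 1 / 2) (h : 1 - δ ≤ ∫ u in (-δ)..δ, KT T u)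
    (l n : ℕ) (x : X) (y : ℝ) : (Uo P f ^ l) (Fd P f 0 (n + 1)) x y ≤ 2 * (IT P f T l / ck * L1 (Fd P f (2 * δ) (n + 1))) := by
  have h1 := U_up (f := f) hS hT hδ h l n x y
  have h2 := le_of_abs_le (smooth_bound (P := P) (f := f) hT (Gp_int (f := f) hS δ n) l x y)
  rw [L1_Gp] at h2
  have h3 : 0 ≤ (Uo P f ^ l) (Fd P f 0 (n + 1)) x y := ((posU hS).pow l).nonneg (Fd_nonneg hS 0 (n + 1)) x y
  nlinarith

lemma U_diff (hS : IsStochastic P ν) {δ T : ℝ} (hT : 0 < T) (hδ : 0 < δ) (hδ2 : δ ≤ 1 / 2) (h : 1 - δ ≤ ∫ u in (-δ)..δ, KT T u)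
    (l l' n : ℕ) (x : X) (y : ℝ) :
    (Uo P f ^ l') (Fd P f 0 (n + 1)) x y - (Uo P f ^ l) (Fd P f 0 (n + 1)) x y ≤
      DT P f T l l' / ck * L1 (Fd P f (-(2 * δ)) (n + 1)) +
      IT P f T l' / ck * (L1 (Fd P f (2 * δ) (n + 1)) - L1 (Fd P f (-(2 * δ)) (n + 1))) +
      2 * δ * (IT P f T l' / ck * L1 (Fd P f (2 * δ) (n + 1))) +
      2 * δ * (IT P f T l / ck * L1 (Fd P f (2 * δ) (n + 1))) := by
  obtain ⟨B, hB⟩ := KT_bdd hT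
  have hkoB : ∀ u, |kout δ T u| ≤ B := fun u => by
    rw [abs_of_nonneg (kout_nonneg hT u)]; exact (kout_le hT u).trans (le_of_abs_le (hB u))
  have h1 := U_up (f := f) hS hT hδ h l' n x y
  have h2 := le_of_abs_le (smooth_bound (P := P) (f := f) hT (Gp_int (f := f) hS δ n) l' x y)
  have h2' := neg_le_of_abs_le (smooth_bound (P := P) (f := f) hT (Gp_int (f := f) hS δ n) l' x y)
  rw [L1_Gp] at h2 h2'
  have hU' : (Uo P f ^ l') (Fd P f 0 (n + 1)) x y ≤ 2 * (IT P f T l' / ck * L1 (Fd P f (2 * δ) (n + 1))) :=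
    U_le hS hT hδ hδ2 h l' n x y
  have h3 : (Uo P f ^ l') (Cv (KT T) (Gp P f δ (n + 1))) x y - (Uo P f ^ l') (Cv (KT T) (Gm P f δ (n + 1))) x y ≤
      IT P f T l' / ck * (L1 (Fd P f (2 * δ) (n + 1)) - L1 (Fd P f (-(2 * δ)) (n + 1))) := by
    rw [← L1_sub hS hδ]
    have h4 := le_of_abs_le (smooth_bound (P := P) (f := f) hT
      (g := Gp P f δ (n + 1) - Gm P f δ (n + 1)) (fun x => (Gp_int hS δ n x).sub (Gm_int hS δ n x)) l' x y)
    have h5 : Cv (KT T) (Gp P f δ (n + 1) - Gm P f δ (n + 1)) = Cv (KT T) (Gp P f δ (n + 1)) - Cv (KT T) (Gm P f δ (n + 1)) := by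
      funext x y
      simp only [Cv, Pi.sub_apply, sub_mul]
      exact integral_sub (Cv_integrable (KT_cont T).measurable hB (Gp_int hS δ n x) y)
        (Cv_integrable (KT_cont T).measurable hB (Gm_int hS δ n x) y)
    rw [h5, map_sub] at h4
    exact h4
  have h6 := le_of_abs_le (smooth_diff (P := P) (f := f) hT (Gm_int (f := f) hS δ n) l l' x y)
  rw [L1_Gm] at h6
  have h7 := ((posU (f := f) hS).pow l) _ _ (fun x y => Cv_down (f := f) hS hT hδ n x y) x y
  rw [map_add, ← Cv_Uo_pow (kout_meas δ T) hkoB (Gm_int hS δ n)] at h7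
  simp only [Pi.add_apply] at h7
  have h8 : Cv (kout δ T) ((Uo P f ^ l) (Gm P f δ (n + 1))) x y ≤
      2 * (IT P f T l / ck * L1 (Fd P f (2 * δ) (n + 1))) * ∫ u, kout δ T u := by
    refine Cv_le (kout_meas δ T) (kout_nonneg hT) hkoB (kout_int hT) (Uo_pow_int (Gm_int hS δ n) l) (fun x y => ?_) x y
    refine le_trans ?_ (U_le hS hT hδ hδ2 h l n x y)
    exact ((posU hS).pow l) _ _ (fun x y => Fd_shift hS _ x (by linarith) (by linarith)) x y
  have h9 := kout_mass hT hδ h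
  have h10 : 0 ≤ 2 * (IT P f T l / ck * L1 (Fd P f (2 * δ) (n + 1))) :=
    (((posU hS).pow l).nonneg (Fd_nonneg hS 0 (n + 1)) x y).trans (U_le hS hT hδ hδ2 h l n x y)
  have h11 := mul_le_mul_of_nonneg_left h9 h10
  have h12 := mul_le_mul_of_nonneg_left hU' hδ.le
  linarith

end

/-! ### Part 11 -/


/-! ### S11: rates and regularity in time -/
section
variable [Fintype X] [DecidableEq X] [Nonempty X] {P : X → X → ℝ} {ν f : X → ℝ}
attribute [local instance] Matrix.linftyOpNormedRing Matrix.linftyOpNormedAlgebra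

lemma IT_nonneg {T : ℝ} (hT : 0 < T) (l : ℕ) : 0 ≤ IT P f T l :=
  intervalIntegral.integral_nonneg (by linarith) fun _ _ => norm_nonneg _
lemma DT_nonneg {T : ℝ} (hT : 0 < T) (l l' : ℕ) : 0 ≤ DT P f T l l' :=
  intervalIntegral.integral_nonneg (by linarith) fun _ _ => norm_nonneg _
lemma DT_symm (T : ℝ) (l l' : ℕ) : DT P f T l l' = DT P f T l' l := by
  unfold DT; simp only [norm_sub_rev]
lemma L1_nonneg (g : X → ℝ → ℝ) : 0 ≤ L1 g :=
  Finset.sum_nonneg fun _ _ => integral_nonneg fun _ => abs_nonneg _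

lemma U_rate (hS : IsStochastic P ν) (h1 : Primitive P) (h2 : ∑ x, f x * ν x = 0)
    (h3 : NonLattice P f) (hD : DecD (dualK P ν) (fun b => -f b)) :
    ∃ (C : ℝ) (l0 : ℕ), 0 < C ∧ 1 ≤ l0 ∧ ∀ l ≥ l0, ∀ n x y,
      (Uo P f ^ l) (Fd P f 0 (n + 1)) x y ≤ C / (Real.sqrt l * Real.sqrt (n + 1)) := by
  obtain ⟨C1, hC1, hIT⟩ := IT_bound hS h1 h2 h3
  obtain ⟨CA, hCA, hL1⟩ := Fd_L1 hS hD
  obtain ⟨T, hT, hK⟩ := KT_conc (δ := 1 / 2) (by norm_num)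
  obtain ⟨l0, hl0, hl⟩ := hIT T hT
  have hck := ck_pos
  refine ⟨2 * (C1 / ck * CA), l0, by positivity, hl0, fun l hll n x y => ?_⟩
  refine (U_le hS hT (by norm_num) le_rfl hK l n x y).trans ?_
  have e1 := hl l hll
  have e2 := hL1 (2 * (1 / 2)) n (by norm_num)
  calc 2 * (IT P f T l / ck * L1 (Fd P f (2 * (1 / 2)) (n + 1)))
      ≤ 2 * ((C1 / Real.sqrt l) / ck * (CA / Real.sqrt (n + 1))) := by
        have := L1_nonneg (Fd P f (2 * (1 / 2)) (n + 1))
        gcongr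
    _ = _ := by field_simp

lemma U_reg (hS : IsStochastic P ν) (h1 : Primitive P) (h2 : ∑ x, f x * ν x = 0)
    (h3 : NonLattice P f) (hD : DecD (dualK P ν) (fun b => -f b)) {η : ℝ} (hη : 0 < η) :
    ∃ (ε : ℝ) (l0 : ℕ), 0 < ε ∧ 1 ≤ l0 ∧ ∀ l ≥ l0, ∀ k : ℕ, (k : ℝ) ≤ ε * l → ∀ n x y,
      |(Uo P f ^ (l + k)) (Fd P f 0 (n + 1)) x y - (Uo P f ^ l) (Fd P f 0 (n + 1)) x y| ≤
        η / (Real.sqrt l * Real.sqrt (n + 1)) := by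
  obtain ⟨C1, hC1, hIT⟩ := IT_bound hS h1 h2 h3
  obtain ⟨CA, hCA, hL1⟩ := Fd_L1 hS hD
  obtain ⟨CB, hCB, hLd⟩ := Fd_L1_diff hS hD
  have hck := ck_pos
  obtain ⟨δ, hδ, hδ2, hδ3⟩ : ∃ δ : ℝ, 0 < δ ∧ δ ≤ 1 / 2 ∧ δ * (4 * C1 * CB + 4 * C1 * CA) ≤ η * ck / 2 := by
    refine ⟨min (1 / 2) (η * ck / 2 / (4 * C1 * CB + 4 * C1 * CA)), by positivity, min_le_left _ _, ?_⟩
    rw [← le_div_iff₀ (by positivity)]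
    exact min_le_right _ _
  obtain ⟨T, hT, hK⟩ := KT_conc hδ
  obtain ⟨l0, hl0, hl⟩ := hIT T hT
  obtain ⟨ε, l1, hε, hl1, hDT⟩ := DT_bound hS h1 h2 h3 hT (η := η * ck / (2 * CA)) (by positivity)
  refine ⟨ε, max l0 l1, hε, hl0.trans (le_max_left _ _), fun l hll k hk n x y => ?_⟩
  have hl0' : l0 ≤ l := (le_max_left _ _).trans hll
  have hlpos : 0 < (l : ℝ) := by exact_mod_cast hl0.trans hl0'
  have e1 : IT P f T l ≤ C1 / Real.sqrt l := hl l hl0'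
  have e2 : IT P f T (l + k) ≤ C1 / Real.sqrt l := by
    refine (hl (l + k) (by omega)).trans ?_
    gcongr
    linarith
  have e3 : DT P f T l (l + k) ≤ η * ck / (2 * CA) / Real.sqrt l := hDT l ((le_max_right _ _).trans hll) k hk
  have a1 := hL1 (-(2 * δ)) n (by linarith)
  have a2 := hL1 (2 * δ) n (by linarith)
  have a3 := hLd (-(2 * δ)) (2 * δ) n (by linarith) (by linarith)
  have a4 : L1 (Fd P f (-(2 * δ)) (n + 1)) ≤ L1 (Fd P f (2 * δ) (n + 1)) := by
    rw [L1_eq (Fd_nonneg hS _ (n + 1)), L1_eq (Fd_nonneg hS _ (n + 1))]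
    exact Finset.sum_le_sum fun x _ => integral_mono (Fd_int hS _ n x) (Fd_int hS _ n x) fun v => Fd_mono hS (by linarith) _ _ _
  have key : ∀ l1 l2 : ℕ, IT P f T l1 ≤ C1 / Real.sqrt l → IT P f T l2 ≤ C1 / Real.sqrt l →
      DT P f T l1 l2 ≤ η * ck / (2 * CA) / Real.sqrt l →
      (Uo P f ^ l2) (Fd P f 0 (n + 1)) x y - (Uo P f ^ l1) (Fd P f 0 (n + 1)) x y ≤ η / (Real.sqrt l * Real.sqrt (n + 1)) := by
    intro l1 l2 i1 i2 i3
    refine (U_diff hS hT hδ hδ2 hK l1 l2 n x y).trans ?_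
    have p1 := L1_nonneg (Fd P f (-(2 * δ)) (n + 1))
    have p2 := L1_nonneg (Fd P f (2 * δ) (n + 1))
    have p3 := IT_nonneg (P := P) (f := f) hT l1
    have p4 := IT_nonneg (P := P) (f := f) hT l2
    calc _ ≤ (η * ck / (2 * CA) / Real.sqrt l) / ck * (CA / Real.sqrt (n + 1)) +
          (C1 / Real.sqrt l) / ck * (CB * (2 * δ - -(2 * δ)) / Real.sqrt (n + 1)) +
          2 * δ * ((C1 / Real.sqrt l) / ck * (CA / Real.sqrt (n + 1))) +
          2 * δ * ((C1 / Real.sqrt l) / ck * (CA / Real.sqrt (n + 1))) := by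
          have p5 := sub_nonneg.2 a4
          gcongr
      _ = (η / 2 + δ * (4 * C1 * CB + 4 * C1 * CA) / ck) / (Real.sqrt l * Real.sqrt (n + 1)) := by
          field_simp; ring
      _ ≤ η / (Real.sqrt l * Real.sqrt (n + 1)) := by
          gcongr
          have : δ * (4 * C1 * CB + 4 * C1 * CA) / ck ≤ η / 2 := by
            rw [div_le_iff₀ hck]; linarith
          linarith
  rw [abs_le]
  constructor
  · have := key (l + k) l e2 e1 (by rw [DT_symm]; exact e3)
    linarith
  · exact key l (l + k) e1 e2 e3

lemma Ko_pow_le_Uo_pow (hS : IsStochastic P ν) (n : ℕ) {h : X → ℝ → ℝ} (hh : ∀ x y, 0 ≤ h x y) (x : X) (y : ℝ) :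
    (Ko P f ^ n) h x y ≤ (Uo P f ^ n) h x y := by
  induction n generalizing x y with
  | zero => simp
  | succ n ih =>
    rw [pow_succ', pow_succ', Module.End.mul_apply, Module.End.mul_apply]
    refine (posK hS _ _ ih x y).trans ?_
    rw [Ko_apply, Uo_apply]
    refine Finset.sum_le_sum fun b _ => mul_le_mul_of_nonneg_left ?_ (hS.nonneg _ _)
    exact mul_le_of_le_one_left (((posU hS).pow n).nonneg hh _ _) (ind_le_one _)

lemma exi_add (a b : ℕ) : exi P f (a + b) = (Ko P f ^ a) (exi P f b) := by
  unfold exi; rw [pow_add, Module.End.mul_apply]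

lemma exi_le_one (hS : IsStochastic P ν) (n : ℕ) (x : X) (y : ℝ) : exi P f n x y ≤ 1 := by
  rw [exi_eq_Fd]; exact Fd_le_one hS _ _ _ _

lemma exi_sup (hS : IsStochastic P ν) (h1 : Primitive P) (h2 : ∑ x, f x * ν x = 0)
    (h3 : NonLattice P f) (hD : DecD (dualK P ν) (fun b => -f b)) :
    ∃ C : ℝ, 0 < C ∧ ∀ n x y, exi P f n x y ≤ C / (n + 1) := by
  obtain ⟨C, l0, hC, hl0, hU⟩ := U_rate hS h1 h2 h3 hD
  refine ⟨max (4 * C) (2 * l0 + 4), by positivity, fun n x y => ?_⟩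
  rw [le_div_iff₀ (by positivity)]
  by_cases hn : 2 * l0 + 2 ≤ n
  · refine le_trans ?_ (le_max_left _ _)
    obtain ⟨b, hb⟩ : ∃ b, n = n / 2 + (b + 1) := ⟨n - n / 2 - 1, by omega⟩
    have hle : exi P f n x y ≤ C / (Real.sqrt (n / 2 : ℕ) * Real.sqrt (b + 1)) := by
      have e : exi P f n = (Ko P f ^ (n / 2)) (exi P f (b + 1)) := by rw [← exi_add, ← hb]
      rw [e, exi_eq_Fd]
      exact (Ko_pow_le_Uo_pow hS _ (Fd_nonneg hS 0 (b + 1)) x y).trans (hU _ (by omega) b x y)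
    have g1 : ((n : ℝ) + 1) / 4 ≤ (n / 2 : ℕ) := by
      have : n + 1 ≤ 4 * (n / 2) := by omega
      have : ((n : ℝ) + 1) ≤ 4 * (n / 2 : ℕ) := by exact_mod_cast this
      linarith
    have g2 : ((n : ℝ) + 1) / 4 ≤ (b : ℝ) + 1 := by
      have : n + 1 ≤ 4 * (b + 1) := by omega
      have : ((n : ℝ) + 1) ≤ 4 * (b + 1) := by exact_mod_cast this
      linarith
    have g3 : ((n : ℝ) + 1) / 4 ≤ Real.sqrt (n / 2 : ℕ) * Real.sqrt (b + 1) := by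
      rw [← Real.mul_self_sqrt (by positivity : (0:ℝ) ≤ ((n : ℝ) + 1) / 4)]
      gcongr
    have g4 : C / (Real.sqrt (n / 2 : ℕ) * Real.sqrt (b + 1)) ≤ C / (((n : ℝ) + 1) / 4) := by gcongr
    have := hle.trans g4
    rw [le_div_iff₀ (by positivity)] at this
    linarith
  · refine le_trans ?_ (le_max_right _ _)
    have g1 : (n : ℝ) + 1 ≤ 2 * l0 + 4 := by
      have : n + 1 ≤ 2 * l0 + 4 := by omega
      exact_mod_cast this
    refine le_trans ?_ g1
    exact mul_le_of_le_one_left (by positivity) (exi_le_one hS _ _ _)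

lemma exi_rate (hS : IsStochastic P ν) (h1 : Primitive P) (h2 : ∑ x, f x * ν x = 0)
    (h3 : NonLattice P f) (hD : DecD (dualK P ν) (fun b => -f b)) (hDp : DecD P f) (y : ℝ) :
    ∃ C : ℝ, 0 < C ∧ ∀ n x, exi P f n x y ≤ C / ((n + 1) * Real.sqrt (n + 1)) := by
  obtain ⟨C, hC, hE⟩ := exi_sup hS h1 h2 h3 hD
  obtain ⟨C', hC', hv⟩ := hDp y
  refine ⟨4 * C * C', by positivity, fun n x => ?_⟩
  obtain ⟨b, hb⟩ : ∃ b, n = n / 2 + b := ⟨n - n / 2, by omega⟩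
  have e : exi P f n = (Ko P f ^ (n / 2)) (exi P f b) := by rw [← exi_add, ← hb]
  have e1 : exi P f n x y ≤ C / (b + 1) * surv P f (n / 2) x y := by
    rw [e]; exact ((posK hS).pow _).le_const (hE b) x y
  have g1 : ((n : ℝ) + 1) / 2 ≤ ((n / 2 : ℕ) : ℝ) + 1 := by
    have : n + 1 ≤ 2 * (n / 2 + 1) := by omega
    have : ((n : ℝ) + 1) ≤ 2 * ((n / 2 : ℕ) + 1) := by exact_mod_cast this
    linarith
  have g2 : ((n : ℝ) + 1) / 2 ≤ (b : ℝ) + 1 := by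
    have : n + 1 ≤ 2 * (b + 1) := by omega
    have : ((n : ℝ) + 1) ≤ 2 * (b + 1) := by exact_mod_cast this
    linarith
  have g3 : Real.sqrt (n + 1) / 2 ≤ Real.sqrt ((n / 2 : ℕ) + 1) := by
    rw [div_le_iff₀ (by norm_num)]
    refine Real.sqrt_le_iff.2 ⟨by positivity, ?_⟩
    rw [mul_pow, Real.sq_sqrt (by positivity)]; linarith
  calc exi P f n x y ≤ C / (b + 1) * (C' / Real.sqrt ((n / 2 : ℕ) + 1)) := by
        refine e1.trans (mul_le_mul_of_nonneg_left (hv _ _) (by positivity))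
    _ ≤ C / (((n : ℝ) + 1) / 2) * (C' / (Real.sqrt (n + 1) / 2)) := by gcongr
    _ = _ := by field_simp; ring
end

/-! ### Part 12 -/


/-! ### S12: regularity in time of exit probabilities -/
section
variable [Fintype X] [DecidableEq X] [Nonempty X] {P : X → X → ℝ} {ν f : X → ℝ}

lemma KL_abs (hS : IsStochastic P ν) (n : ℕ) {h : X → ℝ → ℝ} {B : ℝ} (hh : ∀ x y, |h x y| ≤ B) (x : X) (y : ℝ) :
    |(Ko P f ^ n * Lo P f) h x y| ≤ B * exi P f n x y :=
  (((posK hS).pow n).mul (posL hS)).abs_le_const hh x y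

lemma reg_step (hS : IsStochastic P ν) (m K q k : ℕ) (hq : q ≤ K) (x : X) (y B s e : ℝ)
    (hB : ∀ l ≥ q, ∀ x y, |(Uo P f ^ (l + k)) (exi P f m) x y - (Uo P f ^ l) (exi P f m) x y| ≤ B)
    (hs : ∀ x y, exi P f m x y ≤ s) (he : ∀ j ≥ m, exi P f j x y ≤ e) :
    |exi P f (2 * m + K + k) x y - exi P f (2 * m + K) x y| ≤ 2 * B * surv P f m x y + (2 * q + k) * (s * e) := by
  set h := exi P f m with hh
  have hs0 : 0 ≤ s := (exi_nonneg hS m x y).trans (hs x y)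
  have he0 : 0 ≤ e := (exi_nonneg hS m x y).trans (he m le_rfl)
  have hB0 : 0 ≤ B := (abs_nonneg _).trans (hB q le_rfl x y)
  have hUs : ∀ l x y, |(Uo P f ^ l) h x y| ≤ s := fun l x y => by
    have h0 : ∀ x y, |h x y| ≤ s := fun x y => by rw [abs_of_nonneg (exi_nonneg hS m x y)]; exact hs x y
    have := ((posU (f := f) hS).pow l).abs_le_const h0 x y
    rwa [Uo_pow_one hS, Pi.one_apply, Pi.one_apply, mul_one] at this
  obtain ⟨K', hK'⟩ : ∃ K', K = K' + q := ⟨K - q, by omega⟩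
  -- expansions
  let t : ℕ → ℕ → ℝ := fun j l => (Ko P f ^ (m + j) * Lo P f) ((Uo P f ^ l) h) x y
  have hdec : ∀ N : ℕ, exi P f (2 * m + N) x y = (Ko P f ^ m) ((Uo P f ^ N) h) x y -
      ∑ j ∈ Finset.range N, t j (N - 1 - j) := by
    intro N
    have : exi P f (2 * m + N) = (Ko P f ^ (m + N)) h := by
      rw [hh, ← exi_add]; congr 1; omega
    rw [this, Ko_pow_decomp]
    simp only [LinearMap.sub_apply, LinearMap.sum_apply, Module.End.mul_apply, Pi.sub_apply, Finset.sum_apply, t]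
  have ht : ∀ j l, |t j l| ≤ s * e := fun j l => by
    refine (KL_abs hS (m + j) (hUs l) x y).trans ?_
    exact mul_le_mul_of_nonneg_left (he _ (by omega)) hs0
  have hmain : |(Ko P f ^ m) ((Uo P f ^ (K + k)) h) x y - (Ko P f ^ m) ((Uo P f ^ K) h) x y| ≤ B * surv P f m x y := by
    have := ((posK (f := f) hS).pow m).abs_le_const (h := (Uo P f ^ (K + k)) h - (Uo P f ^ K) h) (B := B) (hB K hq) x y
    rwa [map_sub] at this
  have hsum : |∑ j ∈ Finset.range K', (t j (K + k - 1 - j) - t j (K - 1 - j))| ≤ B * surv P f m x y := by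
    refine (Finset.abs_sum_le_sum_abs _ _).trans ?_
    have : ∀ j ∈ Finset.range K', |t j (K + k - 1 - j) - t j (K - 1 - j)| ≤ B * exi P f (m + j) x y := by
      intro j hj
      have hj' := Finset.mem_range.1 hj
      have e1 : K + k - 1 - j = (K - 1 - j) + k := by omega
      rw [e1]
      have := KL_abs hS (f := f) (m + j) (h := (Uo P f ^ ((K - 1 - j) + k)) h - (Uo P f ^ (K - 1 - j)) h) (B := B)
        (hB _ (by omega)) x y
      rwa [map_sub] at this
    refine (Finset.sum_le_sum this).trans ?_
    rw [← Finset.mul_sum, surv_sum_exi hS]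
    refine mul_le_mul_of_nonneg_left ?_ hB0
    linarith [surv_nonneg (f := f) hS (m + K') x y]
  have hr1 : |∑ j ∈ Finset.range (q + k), t (K' + j) (K + k - 1 - (K' + j))| ≤ (q + k) * (s * e) := by
    refine (Finset.abs_sum_le_sum_abs _ _).trans ((Finset.sum_le_card_nsmul _ _ (s * e) fun j _ => ht _ _).trans ?_)
    simp
  have hr2 : |∑ j ∈ Finset.range q, t (K' + j) (K - 1 - (K' + j))| ≤ q * (s * e) := by
    refine (Finset.abs_sum_le_sum_abs _ _).trans ((Finset.sum_le_card_nsmul _ _ (s * e) fun j _ => ht _ _).trans ?_)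
    simp
  rw [add_assoc (2 * m), hdec (K + k), hdec K]
  have s1 : ∑ j ∈ Finset.range (K + k), t j (K + k - 1 - j) = ∑ j ∈ Finset.range K', t j (K + k - 1 - j) +
      ∑ j ∈ Finset.range (q + k), t (K' + j) (K + k - 1 - (K' + j)) := by
    rw [← Finset.sum_range_add, show K' + (q + k) = K + k by omega]
  have s2 : ∑ j ∈ Finset.range K, t j (K - 1 - j) = ∑ j ∈ Finset.range K', t j (K - 1 - j) +
      ∑ j ∈ Finset.range q, t (K' + j) (K - 1 - (K' + j)) := by
    rw [← Finset.sum_range_add, show K' + q = K by omega]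
  rw [s1, s2]
  rw [Finset.sum_sub_distrib] at hsum
  rw [abs_le] at *
  constructor <;> linarith [hmain.1, hmain.2, hsum.1, hsum.2, hr1.1, hr1.2, hr2.1, hr2.2]

lemma exi_reg (hS : IsStochastic P ν) (h1 : Primitive P) (h2 : ∑ x, f x * ν x = 0)
    (h3 : NonLattice P f) (hD : DecD (dualK P ν) (fun b => -f b)) (hDp : DecD P f) (x : X) (y : ℝ) {ρ : ℝ} (hρ : 0 < ρ) :
    ∃ (ε : ℝ) (n0 : ℕ), 0 < ε ∧ 1 ≤ n0 ∧ ∀ n ≥ n0, ∀ k : ℕ, (k : ℝ) ≤ ε * n →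
      |exi P f (n + k) x y - exi P f n x y| ≤ ρ / (n * Real.sqrt n) := by
  obtain ⟨C, hC, hE⟩ := exi_sup hS h1 h2 h3 hD
  obtain ⟨C', hC', hE'⟩ := exi_rate hS h1 h2 h3 hD hDp y
  obtain ⟨Cy, hCy, hv⟩ := hDp y
  -- sqrt bounds with constants : 9 ≥ 3 * sqrt 3 etc
  obtain ⟨α, hα, hα2, hα3⟩ : ∃ α : ℝ, 0 < α ∧ α ≤ 1 / 3 ∧ 3 * α * (18 * C * C') ≤ ρ / 2 := by
    refine ⟨min (1 / 3) (ρ / 2 / (3 * (18 * C * C'))), by positivity, min_le_left _ _, ?_⟩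
    have : min (1 / 3) (ρ / 2 / (3 * (18 * C * C'))) * (3 * (18 * C * C')) ≤ ρ / 2 := by
      rw [← le_div_iff₀ (by positivity)]; exact min_le_right _ _
    linarith
  obtain ⟨ε, l0, hε, hl0, hU⟩ := U_reg hS h1 h2 h3 hD (η := ρ / 2 / (4 * Cy) * Real.sqrt (α / 12)) (by positivity)
  refine ⟨min α (ε * α / 2), max 6 (⌈2 * (l0 + 1) / α⌉₊), by positivity, le_max_of_le_left (by norm_num), fun n hn k hk => ?_⟩
  have hn6 : 6 ≤ n := (le_max_left _ _).trans hn
  have hn6' : (6 : ℝ) ≤ n := by exact_mod_cast hn6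
  have hn0 : (0 : ℝ) < n := by linarith
  have hnl : 2 * ((l0 : ℝ) + 1) / α ≤ n := (Nat.le_ceil _).trans (by exact_mod_cast (le_max_right _ _).trans hn)
  rw [div_le_iff₀ hα] at hnl
  set q := ⌊α * n⌋₊ with hq
  have hq1 : (q : ℝ) ≤ α * n := Nat.floor_le (by positivity)
  have hq2 : α * n < q + 1 := Nat.lt_floor_add_one _
  have hl0' : (1 : ℝ) ≤ l0 := by exact_mod_cast hl0
  have hq3 : α * n / 2 ≤ q := by nlinarith
  have hql : l0 ≤ q := by
    have : (l0 : ℝ) ≤ q := by nlinarith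
    exact_mod_cast this
  obtain ⟨m', hm'⟩ : ∃ m', n / 3 = m' + 1 := ⟨n / 3 - 1, by omega⟩
  set m := n / 3 with hm
  have hqK : q ≤ n - 2 * m := by
    have : (q : ℝ) ≤ n / 3 := by nlinarith
    have : (3 * q : ℝ) ≤ n := by linarith
    have : 3 * q ≤ n := by exact_mod_cast this
    omega
  have hm1 : (n : ℝ) / 3 ≤ m + 1 := by
    have : n ≤ 3 * (m + 1) := by omega
    have : (n : ℝ) ≤ 3 * (m + 1) := by exact_mod_cast this
    linarith
  have hm2 : (n : ℝ) / 6 ≤ m := by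
    have : n ≤ 6 * m := by omega
    have : (n : ℝ) ≤ 6 * m := by exact_mod_cast this
    linarith
  have hsq : Real.sqrt n / 2 ≤ Real.sqrt (m + 1) := by
    rw [div_le_iff₀ (by norm_num)]
    refine Real.sqrt_le_iff.2 ⟨by positivity, ?_⟩
    rw [mul_pow, Real.sq_sqrt (by positivity)]; linarith
  have key := reg_step (f := f) hS m (n - 2 * m) q k hqK x y (ρ / 2 / (4 * Cy) / n) (3 * C / n) (6 * C' / (n * Real.sqrt n))
    (fun l hl x y => ?_) (fun x y => ?_) (fun j hj => ?_)
  · rw [show 2 * m + (n - 2 * m) = n by omega] at key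
    refine key.trans ?_
    have e1 : surv P f m x y ≤ Cy / (Real.sqrt n / 2) := (hv m x).trans (by gcongr)
    have e2 : (2 * (q : ℝ) + k) ≤ 3 * α * n := by
      have : (min α (ε * α / 2)) * n ≤ α * n := mul_le_mul_of_nonneg_right (min_le_left _ _) hn0.le
      linarith
    calc _ ≤ 2 * (ρ / 2 / (4 * Cy) / n) * (Cy / (Real.sqrt n / 2)) + (3 * α * n) * (3 * C / n * (6 * C' / (n * Real.sqrt n))) := by
          gcongr
      _ = (ρ / 2 + 3 * α * (18 * C * C')) / (n * Real.sqrt n) := by field_simp; ring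
      _ ≤ ρ / (n * Real.sqrt n) := by gcongr; linarith
  · have hk' : (k : ℝ) ≤ ε * l := by
      have h1 : (min α (ε * α / 2)) * n ≤ (ε * α / 2) * n := mul_le_mul_of_nonneg_right (min_le_right _ _) hn0.le
      have h2 : (q : ℝ) ≤ l := by exact_mod_cast hl
      have h3 : ε * (α * n / 2) ≤ ε * l := mul_le_mul_of_nonneg_left (hq3.trans h2) hε.le
      linarith
    have h4 := hU l (hql.trans hl) k hk' m' x y
    rw [exi_eq_Fd, hm']
    refine h4.trans ?_
    have h5 : (m' : ℝ) + 1 = m := by rw [hm']; push_cast; ring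
    rw [h5]
    have h2 : (q : ℝ) ≤ l := by exact_mod_cast hl
    have h6 : Real.sqrt (α / 12) * n ≤ Real.sqrt l * Real.sqrt m := by
      rw [← Real.sqrt_mul (by positivity)]
      refine Real.le_sqrt_of_sq_le ?_
      rw [mul_pow, Real.sq_sqrt (by positivity)]
      calc α / 12 * (n : ℝ) ^ 2 = (α * n / 2) * (n / 6) := by ring
        _ ≤ l * m := by gcongr; linarith
    have h7 : 0 < Real.sqrt (α / 12) := by positivity
    calc _ ≤ ρ / 2 / (4 * Cy) * Real.sqrt (α / 12) / (Real.sqrt (α / 12) * n) := by gcongr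
      _ = _ := by field_simp
  · refine (hE m x y).trans ?_
    calc C / ((m : ℝ) + 1) ≤ C / (n / 3) := by gcongr
      _ = _ := by field_simp
  · refine (hE' j x).trans ?_
    have hj' : (m : ℝ) ≤ j := by exact_mod_cast hj
    have h8 : (n : ℝ) / 3 ≤ j + 1 := by linarith
    have h9 : Real.sqrt n / 2 ≤ Real.sqrt (j + 1) := hsq.trans (Real.sqrt_le_sqrt (by linarith))
    calc C' / (((j : ℝ) + 1) * Real.sqrt (j + 1)) ≤ C' / ((n / 3) * (Real.sqrt n / 2)) := by gcongr
      _ = _ := by field_simp; ring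
end

/-! ### Part 13 -/


lemma taub (u e : ℕ → ℝ) (h : ∀ a k, ∑ j ∈ range k, e (a + j) = u a - u (a + k)) (c : ℝ)
    (hu : Tendsto (fun n : ℕ => Real.sqrt n * u n) atTop (𝓝 c))
    (hreg : ∀ ρ : ℝ, 0 < ρ → ∃ (ε : ℝ) (n0 : ℕ), 0 < ε ∧ 1 ≤ n0 ∧ ∀ n ≥ n0, ∀ k : ℕ,
      (k : ℝ) ≤ ε * n → |e (n + k) - e n| ≤ ρ / (n * Real.sqrt n)) :
    Tendsto (fun n : ℕ => (n : ℝ) * Real.sqrt n * e n) atTop (𝓝 (c / 2)) := by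
  rw [Metric.tendsto_atTop]
  intro ρ hρ
  obtain ⟨ε0, n0, hε0, hn0, hr⟩ := hreg (ρ / 3) (by positivity)
  have hlim : Tendsto (fun s : ℝ => c * (1 / (Real.sqrt (1 + s) * (Real.sqrt (1 + s) + 1)))) (𝓝[>] 0) (𝓝 (c / 2)) := by
    have : ContinuousAt (fun s : ℝ => c * (1 / (Real.sqrt (1 + s) * (Real.sqrt (1 + s) + 1)))) 0 := by
      refine ContinuousAt.mul continuousAt_const (ContinuousAt.div continuousAt_const (by fun_prop) ?_)
      norm_num
    have h2 := this.tendsto.mono_left (nhdsWithin_le_nhds (s := Set.Ioi 0))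
    convert h2 using 2
    norm_num; ring
  obtain ⟨ε, hε1, hε, hεε⟩ : ∃ ε : ℝ, |c * (1 / (Real.sqrt (1 + ε) * (Real.sqrt (1 + ε) + 1))) - c / 2| < ρ / 3 ∧ 0 < ε ∧ ε < ε0 := by
    have e1 := (Metric.tendsto_nhds.1 hlim) (ρ / 3) (by positivity)
    have e2 : ∀ᶠ s : ℝ in 𝓝[>] 0, s ∈ Set.Ioo 0 ε0 := Ioo_mem_nhdsGT hε0
    obtain ⟨s, hs1, hs2⟩ := (e1.and e2).exists
    exact ⟨s, by simpa [Real.dist_eq] using hs1, hs2.1, hs2.2⟩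
  set k : ℕ → ℕ := fun n => ⌊ε * n⌋₊ with hk
  have hkn : Tendsto (fun n : ℕ => (k n : ℝ) / n) atTop (𝓝 ε) :=
    (tendsto_nat_floor_mul_div_atTop hε.le).comp tendsto_natCast_atTop_atTop
  have hnk : Tendsto (fun n : ℕ => (n : ℝ) / k n) atTop (𝓝 (1 / ε)) := by
    have := hkn.inv₀ hε.ne'
    simpa using this
  have hsub : Tendsto (fun n : ℕ => Real.sqrt ((n + k n : ℕ) : ℝ) * u (n + k n)) atTop (𝓝 c) :=
    hu.comp (tendsto_atTop_mono (fun n => Nat.le_add_right n (k n)) tendsto_id)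
  have hsq : Tendsto (fun n : ℕ => 1 / Real.sqrt (1 + (k n : ℝ) / n)) atTop (𝓝 (1 / Real.sqrt (1 + ε))) := by
    refine Tendsto.div tendsto_const_nhds ((Real.continuous_sqrt.tendsto _).comp (hkn.const_add 1)) ?_
    positivity
  have hmain : Tendsto (fun n : ℕ => (n : ℝ) / k n * (Real.sqrt n * u n - 1 / Real.sqrt (1 + (k n : ℝ) / n) *
      (Real.sqrt ((n + k n : ℕ) : ℝ) * u (n + k n)))) atTop (𝓝 (1 / ε * (c - 1 / Real.sqrt (1 + ε) * c))) :=
    hnk.mul (hu.sub (hsq.mul hsub))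
  have hval : 1 / ε * (c - 1 / Real.sqrt (1 + ε) * c) = c * (1 / (Real.sqrt (1 + ε) * (Real.sqrt (1 + ε) + 1))) := by
    have h1 : 0 < Real.sqrt (1 + ε) := by positivity
    have h2 : Real.sqrt (1 + ε) ^ 2 = 1 + ε := Real.sq_sqrt (by positivity)
    have h3 : ε = Real.sqrt (1 + ε) ^ 2 - 1 := by linarith
    have h4 : Real.sqrt (1 + ε) - 1 ≠ 0 := by
      intro h; have : Real.sqrt (1 + ε) = 1 := by linarith
      rw [this] at h2; linarith
    generalize hs : Real.sqrt (1 + ε) = s at *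
    rw [h3, show s ^ 2 - 1 = (s - 1) * (s + 1) by ring]
    field_simp
  rw [hval] at hmain
  obtain ⟨N, hN⟩ := (Metric.tendsto_atTop.1 hmain) (ρ / 3) (by positivity)
  obtain ⟨N1, hN1⟩ := exists_nat_ge (1 / ε)
  refine ⟨max (max N n0) N1, fun n hn => ?_⟩
  have hnN : N ≤ n := le_trans (le_max_left _ _) ((le_max_left _ _).trans hn)
  have hnn0 : n0 ≤ n := le_trans (le_max_right _ _) ((le_max_left _ _).trans hn)
  have hnN1 : N1 ≤ n := (le_max_right _ _).trans hn
  have hn1 : 0 < (n : ℝ) := by exact_mod_cast (by omega : 0 < n)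
  have hk1 : 1 ≤ k n := by
    rw [hk]; refine Nat.le_floor ?_
    have : 1 / ε ≤ n := hN1.trans (by exact_mod_cast hnN1)
    rw [div_le_iff₀ hε] at this; push_cast; linarith
  have hk0 : (0 : ℝ) < k n := by exact_mod_cast hk1
  have hkle : (k n : ℝ) ≤ ε * n := Nat.floor_le (by positivity)
  have hA := hN n hnN
  have hB : |(n : ℝ) * Real.sqrt n * e n - (n : ℝ) / k n * (Real.sqrt n * u n - 1 / Real.sqrt (1 + (k n : ℝ) / n) *
      (Real.sqrt ((n + k n : ℕ) : ℝ) * u (n + k n)))| ≤ ρ / 3 := by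
    have e1 : 1 / Real.sqrt (1 + (k n : ℝ) / n) * Real.sqrt ((n + k n : ℕ) : ℝ) = Real.sqrt n := by
      have : ((n + k n : ℕ) : ℝ) = (1 + (k n : ℝ) / n) * n := by push_cast; field_simp
      rw [this, Real.sqrt_mul (by positivity)]
      have : 0 < Real.sqrt (1 + (k n : ℝ) / n) := by positivity
      field_simp
    rw [← mul_assoc _ _ (u (n + k n)), e1, ← mul_sub, ← h n (k n)]
    have e2 : (n : ℝ) * Real.sqrt n * e n - (n : ℝ) / k n * (Real.sqrt n * ∑ j ∈ range (k n), e (n + j)) =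
        (n : ℝ) * Real.sqrt n / k n * ∑ j ∈ range (k n), (e n - e (n + j)) := by
      rw [Finset.sum_sub_distrib, Finset.sum_const, card_range, nsmul_eq_mul]
      field_simp
    rw [e2, abs_mul, abs_of_nonneg (by positivity)]
    have e3 : |∑ j ∈ range (k n), (e n - e (n + j))| ≤ k n * (ρ / 3 / (n * Real.sqrt n)) := by
      refine (Finset.abs_sum_le_sum_abs _ _).trans ?_
      calc _ ≤ ∑ j ∈ range (k n), ρ / 3 / (n * Real.sqrt n) := by
            refine Finset.sum_le_sum fun j hj => ?_
            rw [abs_sub_comm]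
            refine hr n hnn0 j ?_
            have : (j : ℝ) ≤ k n := by exact_mod_cast (Finset.mem_range.1 hj).le
            have : ε * n ≤ ε0 * n := by gcongr
            linarith
        _ = _ := by rw [Finset.sum_const, card_range, nsmul_eq_mul]
    calc _ ≤ (n : ℝ) * Real.sqrt n / k n * (k n * (ρ / 3 / (n * Real.sqrt n))) := by gcongr
      _ = ρ / 3 := by
        have : 0 < Real.sqrt (n : ℝ) := by positivity
        field_simp
  rw [Real.dist_eq] at hA ⊢
  have := abs_le.1 hB
  have := abs_lt.1 hA
  have := abs_lt.1 hε1
  rw [abs_lt]; constructor <;> linarith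

section
variable [Fintype X] [DecidableEq X] [Nonempty X] {P : X → X → ℝ} {ν f : X → ℝ}

lemma sqrt_surv_tendsto {s v : ℝ} (hs : 0 < s) (x : X) (y : ℝ)
    (hV : Tendsto (fun n : ℕ => s * Real.sqrt (2 * π * n) / 2 * surv P f n x y) atTop (𝓝 v)) :
    Tendsto (fun n : ℕ => Real.sqrt n * surv P f n x y) atTop (𝓝 (2 * v / (s * Real.sqrt (2 * π)))) := by
  have := hV.const_mul (2 / (s * Real.sqrt (2 * π)))
  have hp : 0 < Real.sqrt (2 * π) := by positivity
  convert this using 2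
  · rename_i n
    rw [Real.sqrt_mul (by positivity) (n : ℝ)]; field_simp
  · ring

lemma decD_of_tendsto (hS : IsStochastic P ν) {c : X → ℝ → ℝ}
    (h : ∀ x y, Tendsto (fun n : ℕ => Real.sqrt n * surv P f n x y) atTop (𝓝 (c x y))) : DecD P f := by
  intro z
  have hb : ∀ b, ∃ C, ∀ n : ℕ, Real.sqrt n * surv P f n b z ≤ C := by
    intro b
    obtain ⟨C, hC⟩ := (h b z).bddAbove_range
    exact ⟨C, fun n => hC ⟨n, rfl⟩⟩
  choose C hC using hb
  obtain ⟨B, hB0, hB⟩ := exists_bound C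
  refine ⟨B + 1, by positivity, fun n b => ?_⟩
  have h1 := (hC b n).trans ((le_abs_self _).trans (hB b))
  have h2 := surv_le_one (f := f) hS n b z
  have h0 := surv_nonneg (f := f) hS n b z
  rw [le_div_iff₀ (by positivity)]
  have h3 : Real.sqrt (n + 1) ≤ Real.sqrt n + 1 := by
    rw [Real.sqrt_le_left (by positivity)]
    have := Real.sq_sqrt (Nat.cast_nonneg (α := ℝ) n)
    nlinarith [Real.sqrt_nonneg (n : ℝ)]
  calc _ ≤ surv P f n b z * (Real.sqrt n + 1) := by gcongr
    _ ≤ _ := by linarith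

lemma exi_tendsto (hS : IsStochastic P ν) (h1 : Primitive P) (h2 : ∑ x, f x * ν x = 0)
    (h3 : NonLattice P f) {c cs : X → ℝ → ℝ}
    (h : ∀ x y, Tendsto (fun n : ℕ => Real.sqrt n * surv P f n x y) atTop (𝓝 (c x y)))
    (hs : ∀ x y, Tendsto (fun n : ℕ => Real.sqrt n * surv (dualK P ν) (fun b => -f b) n x y) atTop (𝓝 (cs x y)))
    (x : X) (y : ℝ) :
    Tendsto (fun n : ℕ => (n : ℝ) * Real.sqrt n * exi P f n x y) atTop (𝓝 (c x y / 2)) :=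
  taub (fun n => surv P f n x y) (fun n => exi P f n x y) (fun a k => surv_sum_exi hS a k x y) _ (h x y)
    (fun _ hρ => exi_reg hS h1 h2 h3 (decD_of_tendsto (dual_stoch hS) hs) (decD_of_tendsto hS h) x y hρ)
end

/-! ### Part 14 -/


lemma gam_half (s : ℝ) (hs : 0 < s) :
    IntegrableOn (fun t : ℝ => 1 / Real.sqrt t * Real.exp (-s * t)) (Set.Ioi 0) ∧
    ∫ t in Set.Ioi (0:ℝ), 1 / Real.sqrt t * Real.exp (-s * t) = Real.sqrt π / Real.sqrt s := by
  have e : ∀ t : ℝ, 0 < t → t ^ ((1/2 : ℝ) - 1) * Real.exp (-(s * t)) = 1 / Real.sqrt t * Real.exp (-s * t) := by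
    intro t ht
    rw [show (1/2 : ℝ) - 1 = -(1/2) by norm_num, Real.rpow_neg ht.le, ← Real.sqrt_eq_rpow]
    simp
  have h1 := Real.integral_rpow_mul_exp_neg_mul_Ioi (a := 1/2) (r := s) (by norm_num) hs
  rw [setIntegral_congr_fun measurableSet_Ioi (fun t ht => e t ht)] at h1
  rw [Real.Gamma_one_half_eq, ← Real.sqrt_eq_rpow, Real.sqrt_div zero_le_one, Real.sqrt_one] at h1
  have h2 : ∫ t in Set.Ioi (0:ℝ), 1 / Real.sqrt t * Real.exp (-s * t) = Real.sqrt π / Real.sqrt s := by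
    rw [h1]; ring
  refine ⟨?_, h2⟩
  by_contra hc
  rw [integral_undef hc] at h2
  have : 0 < Real.sqrt π / Real.sqrt s := by positivity
  linarith

lemma w_anti (s : ℝ) (hs : 0 < s) :
    AntitoneOn (fun t : ℝ => 1 / Real.sqrt (t + 1) * Real.exp (-s * t)) (Set.Ici 0) := by
  intro a ha b hb hab
  simp only [Set.mem_Ici] at ha hb
  show 1 / Real.sqrt (b + 1) * Real.exp (-s * b) ≤ 1 / Real.sqrt (a + 1) * Real.exp (-s * a)
  have h1 : 0 < Real.sqrt (a + 1) := by positivity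
  have h2 : Real.sqrt (a + 1) ≤ Real.sqrt (b + 1) := Real.sqrt_le_sqrt (by linarith)
  have h3 : Real.exp (-s * b) ≤ Real.exp (-s * a) := Real.exp_le_exp.2 (by nlinarith)
  gcongr

lemma w_int (s : ℝ) (hs : 0 < s) :
    IntegrableOn (fun t : ℝ => 1 / Real.sqrt (t + 1) * Real.exp (-s * t)) (Set.Ioi 0) := by
  refine (gam_half s hs).1.mono' ?_ ?_
  · exact (by fun_prop : Measurable (fun t : ℝ => 1 / Real.sqrt (t + 1) * Real.exp (-s * t))).aestronglyMeasurable
  · filter_upwards [ae_restrict_mem measurableSet_Ioi] with t ht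
    have ht : 0 < t := ht
    rw [Real.norm_of_nonneg (by positivity)]
    have : Real.sqrt t ≤ Real.sqrt (t + 1) := Real.sqrt_le_sqrt (by linarith)
    have : 0 < Real.sqrt t := by positivity
    gcongr

lemma w_summable (s : ℝ) (hs : 0 < s) :
    Summable (fun n : ℕ => 1 / Real.sqrt ((n:ℝ) + 1) * Real.exp (-s * n)) :=
  (w_anti s hs).summable_of_integrableOn_Ioi_zero (w_int s hs) (fun t ht => by
    have : (0:ℝ) < t := ht
    positivity)

lemma abel_bounds (s : ℝ) (hs : 0 < s) :
    Real.sqrt π / Real.sqrt s - 2 ≤ ∑' n : ℕ, 1 / Real.sqrt ((n:ℝ) + 1) * Real.exp (-s * n) ∧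
    ∑' n : ℕ, 1 / Real.sqrt ((n:ℝ) + 1) * Real.exp (-s * n) ≤ 1 + Real.sqrt π / Real.sqrt s := by
  have hnn : ∀ t ∈ Set.Ioi (0:ℝ), 0 ≤ (fun t : ℝ => 1 / Real.sqrt (t + 1) * Real.exp (-s * t)) t := by
    intro t ht
    have : (0:ℝ) < t := ht
    positivity
  have hle : ∀ t ∈ Set.Ioi (0:ℝ), 1 / Real.sqrt (t + 1) * Real.exp (-s * t) ≤ 1 / Real.sqrt t * Real.exp (-s * t) := by
    intro t ht
    have ht : 0 < t := ht
    have : Real.sqrt t ≤ Real.sqrt (t + 1) := Real.sqrt_le_sqrt (by linarith)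
    have : 0 < Real.sqrt t := by positivity
    gcongr
  obtain ⟨hi, hv⟩ := gam_half s hs
  constructor
  · have h1 := (w_anti s hs).integral_le_tsum (w_summable s hs) hnn
    refine le_trans ?_ h1
    rw [← hv]
    -- split the integral at one
    have hsub : Set.Ioi (1:ℝ) ⊆ Set.Ioi 0 := Set.Ioi_subset_Ioi zero_le_one
    have e1 : ∫ t in Set.Ioi (0:ℝ), 1 / Real.sqrt t * Real.exp (-s * t) =
        (∫ t in Set.Ioc (0:ℝ) 1, 1 / Real.sqrt t * Real.exp (-s * t)) + ∫ t in Set.Ioi (1:ℝ), 1 / Real.sqrt t * Real.exp (-s * t) := by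
      rw [← setIntegral_union (Set.Ioc_disjoint_Ioi le_rfl) measurableSet_Ioi (hi.mono_set Set.Ioc_subset_Ioi_self) (hi.mono_set hsub),
        Set.Ioc_union_Ioi_eq_Ioi zero_le_one]
    have e2 : ∫ t in Set.Ioc (0:ℝ) 1, 1 / Real.sqrt t * Real.exp (-s * t) ≤ 2 := by
      have hr : ∫ t in (0:ℝ)..1, t ^ (-(1/2) : ℝ) = 2 := by
        rw [integral_rpow (Or.inl (by norm_num))]; norm_num
      have hri : IntervalIntegrable (fun t : ℝ => t ^ (-(1/2) : ℝ)) volume 0 1 :=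
        intervalIntegral.intervalIntegrable_rpow' (by norm_num)
      rw [intervalIntegral.integral_of_le zero_le_one] at hr
      rw [← hr]
      refine setIntegral_mono_on (hi.mono_set Set.Ioc_subset_Ioi_self) ((intervalIntegrable_iff_integrableOn_Ioc_of_le zero_le_one).1 hri) measurableSet_Ioc ?_
      intro t ht
      rw [Real.rpow_neg ht.1.le, ← Real.sqrt_eq_rpow, ← one_div]
      have : Real.exp (-s * t) ≤ 1 := Real.exp_le_one_iff.2 (by nlinarith [ht.1])
      have h0 : 0 ≤ 1 / Real.sqrt t := by positivity
      nlinarith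
    have e3 : ∫ t in Set.Ioi (1:ℝ), 1 / Real.sqrt t * Real.exp (-s * t) ≤
        ∫ t in Set.Ioi (0:ℝ), 1 / Real.sqrt (t + 1) * Real.exp (-s * t) := by
      have := (measurePreserving_add_right (volume : Measure ℝ) 1).setIntegral_preimage_emb
        (Homeomorph.addRight (1:ℝ)).measurableEmbedding (fun t : ℝ => 1 / Real.sqrt t * Real.exp (-s * t)) (Set.Ioi 1)
      have hpre : (fun t : ℝ => t + 1) ⁻¹' (Set.Ioi 1) = Set.Ioi 0 := by ext t; simp
      rw [hpre] at this
      rw [← this]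
      refine integral_mono_of_nonneg ?_ (w_int s hs) ?_
      · filter_upwards [ae_restrict_mem measurableSet_Ioi] with t ht
        have : (0:ℝ) < t := ht
        simp only [Pi.zero_apply]; positivity
      · filter_upwards [ae_restrict_mem measurableSet_Ioi] with t ht
        have ht : (0:ℝ) < t := ht
        have : Real.exp (-s * (t + 1)) ≤ Real.exp (-s * t) := Real.exp_le_exp.2 (by nlinarith)
        show 1 / Real.sqrt (t + 1) * Real.exp (-s * (t + 1)) ≤ 1 / Real.sqrt (t + 1) * Real.exp (-s * t)
        gcongr
    linarith
  · have h1 := (w_anti s hs).tsum_le_integral (w_int s hs) hnn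
    have h2 := setIntegral_mono_on (w_int s hs) hi measurableSet_Ioi hle
    rw [hv] at h2
    simp only [zero_add, Real.sqrt_one, mul_zero, Real.exp_zero] at h1
    linarith

lemma abel_base : Tendsto (fun s : ℝ => Real.sqrt s * ∑' n : ℕ, 1 / Real.sqrt ((n:ℝ) + 1) * Real.exp (-s * n))
    (𝓝[>] 0) (𝓝 (Real.sqrt π)) := by
  have hs0 : Tendsto (fun s : ℝ => Real.sqrt s) (𝓝[>] 0) (𝓝 0) := by
    have := (Real.continuous_sqrt.tendsto 0).mono_left (nhdsWithin_le_nhds (s := Set.Ioi 0))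
    simpa using this
  have hl : Tendsto (fun s : ℝ => Real.sqrt π - 2 * Real.sqrt s) (𝓝[>] 0) (𝓝 (Real.sqrt π)) := by
    simpa using (hs0.const_mul 2).const_sub (Real.sqrt π)
  have hu : Tendsto (fun s : ℝ => Real.sqrt s + Real.sqrt π) (𝓝[>] 0) (𝓝 (Real.sqrt π)) := by
    simpa using hs0.add_const (Real.sqrt π)
  refine tendsto_of_tendsto_of_tendsto_of_le_of_le' hl hu ?_ ?_
  · filter_upwards [self_mem_nhdsWithin] with s hs
    have hs : 0 < s := hs
    have h := (abel_bounds s hs).1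
    have hp : 0 < Real.sqrt s := by positivity
    calc _ = Real.sqrt s * (Real.sqrt π / Real.sqrt s - 2) := by field_simp
      _ ≤ _ := by gcongr
  · filter_upwards [self_mem_nhdsWithin] with s hs
    have hs : 0 < s := hs
    have h := (abel_bounds s hs).2
    have hp : 0 < Real.sqrt s := by positivity
    calc _ ≤ Real.sqrt s * (1 + Real.sqrt π / Real.sqrt s) := by gcongr
      _ = _ := by field_simp

lemma summable_bdd_exp (u : ℕ → ℝ) (B : ℝ) (hB : ∀ n, |u n| ≤ B) (s : ℝ) (hs : 0 < s) :
    Summable (fun n : ℕ => u n * Real.exp (-s * n)) := by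
  have hg : Summable (fun n : ℕ => B * Real.exp (-s) ^ n) :=
    (summable_geometric_of_lt_one (Real.exp_nonneg _) (by rw [Real.exp_lt_one_iff]; linarith)).mul_left B
  refine hg.of_norm_bounded fun n => ?_
  rw [Real.norm_eq_abs, abs_mul, abs_of_pos (Real.exp_pos _), ← Real.exp_nat_mul, mul_comm (n:ℝ)]
  gcongr; exact hB n

lemma abel (u : ℕ → ℝ) (B : ℝ) (hB : ∀ n, |u n| ≤ B) (c : ℝ)
    (hu : Tendsto (fun n : ℕ => Real.sqrt n * u n) atTop (𝓝 c)) :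
    Tendsto (fun s : ℝ => Real.sqrt s * ∑' n : ℕ, u n * Real.exp (-s * n)) (𝓝[>] 0) (𝓝 (c * Real.sqrt π)) := by
  set w : ℕ → ℝ := fun n => 1 / Real.sqrt ((n:ℝ) + 1) with hw
  have hw1 : ∀ n, |w n| ≤ 1 := fun n => by
    rw [hw]; simp only
    rw [abs_of_nonneg (by positivity), div_le_one (by positivity)]
    exact Real.one_le_sqrt.2 (by linarith [Nat.cast_nonneg (α := ℝ) n])
  have hratio : Tendsto (fun n : ℕ => Real.sqrt ((n:ℝ) + 1) / Real.sqrt n) atTop (𝓝 1) := by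
    have h1 : Tendsto (fun n : ℕ => Real.sqrt (1 + 1 / (n:ℝ))) atTop (𝓝 1) := by
      have := (Real.continuous_sqrt.tendsto _).comp ((tendsto_one_div_atTop_nhds_zero_nat (𝕜 := ℝ)).const_add 1)
      simp only [add_zero, Real.sqrt_one] at this
      exact this
    refine h1.congr' ?_
    filter_upwards [eventually_gt_atTop 0] with n hn
    have : (0:ℝ) < n := by exact_mod_cast hn
    rw [← Real.sqrt_div (by positivity)]
    congr 1; field_simp
  have hd : Tendsto (fun n : ℕ => Real.sqrt ((n:ℝ) + 1) * (u n - c * w n)) atTop (𝓝 0) := by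
    have h1 := (hratio.mul hu).sub_const c
    rw [one_mul, sub_self] at h1
    refine h1.congr' ?_
    filter_upwards [eventually_gt_atTop 0] with n hn
    have : (0:ℝ) < n := by exact_mod_cast hn
    have : 0 < Real.sqrt (n:ℝ) := by positivity
    have : 0 < Real.sqrt ((n:ℝ) + 1) := by positivity
    simp only [hw]; field_simp
  have hzero : Tendsto (fun s : ℝ => Real.sqrt s * ∑' n : ℕ, (u n - c * w n) * Real.exp (-s * n)) (𝓝[>] 0) (𝓝 0) := by
    rw [Metric.tendsto_nhds]
    intro ρ hρ
    set δ := ρ / (2 * (Real.sqrt π + 1)) with hδ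
    have hδ0 : 0 < δ := by positivity
    obtain ⟨N, hN⟩ := (Metric.tendsto_atTop.1 hd) δ hδ0
    set D := B + |c| with hD
    have hdD : ∀ n, |u n - c * w n| ≤ D := fun n => by
      refine (abs_sub _ _).trans (add_le_add (hB n) ?_)
      rw [abs_mul]; nlinarith [abs_nonneg c, hw1 n]
    have hD0 : 0 ≤ D := (abs_nonneg _).trans (hdD 0)
    have hdb : ∀ n, |u n - c * w n| ≤ δ * w n + (if n ∈ Finset.range N then D else 0) := by
      intro n
      have hwn : 0 ≤ w n := by simp only [hw]; positivity
      by_cases hn : n < N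
      · rw [if_pos (Finset.mem_range.2 hn)]
        have := hdD n; nlinarith
      · rw [if_neg (by simpa using hn), add_zero]
        have := hN n (not_lt.1 hn)
        rw [Real.dist_eq, sub_zero, abs_mul, abs_of_nonneg (by positivity)] at this
        simp only [hw] at this ⊢
        have hq : 0 < Real.sqrt ((n:ℝ) + 1) := by positivity
        rw [mul_one_div δ, le_div_iff₀ hq, mul_comm]; exact this.le
    have hsq : Tendsto (fun s : ℝ => Real.sqrt s) (𝓝[>] 0) (𝓝 0) := by
      have := (Real.continuous_sqrt.tendsto 0).mono_left (nhdsWithin_le_nhds (s := Set.Ioi 0))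
      simpa using this
    have hlim : Tendsto (fun s : ℝ => δ * (Real.sqrt s * ∑' n : ℕ, w n * Real.exp (-s * n)) + Real.sqrt s * (N * D)) (𝓝[>] 0)
        (𝓝 (δ * Real.sqrt π + 0 * (N * D))) := (abel_base.const_mul δ).add (hsq.mul_const _)
    have hlt : δ * Real.sqrt π + 0 * (N * D) < ρ := by
      have : δ * (Real.sqrt π + 1) = ρ / 2 := by rw [hδ]; field_simp
      nlinarith
    filter_upwards [hlim.eventually_lt_const hlt, self_mem_nhdsWithin] with s hs hs0
    have hs0 : 0 < s := hs0
    rw [Real.dist_eq, sub_zero]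
    refine lt_of_le_of_lt ?_ hs
    rw [abs_mul, abs_of_nonneg (Real.sqrt_nonneg _)]
    have hsw := summable_bdd_exp w 1 hw1 s hs0
    have hfin : HasSum (fun n : ℕ => if n ∈ Finset.range N then D else 0) (∑ n ∈ Finset.range N, D) := by
      have := hasSum_sum_of_ne_finset_zero (L := SummationFilter.unconditional ℕ) (f := fun n : ℕ => if n ∈ Finset.range N then D else 0) (s := Finset.range N) (fun n hn => if_neg hn)
      rwa [Finset.sum_congr rfl (fun n hn => if_pos hn)] at this
    have hb2 : HasSum (fun n : ℕ => δ * (w n * Real.exp (-s * n)) + (if n ∈ Finset.range N then D else 0))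
      (δ * (∑' n : ℕ, w n * Real.exp (-s * n)) + N * D) := by
      have := (hsw.hasSum.mul_left δ).add hfin
      simpa using this
    have hle : |∑' n : ℕ, (u n - c * w n) * Real.exp (-s * n)| ≤ δ * (∑' n : ℕ, w n * Real.exp (-s * n)) + N * D := by
      rw [← Real.norm_eq_abs]
      refine tsum_of_norm_bounded hb2 fun n => ?_
      rw [Real.norm_eq_abs, abs_mul, abs_of_pos (Real.exp_pos _)]
      have he1 : Real.exp (-s * n) ≤ 1 := Real.exp_le_one_iff.2 (by nlinarith [Nat.cast_nonneg (α := ℝ) n])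
      have he0 : 0 < Real.exp (-s * n) := Real.exp_pos _
      have hif : 0 ≤ (if n ∈ Finset.range N then D else 0) := by split_ifs <;> linarith
      calc _ ≤ (δ * w n + (if n ∈ Finset.range N then D else 0)) * Real.exp (-s * n) := by gcongr; exact hdb n
        _ ≤ _ := by rw [add_mul]; nlinarith
    calc _ ≤ Real.sqrt s * (δ * (∑' n : ℕ, w n * Real.exp (-s * n)) + N * D) := by gcongr
      _ = _ := by ring
  have hfinal := hzero.add (abel_base.const_mul c)
  rw [zero_add] at hfinal
  refine hfinal.congr' ?_
  filter_upwards [self_mem_nhdsWithin] with s hs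
  have hs : 0 < s := hs
  have h1 := summable_bdd_exp u B hB s hs
  have h2 := summable_bdd_exp w 1 hw1 s hs
  have e : ∑' n : ℕ, (u n - c * w n) * Real.exp (-s * n) = (∑' n : ℕ, u n * Real.exp (-s * n)) - c * ∑' n : ℕ, w n * Real.exp (-s * n) := by
    rw [← tsum_mul_left, ← (h1.tsum_sub (h2.mul_left c))]
    refine tsum_congr fun n => by ring
  rw [e]; simp only [hw]; ring

/-! ### Part 15 -/


lemma slope_exp (a : ℝ) : Tendsto (fun l : ℝ => (1 - Real.exp (-l * a)) / l) (𝓝[>] 0) (𝓝 a) := by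
  have hd : HasDerivAt (fun l : ℝ => 1 - Real.exp (-l * a)) a 0 := by
    have := (((hasDerivAt_id (0:ℝ)).neg.mul_const a).exp).const_sub 1
    simpa using this
  have := hd.tendsto_slope_zero_right
  refine this.congr fun l => ?_
  simp [div_eq_inv_mul]

lemma H_lim (u : ℕ → ℝ) (B : ℝ) (hB : ∀ n, |u n| ≤ B) (c σ2 κ : ℝ) (hσ : 0 < σ2)
    (hu : Tendsto (fun n : ℕ => Real.sqrt n * u n) atTop (𝓝 c)) :
    (∀ᶠ l : ℝ in 𝓝[>] 0, 0 < Real.log (1 + σ2 / 2 * l ^ 2 + κ * l ^ 3) ∧ 1 < 1 + σ2 / 2 * l ^ 2 + κ * l ^ 3) ∧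
    Tendsto (fun l : ℝ => (1 - Real.exp (- Real.log (1 + σ2 / 2 * l ^ 2 + κ * l ^ 3))) *
      (∑' n : ℕ, u n * Real.exp (- Real.log (1 + σ2 / 2 * l ^ 2 + κ * l ^ 3) * n)) / l) (𝓝[>] 0)
      (𝓝 (Real.sqrt σ2 * Real.sqrt (2 * π) / 2 * c)) := by
  set t : ℝ → ℝ := fun l => σ2 / 2 * l ^ 2 + κ * l ^ 3 with ht
  have hid : Tendsto (fun l : ℝ => l) (𝓝[>] 0) (𝓝 0) := nhdsWithin_le_nhds
  have hl0 : ∀ᶠ l : ℝ in 𝓝[>] 0, 0 < l := self_mem_nhdsWithin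
  have htl : Tendsto (fun l => t l / l ^ 2) (𝓝[>] 0) (𝓝 (σ2 / 2)) := by
    have h1 : Tendsto (fun l : ℝ => σ2 / 2 + κ * l) (𝓝[>] 0) (𝓝 (σ2 / 2)) := by
      simpa using (hid.const_mul κ).const_add (σ2 / 2)
    refine h1.congr' ?_
    filter_upwards [hl0] with l hl
    simp only [ht]; field_simp
  have htpos : ∀ᶠ l : ℝ in 𝓝[>] 0, 0 < t l := by
    filter_upwards [htl.eventually_const_lt (by positivity : (0:ℝ) < σ2 / 2), hl0] with l hl h0
    have := mul_pos hl (by positivity : 0 < l ^ 2)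
    rwa [div_mul_cancel₀ _ (by positivity)] at this
  have ht0 : Tendsto t (𝓝[>] 0) (𝓝[>] 0) := by
    rw [tendsto_nhdsWithin_iff]
    refine ⟨?_, htpos⟩
    have : Continuous t := by fun_prop
    have h2 := (this.tendsto 0).mono_left (nhdsWithin_le_nhds (s := Set.Ioi 0))
    simpa [ht] using h2
  set s : ℝ → ℝ := fun l => Real.log (1 + t l) with hs
  have hse : ∀ l, Real.log (1 + σ2 / 2 * l ^ 2 + κ * l ^ 3) = s l := fun l => by simp only [hs, ht]; ring_nf
  have hspos : ∀ᶠ l : ℝ in 𝓝[>] 0, 0 < s l := by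
    filter_upwards [htpos] with l hl
    exact Real.log_pos (by linarith)
  have hlog : Tendsto (fun x : ℝ => Real.log (1 + x) / x) (𝓝[>] 0) (𝓝 1) := by
    have := (Real.hasDerivAt_log one_ne_zero).tendsto_slope_zero_right
    simp only [inv_one] at this
    refine this.congr fun l => ?_
    simp [div_eq_inv_mul]
  have hsl : Tendsto (fun l => s l / l ^ 2) (𝓝[>] 0) (𝓝 (σ2 / 2)) := by
    have h1 := (hlog.comp ht0).mul htl
    rw [one_mul] at h1
    refine h1.congr' ?_
    filter_upwards [htpos] with l hl
    simp only [Function.comp, hs]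
    field_simp
  have hs0 : Tendsto s (𝓝[>] 0) (𝓝[>] 0) := by
    rw [tendsto_nhdsWithin_iff]
    refine ⟨?_, hspos⟩
    have h1 := hsl.mul (hid.pow 2)
    rw [show σ2 / 2 * 0 ^ 2 = 0 by ring] at h1
    refine h1.congr' ?_
    filter_upwards [hl0] with l hl
    field_simp
  refine ⟨?_, ?_⟩
  · filter_upwards [hspos, htpos] with l h1 h2
    rw [hse]; refine ⟨h1, ?_⟩
    simp only [ht] at h2; linarith
  simp only [hse]
  have hG := (abel u B hB c hu).comp hs0
  have hE := (slope_exp 1).comp hs0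
  have hsq : Tendsto (fun l => Real.sqrt (s l / l ^ 2)) (𝓝[>] 0) (𝓝 (Real.sqrt (σ2 / 2))) :=
    (Real.continuous_sqrt.tendsto _).comp hsl
  have hall := (hE.mul hG).mul hsq
  have hv : 1 * (c * Real.sqrt π) * Real.sqrt (σ2 / 2) = Real.sqrt σ2 * Real.sqrt (2 * π) / 2 * c := by
    rw [Real.sqrt_div hσ.le, Real.sqrt_mul (by norm_num)]
    have h2 : Real.sqrt 2 * Real.sqrt 2 = 2 := Real.mul_self_sqrt (by norm_num)
    have h3 : 0 < Real.sqrt 2 := by positivity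
    field_simp
    linear_combination (-c) * h2
  rw [hv] at hall
  refine hall.congr' ?_
  filter_upwards [hl0, hspos] with l hl hsp
  simp only [Function.comp, mul_one]
  rw [Real.sqrt_div hsp.le, Real.sqrt_sq hl.le]
  have h4 : Real.sqrt (s l) * Real.sqrt (s l) = s l := Real.mul_self_sqrt hsp.le
  have h5 : s l ≠ 0 := hsp.ne'
  generalize (∑' n : ℕ, u n * Real.exp (- s l * n)) = G
  calc _ = (1 - Real.exp (-s l)) * G * (Real.sqrt (s l) * Real.sqrt (s l)) / (s l * l) := by
        field_simp
    _ = _ := by rw [h4]; field_simp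

section
variable [Fintype X] [DecidableEq X] [Nonempty X] {P : X → X → ℝ} {ν f : X → ℝ}

noncomputable def Bq (P : X → X → ℝ) (f : X → ℝ) (q : ℝ) (n : ℕ) : X → ℝ → ℝ :=
  1 - (1 - q) • ∑ j ∈ range n, q ^ j • surv P f j

lemma Bq_apply (q : ℝ) (n : ℕ) (x : X) (y : ℝ) :
    Bq P f q n x y = 1 - (1 - q) * ∑ j ∈ range n, q ^ j * surv P f j x y := by
  simp [Bq, Finset.sum_apply]

lemma Lo_one (hS : IsStochastic P ν) : Lo P f 1 = 1 - Ko P f 1 := by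
  have := congrArg (fun A => A 1) (Ko_add_Lo (P := P) (f := f))
  simp only [LinearMap.add_apply, Uo_one hS] at this
  exact eq_sub_of_add_eq' this

lemma Bq_succ (hS : IsStochastic P ν) (q : ℝ) (n : ℕ) :
    Bq P f q (n + 1) = q • (Lo P f 1 + Ko P f (Bq P f q n)) := by
  have h1 : Ko P f (Bq P f q n) = Ko P f 1 - (1 - q) • ∑ j ∈ range n, q ^ j • surv P f (j + 1) := by
    unfold Bq
    rw [map_sub, map_smul, map_sum]
    congr 2
    refine Finset.sum_congr rfl fun j _ => ?_
    rw [map_smul, surv_succ]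
  rw [h1, Lo_one hS]
  funext x y
  rw [Bq_apply, Finset.sum_range_succ']
  simp only [surv_zero, Pi.smul_apply, Pi.add_apply, Pi.sub_apply, Pi.one_apply, smul_eq_mul, Finset.sum_apply]
  have : ∑ j ∈ range n, q ^ (j + 1) * surv P f (j + 1) x y = q * ∑ j ∈ range n, q ^ j * surv P f (j + 1) x y := by
    rw [Finset.mul_sum]; exact Finset.sum_congr rfl fun j _ => by ring
  rw [this]; ring

lemma Uo_split (Ψ : X → ℝ → ℝ) : Uo P f Ψ = Lo P f Ψ + Ko P f Ψ := by
  rw [← Ko_add_Lo]; simp [add_comm]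

lemma lap_lower (hS : IsStochastic P ν) {q m : ℝ} (hq : 0 ≤ q) (hm : 0 ≤ m) (Ψ : X → ℝ → ℝ)
    (hΨ : ∀ x y, q * Uo P f Ψ x y ≤ Ψ x y) (h0 : ∀ x y, 0 ≤ Ψ x y)
    (hL : ∀ x y, y ≤ 0 → m ≤ Ψ x y) (n : ℕ) (x : X) (y : ℝ) :
    m * (Bq P f q n x y - q ^ n * surv P f n x y) ≤ Ψ x y := by
  induction n generalizing x y with
  | zero => simp [Bq, surv_zero, h0 x y]
  | succ n ih =>
    refine le_trans ?_ (hΨ x y)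
    have e : Bq P f q (n+1) - q ^ (n+1) • surv P f (n+1) = q • (Lo P f 1 + Ko P f (Bq P f q n - q ^ n • surv P f n)) := by
      rw [Bq_succ hS, map_sub, map_smul, ← surv_succ]
      funext x y; simp; ring
    have e2 := congrFun (congrFun e x) y
    simp only [Pi.sub_apply, Pi.smul_apply, smul_eq_mul, Pi.add_apply] at e2
    rw [e2, Uo_split, Pi.add_apply, Pi.add_apply, mul_left_comm]
    refine mul_le_mul_of_nonneg_left ?_ hq
    rw [mul_add]
    refine add_le_add ?_ ?_
    · rw [Lo_apply, Lo_apply, Finset.mul_sum]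
      refine Finset.sum_le_sum fun b _ => ?_
      rw [mul_left_comm]
      refine mul_le_mul_of_nonneg_left ?_ (hS.nonneg _ _)
      by_cases hb : y + f b ≤ 0
      · rw [ind_true hb]; simpa using hL b _ hb
      · rw [ind_false hb]; simp
    · have := posK (f := f) hS (m • (Bq P f q n - q ^ n • surv P f n)) Ψ (fun x y => by simpa using ih x y) x y
      rw [map_smul] at this
      simpa using this

lemma lap_upper (hS : IsStochastic P ν) {q m M : ℝ} (hq : 0 ≤ q) (hM : ∀ b, |f b| ≤ M) (Ψ : X → ℝ → ℝ)
    (hΨ : ∀ x y, Ψ x y ≤ q * Uo P f Ψ x y)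
    (hL : ∀ x y, -M ≤ y → Ψ x y ≤ m) (n : ℕ) (x : X) (y : ℝ) (hy : 0 < y) :
    Ψ x y ≤ m * Bq P f q n x y := by
  induction n generalizing x y with
  | zero =>
    simp only [Bq, range_zero, sum_empty, smul_zero, sub_zero, Pi.one_apply, mul_one]
    exact hL x y (by linarith [(abs_nonneg _).trans (hM x)])
  | succ n ih =>
    refine (hΨ x y).trans ?_
    rw [Bq_succ hS, Uo_split, Pi.add_apply, Pi.add_apply]
    simp only [Pi.smul_apply, Pi.add_apply, smul_eq_mul]
    rw [mul_left_comm]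
    refine mul_le_mul_of_nonneg_left ?_ hq
    rw [mul_add]
    refine add_le_add ?_ ?_
    · rw [Lo_apply, Lo_apply, Finset.mul_sum]
      refine Finset.sum_le_sum fun b _ => ?_
      rw [mul_left_comm m]
      refine mul_le_mul_of_nonneg_left ?_ (hS.nonneg _ _)
      by_cases hb : y + f b ≤ 0
      · rw [ind_true hb]; simpa using hL b _ (by linarith [(abs_le.1 (hM b)).1])
      · rw [ind_false hb]; simp
    · rw [Ko_apply, Ko_apply, Finset.mul_sum]
      refine Finset.sum_le_sum fun b _ => ?_
      rw [mul_left_comm m]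
      refine mul_le_mul_of_nonneg_left ?_ (hS.nonneg _ _)
      by_cases hb : 0 < y + f b
      · rw [ind_true hb, one_mul, one_mul]; exact ih b _ hb
      · rw [ind_false hb]; simp

lemma Bq_lim (hS : IsStochastic P ν) {s : ℝ} (hs : 0 < s) (x : X) (y : ℝ) :
    Tendsto (fun n => Bq P f (Real.exp (-s)) n x y) atTop
      (𝓝 (1 - (1 - Real.exp (-s)) * ∑' n : ℕ, surv P f n x y * Real.exp (-s * n))) ∧
    Tendsto (fun n => Real.exp (-s) ^ n * surv P f n x y) atTop (𝓝 0) := by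
  have hsum := summable_bdd_exp (fun n => surv P f n x y) 1 (fun n => by
    rw [abs_of_nonneg (surv_nonneg hS n x y)]; exact surv_le_one hS n x y) s hs
  have he : ∀ n : ℕ, Real.exp (-s) ^ n * surv P f n x y = surv P f n x y * Real.exp (-s * n) := fun n => by
    rw [← Real.exp_nat_mul, mul_comm (n:ℝ), mul_comm]
  refine ⟨?_, ?_⟩
  · simp only [Bq_apply, he]
    exact (hsum.hasSum.tendsto_sum_nat.const_mul _).const_sub 1
  · simp only [he]; exact hsum.tendsto_atTop_zero
end

/-! ### Part 16 -/

section
variable [Fintype X] [DecidableEq X] [Nonempty X] {P : X → X → ℝ} {ν f : X → ℝ}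

lemma real_aeig (hS : IsStochastic P ν) (h1 : Primitive P) (h2 : ∑ x, f x * ν x = 0) :
    ∃ (r b : X → ℝ) (C : ℝ), 0 < C ∧ ∀ l : ℝ, 0 ≤ l → l ≤ 1 → ∀ x,
      |∑ c, P x c * ((1 - l * r c + l ^ 2 * b c) * Real.exp (-l * f c)) -
        (1 + sigma2 P ν f / 2 * l ^ 2) * (1 - l * r x + l ^ 2 * b x)| ≤ C * l ^ 3 := by
  obtain ⟨r, b, C, hC, h⟩ := exists_aeig hS h1 h2
  refine ⟨r, b, C, hC, fun l hl0 hl x => ?_⟩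
  have hn : ‖(l:ℂ)‖ = l := by rw [Complex.norm_real, Real.norm_of_nonneg hl0]
  have := h (l:ℂ) (by rw [hn]; exact hl) x
  rw [hn] at this
  rw [← Real.norm_eq_abs, ← Complex.norm_real]
  convert this using 2
  unfold aeig
  push_cast
  rfl

lemma V_bound (hS : IsStochastic P ν) (h1 : Primitive P) (h2 : ∑ x, f x * ν x = 0)
    (hσ : 0 < sigma2 P ν f) {c : X → ℝ → ℝ}
    (h : ∀ x y, Tendsto (fun n : ℕ => Real.sqrt n * surv P f n x y) atTop (𝓝 (c x y))) :
    ∃ C : ℝ, ∀ x y, 0 < y →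
      |Real.sqrt (sigma2 P ν f) * Real.sqrt (2 * π) / 2 * c x y - y| ≤ C := by
  obtain ⟨r, b, C, hC, hae⟩ := real_aeig hS h1 h2
  obtain ⟨R, hR0, hR⟩ := exists_bound r
  obtain ⟨B, hB0, hB⟩ := exists_bound b
  obtain ⟨M, hM0, hM⟩ := exists_bound f
  set σ2 := sigma2 P ν f with hσ2
  set A := R + B with hA
  have hA0 : 0 < A := by positivity
  refine ⟨A + M + R, fun x y hy => ?_⟩
  set v := Real.sqrt σ2 * Real.sqrt (2 * π) / 2 * c x y with hv
  set a : ℝ → X → ℝ := fun l x => 1 - l * r x + l ^ 2 * b x with ha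
  have hab : ∀ l : ℝ, 0 ≤ l → l ≤ 1 → ∀ x, |a l x - 1| ≤ A * l := by
    intro l hl0 hl x
    have e : a l x - 1 = l * (- r x + l * b x) := by simp only [ha]; ring
    rw [e, abs_mul, abs_of_nonneg hl0, mul_comm]
    refine mul_le_mul_of_nonneg_right ?_ hl0
    refine (abs_add_le _ _).trans (add_le_add (by rw [abs_neg]; exact hR x) ?_)
    rw [abs_mul, abs_of_nonneg hl0]
    calc l * |b x| ≤ 1 * B := mul_le_mul hl (hB x) (abs_nonneg _) zero_le_one
      _ = B := one_mul B
  set Ψ : ℝ → X → ℝ → ℝ := fun l x y => a l x * Real.exp (-l * y) with hΨ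
  have hbd : ∀ n, |surv P f n x y| ≤ 1 := fun n => by
    rw [abs_of_nonneg (surv_nonneg hS n x y)]; exact surv_le_one hS n x y
  obtain ⟨evp, limp⟩ := H_lim (fun n => surv P f n x y) 1 hbd (c x y) σ2 (2 * C) hσ (h x y)
  obtain ⟨evm, limm⟩ := H_lim (fun n => surv P f n x y) 1 hbd (c x y) σ2 (-(2 * C)) hσ (h x y)
  rw [← hv] at limp limm
  set Hp : ℝ → ℝ := fun l => (1 - Real.exp (- Real.log (1 + σ2 / 2 * l ^ 2 + 2 * C * l ^ 3))) *
      (∑' n : ℕ, surv P f n x y * Real.exp (- Real.log (1 + σ2 / 2 * l ^ 2 + 2 * C * l ^ 3) * n)) with hHp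
  set Hm : ℝ → ℝ := fun l => (1 - Real.exp (- Real.log (1 + σ2 / 2 * l ^ 2 + -(2 * C) * l ^ 3))) *
      (∑' n : ℕ, surv P f n x y * Real.exp (- Real.log (1 + σ2 / 2 * l ^ 2 + -(2 * C) * l ^ 3) * n)) with hHm
  have hid : Tendsto (fun l : ℝ => l) (𝓝[>] 0) (𝓝 0) := nhdsWithin_le_nhds
  have hl0 : ∀ᶠ l : ℝ in 𝓝[>] 0, 0 < l := self_mem_nhdsWithin
  have hl1 : ∀ᶠ l : ℝ in 𝓝[>] 0, l < 1 := hid.eventually_lt_const zero_lt_one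
  have hlA : ∀ᶠ l : ℝ in 𝓝[>] 0, l < 1 / (2 * A) := hid.eventually_lt_const (by positivity)
  -- basic estimates for small positive parameter
  have hbasic : ∀ l : ℝ, 0 < l → l < 1 → l < 1 / (2 * A) →
      (∀ x, 1 / 2 ≤ a l x) ∧ ∀ x y, |Uo P f (Ψ l) x y - (1 + σ2 / 2 * l ^ 2) * Ψ l x y| ≤ 2 * C * l ^ 3 * Ψ l x y := by
    intro l hl hl1 hlA
    have hlA' : A * l ≤ 1 / 2 := by
      rw [lt_div_iff₀ (by positivity)] at hlA; linarith
    have hahalf : ∀ x, 1 / 2 ≤ a l x := fun x => by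
      have := (abs_le.1 (hab l hl.le hl1.le x)).1; linarith
    refine ⟨hahalf, fun x y => ?_⟩
    have e : Uo P f (Ψ l) x y - (1 + σ2 / 2 * l ^ 2) * Ψ l x y = (∑ c, P x c * ((1 - l * r c + l ^ 2 * b c) * Real.exp (-l * f c)) -
        (1 + sigma2 P ν f / 2 * l ^ 2) * (1 - l * r x + l ^ 2 * b x)) * Real.exp (-l * y) := by
      rw [Uo_apply, sub_mul, Finset.sum_mul]
      simp only [hΨ, ha]
      congr 1
      · refine Finset.sum_congr rfl fun d _ => ?_
        rw [mul_add, Real.exp_add]; ring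
      · ring
    rw [e, abs_mul, abs_of_pos (Real.exp_pos _)]
    have h4 := hae l hl.le hl1.le x
    calc _ ≤ C * l ^ 3 * Real.exp (-l * y) := by gcongr
      _ = 2 * C * l ^ 3 * (1 / 2 * Real.exp (-l * y)) := by ring
      _ ≤ 2 * C * l ^ 3 * (a l x * Real.exp (-l * y)) := by gcongr; exact hahalf x
  have hlow : ∀ᶠ l : ℝ in 𝓝[>] 0, (1 - A * l) * (1 - Hp l) ≤ a l x * Real.exp (-l * y) := by
    filter_upwards [hl0, hl1, hlA, evp] with l hl hl1 hlA hev
    obtain ⟨hahalf, hU⟩ := hbasic l hl hl1 hlA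
    have hlA' : A * l ≤ 1 / 2 := by
      rw [lt_div_iff₀ (by positivity)] at hlA; linarith
    set k := 1 + σ2 / 2 * l ^ 2 + 2 * C * l ^ 3 with hk
    have hkp : 0 < k := by linarith [hev.2]
    have hq : Real.exp (- Real.log k) = 1 / k := by rw [Real.exp_neg, Real.exp_log hkp, one_div]
    have key := fun n => lap_lower (f := f) hS (q := Real.exp (- Real.log k)) (m := 1 - A * l) (Real.exp_nonneg _) (by linarith) (Ψ l)
      (fun x y => by
        rw [hq, one_div, inv_mul_le_iff₀ hkp, hk]
        have := (abs_le.1 (hU x y)).2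
        linarith)
      (fun x y => mul_nonneg (by linarith [hahalf x]) (Real.exp_nonneg _))
      (fun x y hy => by
        have h5 := (abs_le.1 (hab l hl.le hl1.le x)).1
        have h6 : 1 ≤ Real.exp (-l * y) := Real.one_le_exp (by nlinarith)
        have h7 := hahalf x
        show 1 - A * l ≤ a l x * Real.exp (-l * y)
        nlinarith) n x y
    obtain ⟨l1, l2⟩ := Bq_lim (f := f) hS hev.1 x y
    have := ((l1.sub l2).const_mul (1 - A * l))
    rw [sub_zero] at this
    exact le_of_tendsto' this key
  have hup : ∀ᶠ l : ℝ in 𝓝[>] 0, a l x * Real.exp (-l * y) ≤ (1 + A * l) * Real.exp (-l * (-M)) * (1 - Hm l) := by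
    filter_upwards [hl0, hl1, hlA, evm] with l hl hl1 hlA hev
    obtain ⟨hahalf, hU⟩ := hbasic l hl hl1 hlA
    set k := 1 + σ2 / 2 * l ^ 2 + -(2 * C) * l ^ 3 with hk
    have hkp : 0 < k := by linarith [hev.2]
    have hq : Real.exp (- Real.log k) = 1 / k := by rw [Real.exp_neg, Real.exp_log hkp, one_div]
    have key := fun n => lap_upper (f := f) hS (q := Real.exp (- Real.log k)) (m := (1 + A * l) * Real.exp (-l * (-M)))
      (Real.exp_nonneg _) hM (Ψ l)
      (fun x y => by
        rw [hq, one_div, ← div_eq_inv_mul, le_div_iff₀ hkp, hk]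
        have := (abs_le.1 (hU x y)).1
        linarith)
      (fun x y hy => by
        have h5 := (abs_le.1 (hab l hl.le hl1.le x)).2
        have h7 := hahalf x
        show a l x * Real.exp (-l * y) ≤ _
        have h6 : Real.exp (-l * y) ≤ Real.exp (-l * (-M)) := Real.exp_le_exp.2 (by nlinarith)
        have h8 : 0 < Real.exp (-l * y) := Real.exp_pos _
        gcongr
        linarith) n x y hy
    obtain ⟨l1, l2⟩ := Bq_lim (f := f) hS hev.1 x y
    exact ge_of_tendsto' (l1.const_mul ((1 + A * l) * Real.exp (-l * (-M)))) key
  -- the limit of the normalized Laplace functional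
  have hHp0 : Tendsto Hp (𝓝[>] 0) (𝓝 0) := by
    have := limp.mul hid
    rw [mul_zero] at this
    refine this.congr' ?_
    filter_upwards [hl0] with l hl
    exact div_mul_cancel₀ _ hl.ne'
  have hexp1 : ∀ d : ℝ, Tendsto (fun l : ℝ => Real.exp (-l * d)) (𝓝[>] 0) (𝓝 1) := by
    intro d
    have : Continuous (fun l : ℝ => Real.exp (-l * d)) := by fun_prop
    simpa using (this.tendsto 0).mono_left (nhdsWithin_le_nhds (s := Set.Ioi 0))
  have hψ : Tendsto (fun l : ℝ => (1 - a l x * Real.exp (-l * y)) / l) (𝓝[>] 0) (𝓝 (y + r x)) := by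
    have l1 : Tendsto (fun l : ℝ => (r x - l * b x) * Real.exp (-l * y)) (𝓝[>] 0) (𝓝 (r x)) := by
      have := ((hid.mul_const (b x)).const_sub (r x)).mul (hexp1 y)
      simpa using this
    refine ((slope_exp y).add l1).congr' ?_
    filter_upwards [hl0] with l hl
    simp only [ha]; field_simp; ring
  have hE : Tendsto (fun l : ℝ => ((1 + A * l) * Real.exp (-l * (-M)) - 1) / l) (𝓝[>] 0) (𝓝 (M + A)) := by
    have l1 := ((slope_exp (-M)).neg).add ((hexp1 (-M)).const_mul A)
    rw [neg_neg, mul_one] at l1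
    refine l1.congr' ?_
    filter_upwards [hl0] with l hl
    field_simp; ring
  have hE1 : Tendsto (fun l : ℝ => (1 + A * l) * Real.exp (-l * (-M))) (𝓝[>] 0) (𝓝 1) := by
    have := ((hid.const_mul A).const_add 1).mul (hexp1 (-M))
    simpa using this
  have c1 : (y + r x) - A * (1 - 0) ≤ v := by
    refine le_of_tendsto_of_tendsto (hψ.sub ((hHp0.const_sub 1).const_mul A)) limp ?_
    filter_upwards [hlow, hl0] with l h5 hl
    show (1 - a l x * Real.exp (-l * y)) / l - A * (1 - Hp l) ≤ Hp l / l
    rw [← sub_nonneg]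
    have : Hp l / l - ((1 - a l x * Real.exp (-l * y)) / l - A * (1 - Hp l)) =
      (a l x * Real.exp (-l * y) - (1 - A * l) * (1 - Hp l)) / l := by field_simp; ring
    rw [this]
    exact div_nonneg (by linarith) hl.le
  have c2 : 1 * v ≤ (M + A) + (y + r x) := by
    refine le_of_tendsto_of_tendsto (hE1.mul limm) (hE.add hψ) ?_
    filter_upwards [hup, hl0] with l h5 hl
    show (1 + A * l) * Real.exp (-l * (-M)) * (Hm l / l) ≤ ((1 + A * l) * Real.exp (-l * (-M)) - 1) / l + (1 - a l x * Real.exp (-l * y)) / l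
    rw [← sub_nonneg]
    have : ((1 + A * l) * Real.exp (-l * (-M)) - 1) / l + (1 - a l x * Real.exp (-l * y)) / l - (1 + A * l) * Real.exp (-l * (-M)) * (Hm l / l) =
      ((1 + A * l) * Real.exp (-l * (-M)) * (1 - Hm l) - a l x * Real.exp (-l * y)) / l := by field_simp; ring
    rw [this]
    exact div_nonneg (by linarith) hl.le
  have := abs_le.1 (hR x)
  rw [abs_le]; constructor <;> linarith
end

/-! ### Part 17 -/

section
variable [Fintype X] [DecidableEq X] [Nonempty X] {P : X → X → ℝ} {ν f : X → ℝ}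

lemma nu_sum_bound (hS : IsStochastic P ν) (a : X → ℝ) (K : ℝ) (h : ∀ x, |a x| ≤ K) :
    |∑ x, ν x * a x| ≤ K := by
  calc _ ≤ ∑ x, ν x * K := by
        refine (Finset.abs_sum_le_sum_abs _ _).trans (Finset.sum_le_sum fun x _ => ?_)
        rw [abs_mul, abs_of_pos (hS.nuPos x)]
        exact mul_le_mul_of_nonneg_left (h x) (hS.nuPos x).le
    _ = K := by rw [← Finset.sum_mul, hS.nuSum, one_mul]

lemma pop_bound (hS : IsStochastic P ν) (a : X → ℝ) (K : ℝ) (h : ∀ x, |a x| ≤ K) (b : X) :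
    |∑ x, P b x * a x| ≤ K := by
  calc _ ≤ ∑ x, P b x * K := by
        refine (Finset.abs_sum_le_sum_abs _ _).trans (Finset.sum_le_sum fun x _ => ?_)
        rw [abs_mul, abs_of_nonneg (hS.nonneg b x)]
        exact mul_le_mul_of_nonneg_left (h x) (hS.nonneg b x)
    _ = K := by rw [← Finset.sum_mul, hS.rowSum, one_mul]

lemma phi_est {w : ℝ → ℝ} (hw : Monotone w) {C : ℝ} (hC : ∀ z, 0 < z → |w z - z| ≤ C) {M T u : ℝ}
    (hT : M < T) (hu : |u - T| ≤ M) :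
    |(∫ v in (0:ℝ)..u, w v) - (∫ v in (0:ℝ)..T, w v) - (u - T) * T| ≤ (C + M) * M := by
  have hi : ∀ a b : ℝ, IntervalIntegrable w volume a b := fun a b => hw.intervalIntegrable
  have hM : 0 ≤ M := (abs_nonneg _).trans hu
  have hC0 : 0 ≤ C := (abs_nonneg _).trans (hC 1 one_pos)
  have e : (∫ v in (0:ℝ)..u, w v) - (∫ v in (0:ℝ)..T, w v) - (u - T) * T = ∫ v in T..u, (w v - T) := by
    rw [intervalIntegral.integral_interval_sub_left (hi _ _) (hi _ _),
      intervalIntegral.integral_sub (hi _ _) intervalIntegrable_const, intervalIntegral.integral_const, smul_eq_mul]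
  rw [e, ← Real.norm_eq_abs]
  have := intervalIntegral.norm_integral_le_of_norm_le_const (a := T) (b := u) (C := C + M) (f := fun v => w v - T) (fun v hv => by
    have h1 : min T u < v ∧ v ≤ max T u := by rw [Set.uIoc] at hv; exact hv
    have h2 := abs_le.1 hu
    have hlo : T - M ≤ min T u := le_min (by linarith) (by linarith)
    have hhi : max T u ≤ T + M := max_le (by linarith) (by linarith)
    have h3 := abs_le.1 (hC v (by linarith))
    rw [Real.norm_eq_abs, abs_le]
    constructor <;> linarith)
  refine this.trans ?_
  gcongr

lemma phi_int_est {w : ℝ → ℝ} (hw : Monotone w) {C : ℝ} (hC : ∀ z, 0 < z → |w z - z| ≤ C) {M T g : ℝ}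
    (hT : M < T) (hg : |g| ≤ M) :
    |(∫ u in T..(T + g), ∫ v in (0:ℝ)..u, w v) - g * (∫ v in (0:ℝ)..T, w v) - g ^ 2 / 2 * T| ≤ (C + M) * M * M := by
  have hi : ∀ a b : ℝ, IntervalIntegrable w volume a b := fun a b => hw.intervalIntegrable
  have hcont : Continuous (fun u : ℝ => ∫ v in (0:ℝ)..u, w v) := intervalIntegral.continuous_primitive hi 0
  have hM : 0 ≤ M := (abs_nonneg _).trans hg
  have hC0 : 0 ≤ C := (abs_nonneg _).trans (hC 1 one_pos)
  have e : (∫ u in T..(T + g), ∫ v in (0:ℝ)..u, w v) - g * (∫ v in (0:ℝ)..T, w v) - g ^ 2 / 2 * T =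
      ∫ u in T..(T+g), ((∫ v in (0:ℝ)..u, w v) - (∫ v in (0:ℝ)..T, w v) - (u - T) * T) := by
    have c2 : Continuous (fun u : ℝ => (u - T) * T) := by fun_prop
    rw [intervalIntegral.integral_sub ((hcont.intervalIntegrable _ _).sub intervalIntegrable_const) (c2.intervalIntegrable _ _),
      intervalIntegral.integral_sub (hcont.intervalIntegrable _ _) intervalIntegrable_const,
      intervalIntegral.integral_const, smul_eq_mul, intervalIntegral.integral_mul_const,
      intervalIntegral.integral_sub (by simp) intervalIntegrable_const, integral_id, intervalIntegral.integral_const, smul_eq_mul]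
    ring
  rw [e, ← Real.norm_eq_abs]
  have := intervalIntegral.norm_integral_le_of_norm_le_const (a := T) (b := T + g) (C := (C + M) * M)
    (f := fun u => (∫ v in (0:ℝ)..u, w v) - (∫ v in (0:ℝ)..T, w v) - (u - T) * T) (fun v hv => by
    have h1 : min T (T + g) < v ∧ v ≤ max T (T + g) := by rw [Set.uIoc] at hv; exact hv
    have h2 := abs_le.1 hg
    have hlo : T - M ≤ min T (T + g) := le_min (by linarith) (by linarith)
    have hhi : max T (T + g) ≤ T + M := max_le (by linarith) (by linarith)
    rw [Real.norm_eq_abs]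
    exact phi_est hw hC hT (abs_le.2 ⟨by linarith, by linarith⟩))
  refine this.trans ?_
  rw [add_sub_cancel_left]
  gcongr

set_option maxHeartbeats 1000000 in
/-- the key identity for the positive harmonic function -/
lemma I_core (hS : IsStochastic P ν) (h1 : Primitive P) (h2 : ∑ x, f x * ν x = 0) (w : X → ℝ → ℝ)
    (hw : ∀ b, Monotone (w b))
    (hh : ∀ b z, 0 < z → w b z = ∑ c, P b c * w c (z + f c)) {C : ℝ}
    (hC : ∀ b z, 0 < z → |w b z - z| ≤ C) :
    ∑ c, ν c * ∫ v in (0:ℝ)..(f c), w c v = sigma2 P ν f / 2 := by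
  obtain ⟨M, hM0, hM⟩ := exists_bound f
  obtain ⟨r, hr⟩ := poisson hS h1 (Pop P f) (nu_Pf hS h2)
  obtain ⟨h, hhd⟩ := poisson (dual_stoch hS) (dual_prim hS h1) f h2
  obtain ⟨H, hH0, hH⟩ := exists_bound h
  have hσ := sigma2_eq hS h1 h2 r hr
  set Φ : X → ℝ → ℝ := fun c u => ∫ v in (0:ℝ)..u, w c v with hΦ
  set I := ∑ c, ν c * Φ c (f c) with hI
  show I = _
  have hi : ∀ c, ∀ a b : ℝ, IntervalIntegrable (w c) volume a b := fun c a b => (hw c).intervalIntegrable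
  have hcont : ∀ c, Continuous (Φ c) := fun c => intervalIntegral.continuous_primitive (hi c) 0
  have hrec : ∀ b L, 0 ≤ L → Φ b L = ∑ c, P b c * (Φ c (L + f c) - Φ c (f c)) := by
    intro b L hL
    have e1 : Φ b L = ∫ z in (0:ℝ)..L, ∑ c, P b c * w c (z + f c) := by
      refine intervalIntegral.integral_congr_uIoo fun z hz => ?_
      rw [Set.uIoo_of_le hL] at hz
      exact hh b z hz.1
    have hi' : ∀ c, IntervalIntegrable (fun z => w c (z + f c)) volume 0 L := fun c =>
      Monotone.intervalIntegrable (fun a b hab => hw c (by linarith))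
    have hi2 : ∀ c ∈ Finset.univ, IntervalIntegrable (fun z => P b c * w c (z + f c)) volume 0 L :=
      fun c _ => (hi' c).const_mul (P b c)
    rw [e1, intervalIntegral.integral_finsetSum hi2]
    refine Finset.sum_congr rfl fun c _ => ?_
    rw [intervalIntegral.integral_const_mul, intervalIntegral.integral_comp_add_right, zero_add,
      intervalIntegral.integral_interval_sub_left (hi _ _ _) (hi _ _ _)]
  have hIL : ∀ L, 0 ≤ L → I = ∑ c, ν c * (Φ c (L + f c) - Φ c L) := by
    intro L hL
    have e1 : ∑ b, ν b * Φ b L = ∑ c, ν c * (Φ c (L + f c) - Φ c (f c)) := by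
      calc _ = ∑ b, ν b * ∑ c, P b c * (Φ c (L + f c) - Φ c (f c)) := Finset.sum_congr rfl fun b _ => by rw [hrec b L hL]
        _ = _ := by
          simp only [Finset.mul_sum]
          rw [Finset.sum_comm]
          refine Finset.sum_congr rfl fun c _ => ?_
          rw [← hS.nuInv c, Finset.sum_mul]
          exact Finset.sum_congr rfl fun b _ => by ring
    simp only [mul_sub, Finset.sum_sub_distrib] at e1 ⊢
    rw [hI]; linarith
  obtain ⟨K0, hK00, hK0⟩ := exists_bound (fun c => ∫ u in M..(M + f c), Φ c u)
  obtain ⟨K1, hK10, hK1⟩ := exists_bound (fun c => Φ c (f c))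
  set K := M * |I| + ((C + M) * M * M + K0) + H * ((C + M) * M + K1) with hK
  have hmain : ∀ T, M < T → |T * (I - sigma2 P ν f / 2)| ≤ K := by
    intro T hT
    have a1 : (T - M) * I = ∑ c, ν c * ((∫ u in T..(T + f c), Φ c u) - ∫ u in M..(M + f c), Φ c u) := by
      have e1 : ∫ L in M..T, I = ∫ L in M..T, ∑ c, ν c * (Φ c (L + f c) - Φ c L) := by
        refine intervalIntegral.integral_congr fun L hL => ?_
        rw [Set.uIcc_of_le hT.le] at hL
        exact hIL L (hM0.le.trans hL.1)
      rw [intervalIntegral.integral_const, smul_eq_mul] at e1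
      have hc' : ∀ c, Continuous (fun L : ℝ => Φ c (L + f c)) := fun c => (hcont c).comp (continuous_add_const (f c))
      have hi3 : ∀ c ∈ Finset.univ, IntervalIntegrable (fun L => ν c * (Φ c (L + f c) - Φ c L)) volume M T :=
        fun c _ => (((hc' c).sub (hcont c)).const_mul (ν c)).intervalIntegrable _ _
      rw [e1, intervalIntegral.integral_finsetSum hi3]
      refine Finset.sum_congr rfl fun c _ => ?_
      rw [intervalIntegral.integral_const_mul, intervalIntegral.integral_sub ((hc' c).intervalIntegrable _ _) ((hcont c).intervalIntegrable _ _),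
        intervalIntegral.integral_comp_add_right (fun L => Φ c L),
        intervalIntegral.integral_interval_sub_interval_comm' ((hcont c).intervalIntegrable _ _) ((hcont c).intervalIntegrable _ _) ((hcont c).intervalIntegrable _ _)]
    -- first expansion
    set E1 : X → ℝ := fun c => (∫ u in T..(T + f c), Φ c u) - f c * Φ c T - f c ^ 2 / 2 * T - ∫ u in M..(M + f c), Φ c u with hE1
    have b1 : |∑ c, ν c * E1 c| ≤ (C + M) * M * M + K0 := by
      refine nu_sum_bound hS E1 _ fun c => ?_
      exact (abs_sub _ _).trans (add_le_add (phi_int_est (hw c) (hC c) hT (hM c)) (hK0 c))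
    have a2 : (T - M) * I = ∑ c, f c * Φ c T * ν c + T / 2 * ∑ c, f c ^ 2 * ν c + ∑ c, ν c * E1 c := by
      rw [a1, Finset.mul_sum, ← Finset.sum_add_distrib, ← Finset.sum_add_distrib]
      refine Finset.sum_congr rfl fun c _ => ?_
      simp only [hE1]; ring
    -- second expansion
    set E2 : X → ℝ := fun b => Φ b T - Pop P (fun c => Φ c T) b - T * Pop P f b with hE2
    have b2 : ∀ b, |E2 b| ≤ (C + M) * M + K1 := by
      intro b
      have e : E2 b = ∑ c, P b c * ((Φ c (T + f c) - Φ c T - (T + f c - T) * T) - Φ c (f c)) := by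
        simp only [hE2]
        rw [hrec b T (hM0.le.trans hT.le)]
        unfold Pop
        rw [Finset.mul_sum, ← Finset.sum_sub_distrib, ← Finset.sum_sub_distrib]
        exact Finset.sum_congr rfl fun c _ => by ring
      rw [e]
      refine pop_bound hS _ _ (fun c => ?_) b
      refine (abs_sub _ _).trans (add_le_add (phi_est (hw c) (hC c) hT ?_) (hK1 c))
      rw [add_sub_cancel_left]; exact hM c
    have b2' : |∑ b, ν b * (h b * E2 b)| ≤ H * ((C + M) * M + K1) := by
      refine nu_sum_bound hS _ _ fun b => ?_
      rw [abs_mul]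
      exact mul_le_mul (hH b) (b2 b) (abs_nonneg _) hH0.le
    have a3 : ∀ q : X → ℝ, ∑ c, f c * q c * ν c = ∑ c, h c * (q c - Pop P q c) * ν c := by
      intro q
      have := dual_pair hS q h
      have e : ∑ c, f c * q c * ν c = ∑ c, h c * q c * ν c - ∑ c, q c * Pop (dualK P ν) h c * ν c := by
        rw [← Finset.sum_sub_distrib]
        refine Finset.sum_congr rfl fun c _ => ?_
        rw [← hhd c]; ring
      rw [e, ← this, ← Finset.sum_sub_distrib]
      exact Finset.sum_congr rfl fun c _ => by ring
    have a4 : ∑ c, f c * Φ c T * ν c = T * ∑ c, f c * r c * ν c + ∑ b, ν b * (h b * E2 b) := by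
      rw [a3 (fun c => Φ c T), a3 r, Finset.mul_sum, ← Finset.sum_add_distrib]
      refine Finset.sum_congr rfl fun c _ => ?_
      simp only [hE2]
      rw [hr c]; ring
    have a5 : T * (I - sigma2 P ν f / 2) = M * I + ∑ c, ν c * E1 c + ∑ b, ν b * (h b * E2 b) := by
      rw [hσ]; rw [a4] at a2; linarith
    rw [a5, hK]
    refine (abs_add_le _ _).trans (add_le_add ((abs_add_le _ _).trans (add_le_add ?_ b1)) b2')
    rw [abs_mul, abs_of_pos hM0]
  by_contra hne
  have hd : 0 < |I - sigma2 P ν f / 2| := abs_pos.2 (sub_ne_zero.2 hne)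
  set T := M + 1 + (|K| + 1) / |I - sigma2 P ν f / 2| with hTdef
  have hT0 : 0 < (|K| + 1) / |I - sigma2 P ν f / 2| := by positivity
  have := hmain T (by linarith)
  rw [abs_mul, abs_of_pos (by linarith)] at this
  have e : (|K| + 1) / |I - sigma2 P ν f / 2| * |I - sigma2 P ν f / 2| = |K| + 1 := div_mul_cancel₀ _ hd.ne'
  have := le_abs_self K
  rw [hTdef] at *
  nlinarith
end

/-! ### Part 18 -/

section
variable [Fintype X] [DecidableEq X] [Nonempty X] {P : X → X → ℝ} {ν f : X → ℝ}

lemma sqrt_ratio_tendsto : Tendsto (fun n : ℕ => √((n + 1 : ℕ) : ℝ) / √(n : ℝ)) atTop (𝓝 1) := by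
  have h : Tendsto (fun n : ℕ => ((n : ℝ) + 1) / n) atTop (𝓝 1) := by
    have := (tendsto_one_div_atTop_nhds_zero_nat (𝕜 := ℝ)).const_add 1
    rw [add_zero] at this
    refine this.congr' ?_
    filter_upwards [eventually_gt_atTop 0] with n hn
    have : (n : ℝ) ≠ 0 := by positivity
    field_simp
  have h2 := (Real.continuous_sqrt.tendsto 1).comp h
  rw [Real.sqrt_one] at h2
  refine h2.congr fun n => ?_
  simp only [Function.comp_apply]
  rw [Real.sqrt_div' _ (Nat.cast_nonneg n)]
  push_cast
  rfl

lemma lim_harm {c : X → ℝ → ℝ}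
    (h : ∀ x y, Tendsto (fun n : ℕ => √(n : ℝ) * surv P f n x y) atTop (𝓝 (c x y))) (b : X) (z : ℝ) :
    c b z = ∑ a, P b a * (ind (0 < z + f a) * c a (z + f a)) := by
  have h1 := (tendsto_add_atTop_iff_nat 1).2 (h b z)
  have h2 : Tendsto (fun n : ℕ => (√((n + 1 : ℕ) : ℝ) / √(n : ℝ)) *
      ∑ a, P b a * (ind (0 < z + f a) * (√(n : ℝ) * surv P f n a (z + f a)))) atTop
      (𝓝 (1 * ∑ a, P b a * (ind (0 < z + f a) * c a (z + f a)))) :=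
    sqrt_ratio_tendsto.mul (tendsto_finsetSum _ fun a _ => ((h a (z + f a)).const_mul _).const_mul _)
  rw [one_mul] at h2
  refine tendsto_nhds_unique h1 (h2.congr' ?_)
  filter_upwards [eventually_gt_atTop 0] with n hn
  have hn' : √(n : ℝ) ≠ 0 := by positivity
  rw [surv_succ, Ko_apply, Finset.mul_sum, Finset.mul_sum]
  refine Finset.sum_congr rfl fun a _ => ?_
  field_simp

lemma I_gen (hS : IsStochastic P ν) (h1 : Primitive P) (h2 : ∑ x, f x * ν x = 0)
    (hσ : 0 < sigma2 P ν f) {c : X → ℝ → ℝ}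
    (h : ∀ x y, Tendsto (fun n : ℕ => √(n : ℝ) * surv P f n x y) atTop (𝓝 (c x y)))
    {k : ℝ} (hk : k = √(sigma2 P ν f) * √(2 * π) / 2) :
    ∫ z in Set.Ioi (0:ℝ), ∑ b, ν b * ∑ a, P b a * (k * c a z * ind (z ≤ f a)) = sigma2 P ν f / 2 := by
  have hk0 : 0 < k := by rw [hk]; positivity
  have hc0 : ∀ x y, 0 ≤ c x y := fun x y => ge_of_tendsto' (h x y) fun n =>
    mul_nonneg (Real.sqrt_nonneg _) (surv_nonneg (f := f) hS n x y)
  have hcm : ∀ x, Monotone (c x) := fun x y y' hy => le_of_tendsto_of_tendsto' (h x y) (h x y') fun n =>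
    mul_le_mul_of_nonneg_left (surv_mono hS n x hy) (Real.sqrt_nonneg _)
  obtain ⟨C, hC⟩ := V_bound hS h1 h2 hσ h
  set w : X → ℝ → ℝ := fun a z => ind (0 < z) * (k * c a z) with hw
  have hwm : ∀ a, Monotone (w a) := by
    intro a y y' hy
    simp only [hw]
    by_cases h0 : 0 < y
    · rw [ind_true h0, ind_true (h0.trans_le hy), one_mul, one_mul]
      exact mul_le_mul_of_nonneg_left (hcm a hy) hk0.le
    · rw [ind_false h0, zero_mul]
      exact mul_nonneg (ind_nonneg _) (mul_nonneg hk0.le (hc0 _ _))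
  have key := I_core (C := C) hS h1 h2 w hwm (fun b z hz => by
      simp only [hw]
      rw [ind_true hz, one_mul, lim_harm h b z, Finset.mul_sum]
      exact Finset.sum_congr rfl fun a _ => by ring) (fun b z hz => by
      simp only [hw]
      rw [ind_true hz, one_mul, hk]; exact hC b z hz)
  rw [← key]
  have e1 : ∀ z, ∑ b, ν b * ∑ a, P b a * (k * c a z * ind (z ≤ f a)) = ∑ a, ν a * (k * c a z * ind (z ≤ f a)) := by
    intro z
    simp only [Finset.mul_sum]
    rw [Finset.sum_comm]
    refine Finset.sum_congr rfl fun a _ => ?_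
    rw [← hS.nuInv a, Finset.sum_mul]
    exact Finset.sum_congr rfl fun b _ => by ring
  simp only [e1]
  have e2 : ∀ a z, k * c a z * ind (z ≤ f a) = (Set.Iic (f a)).indicator (fun z => k * c a z) z := by
    intro a z
    by_cases hz : z ≤ f a
    · rw [ind_true hz, Set.indicator_of_mem (by exact hz), mul_one]
    · rw [ind_false hz, Set.indicator_of_notMem (by exact hz), mul_zero]
  have hii : ∀ a, IntegrableOn (fun z => k * c a z) (Set.Ioi 0 ∩ Set.Iic (f a)) := by
    intro a
    rw [Set.Ioi_inter_Iic]
    have hm : Monotone (fun z => k * c a z) := fun y y' hy => mul_le_mul_of_nonneg_left (hcm a hy) hk0.le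
    exact (hm.intervalIntegrable (a := 0) (b := f a) (μ := volume)).1
  have e3 : ∀ a, IntegrableOn (fun z => k * c a z * ind (z ≤ f a)) (Set.Ioi 0) := by
    intro a
    simp only [e2]
    rw [IntegrableOn, integrable_indicator_iff measurableSet_Iic, IntegrableOn, Measure.restrict_restrict measurableSet_Iic,
      Set.inter_comm]
    exact hii a
  rw [integral_finsetSum _ (fun a _ => (e3 a).const_mul (ν a))]
  refine Finset.sum_congr rfl fun a _ => ?_
  rw [integral_const_mul]
  congr 1
  simp only [e2]
  rw [setIntegral_indicator measurableSet_Iic, Set.Ioi_inter_Iic]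
  by_cases ha : 0 ≤ f a
  · rw [intervalIntegral.integral_of_le ha]
    refine setIntegral_congr_fun measurableSet_Ioc fun z hz => ?_
    simp only [hw]
    rw [ind_true hz.1, one_mul]
  · push Not at ha
    rw [Set.Ioc_eq_empty (by linarith), setIntegral_empty, intervalIntegral.integral_of_ge ha.le]
    rw [setIntegral_congr_fun (g := fun _ => (0:ℝ)) measurableSet_Ioc (fun z hz => by
      simp only [hw]
      rw [ind_false (by linarith [hz.2]), zero_mul])]
    simp

lemma shift_tendsto {e : ℕ → ℝ} {l : ℝ} (h : Tendsto (fun n : ℕ => (n : ℝ) * √(n : ℝ) * e n) atTop (𝓝 l)) :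
    Tendsto (fun n : ℕ => ((n + 1 : ℕ) : ℝ) ^ (3 / 2 : ℝ) * e n) atTop (𝓝 l) := by
  have h3 : Tendsto (fun n : ℕ => (√((n + 1 : ℕ) : ℝ) / √(n : ℝ)) ^ 3 * ((n : ℝ) * √(n : ℝ) * e n)) atTop (𝓝 (1 ^ 3 * l)) :=
    (sqrt_ratio_tendsto.pow 3).mul h
  rw [one_pow, one_mul] at h3
  refine h3.congr' ?_
  filter_upwards [eventually_gt_atTop 0] with n hn
  have hn' : √(n : ℝ) ≠ 0 := by positivity
  have e1 : ((n + 1 : ℕ) : ℝ) ^ (3 / 2 : ℝ) = √((n + 1 : ℕ) : ℝ) ^ 3 := by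
    rw [Real.sqrt_eq_rpow, ← Real.rpow_natCast, ← Real.rpow_mul (by positivity)]
    norm_num
  have e2 : (n : ℝ) * √(n : ℝ) = √(n : ℝ) ^ 3 := by
    rw [pow_succ, Real.sq_sqrt (Nat.cast_nonneg n)]
  rw [e1, e2, div_pow]
  field_simp

end

theorem main_aux [Fintype X] [DecidableEq X] [Nonempty X] (P : X → X → ℝ) (ν f : X → ℝ)
    (hS : IsStochastic P ν) (h1 : Primitive P) (h2 : ∑ x, f x * ν x = 0) (h3 : NonLattice P f)
    (V : X → ℝ → ℝ)
    (hV : ∀ x y, Tendsto (fun n : ℕ => √(sigma2 P ν f) * √(2 * π * n) / 2 *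
      Ex P x n (fun ω => ind (survives f y n ω))) atTop (nhds (V x y)))
    (Vs : X → ℝ → ℝ)
    (hVs : ∀ x z, Tendsto (fun n : ℕ => √(sigma2 P ν f) * √(2 * π * n) / 2 *
      Ex (dualK P ν) x n (fun ω => ind (survives (fun b => -f b) z n ω))) atTop (nhds (Vs x z))) :
    ∀ x y, Tendsto (fun n : ℕ => (n : ℝ) ^ (3 / 2 : ℝ) *
      Ex P x n (fun ω => ind (survives f y (n - 1) ω ∧ y + Spath f ω n ≤ 0))) atTop
      (nhds (2 * V x y / (√(2 * π) * √(sigma2 P ν f) ^ 3) *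
        ∫ z in Set.Ioi (0:ℝ), ∑ b, ν b * Ex (dualK P ν) b 1
          (fun ωs => Vs (ωs 1) z * ind (z ≤ Spath (fun u => -f u) ωs 1)))) := by
  intro x y
  have hσ := sigma2_pos hS h1 h2 h3
  have hs : 0 < √(sigma2 P ν f) := Real.sqrt_pos.2 hσ
  have hp : 0 < √(2 * π) := by positivity
  simp only [Ex_survives] at hV hVs
  have h : ∀ x y, Tendsto (fun n : ℕ => √(n : ℝ) * surv P f n x y) atTop (𝓝 (2 * V x y / (√(sigma2 P ν f) * √(2 * π)))) :=
    fun x y => sqrt_surv_tendsto hs x y (hV x y)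
  have hd : ∀ x y, Tendsto (fun n : ℕ => √(n : ℝ) * surv (dualK P ν) (fun b => -f b) n x y) atTop
      (𝓝 (2 * Vs x y / (√(sigma2 P ν f) * √(2 * π)))) :=
    fun x y => sqrt_surv_tendsto hs x y (hVs x y)
  have hσd := sigma2_dual hS h1 h2
  have hI := I_gen (dual_stoch hS) (dual_prim hS h1) (f := fun b => -f b)
    (by simp only [neg_mul, Finset.sum_neg_distrib, h2, neg_zero]) (by rw [hσd]; exact hσ) hd rfl
  rw [hσd] at hI
  have e : ∀ a z, √(sigma2 P ν f) * √(2 * π) / 2 * (2 * Vs a z / (√(sigma2 P ν f) * √(2 * π))) = Vs a z := by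
    intro a z; field_simp
  simp only [e] at hI
  simp only [Ex_one_int]
  rw [hI]
  have hlim := shift_tendsto (exi_tendsto hS h1 h2 h3 h hd x y)
  have e2 : 2 * V x y / (√(2 * π) * √(sigma2 P ν f) ^ 3) * (sigma2 P ν f / 2) =
      2 * V x y / (√(sigma2 P ν f) * √(2 * π)) / 2 := by
    conv_lhs => rw [← Real.sq_sqrt hσ.le]
    rw [Real.sqrt_sq hs.le]
    field_simp
  rw [e2, ← tendsto_add_atTop_iff_nat 1]
  refine hlim.congr fun n => ?_
  rw [← Ex_exit]
  rfl

/-- Theorem 2.8: local limit theorem for the exit time. -/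
theorem exit_time_local_limit [Fintype X] [DecidableEq X] [Nonempty X]
    (P : X → X → ℝ) (ν f : X → ℝ) (hS : IsStochastic P ν)
    (h1 : Primitive P) (h2 : ∑ x, f x * ν x = 0) (h3 : NonLattice P f)
    (V : X → ℝ → ℝ)
    (hV : ∀ (x : X) (y : ℝ),
      Tendsto (fun n : ℕ =>
          Real.sqrt (sigma2 P ν f) * Real.sqrt (2 * π * n) / 2 *
            Ex P x n (fun ω => ind (survives f y n ω)))
        atTop (nhds (V x y)))
    (Vs : X → ℝ → ℝ)
    (hVs : ∀ (x : X) (z : ℝ),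
      Tendsto (fun n : ℕ =>
          Real.sqrt (sigma2 P ν f) * Real.sqrt (2 * π * n) / 2 *
            Ex (dualK P ν) x n (fun ω => ind (survives (fun b => -f b) z n ω)))
        atTop (nhds (Vs x z))) :
    ∀ (x : X) (y : ℝ),
      Tendsto (fun n : ℕ => (n : ℝ) ^ (3 / 2 : ℝ) *
          Ex P x n (fun ω => ind (survives f y (n - 1) ω ∧ y + Spath f ω n ≤ 0)))
        atTop
        (nhds (2 * V x y / (Real.sqrt (2 * π) * Real.sqrt (sigma2 P ν f) ^ 3) *
          ∫ z in Set.Ioi (0 : ℝ), ∑ b, ν b *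
            Ex (dualK P ν) b 1 (fun ωs =>
              Vs (ωs 1) z * ind (z ≤ Spath (fun u => -f u) ωs 1)))) :=
  main_aux P ν f hS h1 h2 h3 V hV Vs hVs
end CLLT
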